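/- On $\mathbb{R}^2$ consider the inhomogeneous incompressible Navier–Stokes system $$\partial_t\rho+u\cdot\nabla\rho=0,\qquad \rho\,\partial_tu+\rho(u\cdot\nabla)u-\Delta u+\nabla\Pi=0,\qquad \operatorname{div}u=0,\qquad (\rho,u)|_{t=0}=(\rho_0,u_0).$$ There is an increasing function $\mathcal C:\mathbb{R}\to\mathbb{R}$ with the following property. Let $(\rho,u,\nabla\Pi)$, with $\rho>0$, be a global solution on $[0,\infty)\times\mathbb{R}^2$ such that $\rho-1$, $u$ and $\nabla\Pi$ are smooth in time on $[0,\infty)$ with values in every Sobolev space $H^m(\mathbb{R}^2)$, and suppose that $$U_0:=\int_{\mathbb{R}^2}|x|\,|u_0(x)|\,dx<\infty,\qquad \int_{\mathbb{R}^2}\rho_0u_0\,dx=0,\qquad \tfrac34\le\rho_0\le\tfrac54 .$$ Put $E_0=\int_{\mathbb{R}^2}\rho_0|u_0|^2dx$, $E_1=\|\nabla u_0\|_{L^2}^2$, $E_2=\|\sqrt{\rho_0}\,\partial_tu|_{t=0}\|_{L^2}^2+\|\nabla u_0\|_{L^2}^4$ and $$T_2=\max\Big\{\frac{U_0}{E_0},\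 \|\rho_0-1\|_{L^2}^2,\ \frac{E_0}{E_1},\ \frac{E_2}{E_1}\Big\}$$ (if $u_0=0$, the quotients are read as $0$, and both sides of the inequality below vanish). Then for every $T\ge T_2$ and every $t\ge0$ $$\|\partial_tu(t)\|_{L^2}+\|\nabla^2u(t)\|_{L^2}+\|\nabla\Pi(t)\|_{L^2}\le \mathcal C(E_0)\,E_2^{1/2}\,\Big(e+\frac tT\Big)^{-2}$$ (where $t/T$ is read as $0$ if $T=0$, which can only occur for $u_0=0$). -/

import Mathlib

open MeasureTheory Set Filter Topology
open scoped ENNReal ContDiff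

namespace INS2D

noncomputable section

/-- The plane `ℝ²` with its Euclidean norm. -/
abbrev Plane : Type := EuclideanSpace ℝ (Fin 2)

/-- The `i`-th canonical basis vector of `ℝ²`. -/
def basisVec (i : Fin 2) : Plane := EuclideanSpace.single i 1

section Operators

variable {F : Type*} [NormedAddCommGroup F] [NormedSpace ℝ F]

/-- The spatial gradient `∇f = (∂₁f, ∂₂f)`. Its norm is `|∇f|² = |∂₁f|² + |∂₂f|²`, so that for a vector
field it is the Frobenius norm of the Jacobian matrix; the tensor `∇²f` of second derivatives is
`grad (grad f)`, with `|∇²f|² = ∑ᵢⱼ |∂ᵢ∂ⱼf|²`. -/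
def grad (f : Plane → F) (x : Plane) : PiLp 2 (fun _ : Fin 2 => F) :=
  WithLp.toLp 2 (fun i => fderiv ℝ f x (basisVec i))

/-- The spatial Laplacian `Δf = ∂₁∂₁f + ∂₂∂₂f`. -/
def lap (f : Plane → F) (x : Plane) : F :=
  ∑ i, iteratedFDeriv ℝ 2 f x (fun _ => basisVec i)

/-- The divergence of a vector field on `ℝ²`. -/
def divg (f : Plane → Plane) (x : Plane) : ℝ := ∑ i, fderiv ℝ f x (basisVec i) i

/-- The time derivative `∂ₜf` of a function on `[0,∞) × ℝ²` (one-sided at `t = 0`). -/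
def tderiv (f : ℝ → Plane → F) (t : ℝ) (x : Plane) : F :=
  derivWithin (fun s => f s x) (Ici 0) t

/-- The `L²(ℝ²)` norm, as a real number. -/
def l2 {G : Type*} [NormedAddCommGroup G] (f : Plane → G) : ℝ := (eLpNorm f 2 volume).toReal

/-- `f` is smooth in time on `[0,∞)` with values in every Sobolev space `Hᵐ(ℝ²)`: it is (classically)
smooth on `[0,∞) × ℝ²`, and each derivative `∇ᵐ∂ₜʲf(t)` belongs to `L²(ℝ²)` and depends continuously
on `t ∈ [0,∞)` in the `L²(ℝ²)` norm. -/
structure SobolevSmooth (f : ℝ → Plane → F) : Prop where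
  smooth : ContDiffOn ℝ ∞ (fun q : ℝ × Plane => f q.1 q.2) (Ici 0 ×ˢ univ)
  memLp : ∀ j m : ℕ, ∀ t : ℝ, 0 ≤ t →
    MemLp (fun x => iteratedFDeriv ℝ m (tderiv^[j] f t) x) 2 volume
  continuous : ∀ j m : ℕ, ∀ t₀ : ℝ, 0 ≤ t₀ →
    Tendsto (fun t => eLpNorm (fun x => iteratedFDeriv ℝ m (tderiv^[j] f t) x
      - iteratedFDeriv ℝ m (tderiv^[j] f t₀) x) 2 volume) (𝓝[Ici 0] t₀) (𝓝 0)

end Operators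

/-- `(ρ, u, ∇P)` is a smooth global solution, on `[0,∞) × ℝ²`, of the two-dimensional inhomogeneous
incompressible Navier–Stokes system, where `ρ - 1`, `u` and `∇P` are smooth in time with values in
every Sobolev space. The initial data are `ρ 0` and `u 0`. -/
structure IsSmoothSolution (ρ : ℝ → Plane → ℝ) (u : ℝ → Plane → Plane) (P : ℝ → Plane → ℝ) :
    Prop where
  regular_rho : SobolevSmooth (fun t x => ρ t x - 1)
  regular_u : SobolevSmooth u
  differentiable_P : ∀ t : ℝ, 0 ≤ t → Differentiable ℝ (P t)
  regular_gradP : SobolevSmooth (fun t x => gradient (P t) x)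
  rho_pos : ∀ t : ℝ, 0 ≤ t → ∀ x, 0 < ρ t x
  mass : ∀ t : ℝ, 0 ≤ t → ∀ x, tderiv ρ t x + fderiv ℝ (ρ t) x (u t x) = 0
  momentum : ∀ t : ℝ, 0 ≤ t → ∀ x,
    ρ t x • tderiv u t x + ρ t x • fderiv ℝ (u t) x (u t x) - lap (u t) x + gradient (P t) x = 0
  incompressible : ∀ t : ℝ, 0 ≤ t → ∀ x, divg (u t) x = 0

/-- The conditions on the initial data: `∫ |x||u₀| dx < ∞`, `∫ ρ₀u₀ dx = 0`, `3/4 ≤ ρ₀ ≤ 5/4`. -/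
structure AdmissibleData (ρ₀ : Plane → ℝ) (u₀ : Plane → Plane) : Prop where
  moment : Integrable (fun x => ‖x‖ * ‖u₀ x‖) volume
  mean_zero : ∫ x, ρ₀ x • u₀ x = 0
  density : ∀ x, 3 / 4 ≤ ρ₀ x ∧ ρ₀ x ≤ 5 / 4

/-- `U₀ = ∫ |x||u₀(x)| dx`. -/
def U0 (u : ℝ → Plane → Plane) : ℝ := ∫ x, ‖x‖ * ‖u 0 x‖

/-- `E₀ = ∫ ρ₀|u₀|² dx`. -/
def E0 (ρ : ℝ → Plane → ℝ) (u : ℝ → Plane → Plane) : ℝ := ∫ x, ρ 0 x * ‖u 0 x‖ ^ 2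

/-- `E₁ = ‖∇u₀‖²_{L²}`. -/
def E1 (u : ℝ → Plane → Plane) : ℝ := l2 (grad (u 0)) ^ 2

/-- `E₂ = ‖√ρ₀ ∂ₜu|_{t=0}‖²_{L²} + ‖∇u₀‖⁴_{L²}`. -/
def E2 (ρ : ℝ → Plane → ℝ) (u : ℝ → Plane → Plane) : ℝ :=
  l2 (fun x => Real.sqrt (ρ 0 x) • tderiv u 0 x) ^ 2 + l2 (grad (u 0)) ^ 4

/-- `T₀ = max{U₀/E₀, ‖ρ₀ - 1‖²_{L²}}`. -/
def T0 (ρ : ℝ → Plane → ℝ) (u : ℝ → Plane → Plane) : ℝ :=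
  max (U0 u / E0 ρ u) (l2 (fun x => ρ 0 x - 1) ^ 2)

/-- `T₁ = max{T₀, E₀/E₁}`. -/
def T1 (ρ : ℝ → Plane → ℝ) (u : ℝ → Plane → Plane) : ℝ := max (T0 ρ u) (E0 ρ u / E1 u)

/-- `T₂ = max{T₁, E₂/E₁}`. -/
def T2 (ρ : ℝ → Plane → ℝ) (u : ℝ → Plane → Plane) : ℝ := max (T1 ρ u) (E2 ρ u / E1 u)

/-- `⟨t⟩_T = e + t/T`. -/
def bracket (T t : ℝ) : ℝ := Real.exp 1 + t / T

end

end INS2D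

open scoped NNReal

namespace INS2D

noncomputable section

section Calculus

variable {F : Type*} [NormedAddCommGroup F] [NormedSpace ℝ F]

/-- The spatial partial derivative `∂ᵢf` of a time-dependent function. -/
def dx (i : Fin 2) (f : ℝ → Plane → F) (t : ℝ) (x : Plane) : F :=
  fderiv ℝ (f t) x (basisVec i)

/-- Classical smoothness on `[0,∞) × ℝ²`. -/
def Smooth (f : ℝ → Plane → F) : Prop :=
  ContDiffOn ℝ ∞ (fun q : ℝ × Plane => f q.1 q.2) (Ici 0 ×ˢ univ)

theorem uniqueDiffOn_halfSpace : UniqueDiffOn ℝ ((Ici 0 : Set ℝ) ×ˢ (univ : Set Plane)) :=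
  (uniqueDiffOn_Ici 0).prod uniqueDiffOn_univ

/-- The directional derivative within `[0,∞) × ℝ²`. -/
def ddir (v : ℝ × Plane) (f : ℝ → Plane → F) (t : ℝ) (x : Plane) : F :=
  fderivWithin ℝ (fun q : ℝ × Plane => f q.1 q.2) (Ici 0 ×ˢ univ) (t, x) v

variable {f g : ℝ → Plane → F} {t : ℝ}

theorem Smooth.congr (hf : Smooth f) (h : ∀ t, 0 ≤ t → f t = g t) : Smooth g :=
  ContDiffOn.congr hf fun q hq => by rw [h q.1 hq.1]

theorem Smooth.differentiableWithinAt (hf : Smooth f) (ht : 0 ≤ t) (x : Plane) :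
    DifferentiableWithinAt ℝ (fun q : ℝ × Plane => f q.1 q.2) (Ici 0 ×ˢ univ) (t, x) :=
  (hf.differentiableOn (by simp)) (t, x) ⟨ht, mem_univ _⟩

theorem Smooth.smooth_ddir (hf : Smooth f) (v : ℝ × Plane) : Smooth (ddir v f) := by
  have h : ContDiffOn ℝ ∞ (fderivWithin ℝ (fun q : ℝ × Plane => f q.1 q.2) (Ici 0 ×ˢ univ))
      (Ici 0 ×ˢ univ) := ContDiffOn.fderivWithin hf uniqueDiffOn_halfSpace (by simp)
  exact h.clm_apply contDiffOn_const

theorem Smooth.hasDerivWithinAt_ddir (hf : Smooth f) (ht : 0 ≤ t) (x : Plane) :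
    HasDerivWithinAt (fun s => f s x) (ddir (1, 0) f t x) (Ici 0) t := by
  have h1 := (hf.differentiableWithinAt ht x).hasFDerivWithinAt
  have h2 : HasDerivWithinAt (fun s : ℝ => ((s, x) : ℝ × Plane)) (1, 0) (Ici 0) t :=
    (hasDerivWithinAt_id t _).prodMk (hasDerivWithinAt_const t _ x)
  have hm : MapsTo (fun s : ℝ => ((s, x) : ℝ × Plane)) (Ici 0) (Ici 0 ×ˢ univ) :=
    fun s hs => ⟨hs, mem_univ _⟩
  exact HasFDerivWithinAt.comp_hasDerivWithinAt (x := t) h1 h2 hm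

theorem Smooth.hasFDerivAt_slice (hf : Smooth f) (ht : 0 ≤ t) (x : Plane) :
    HasFDerivAt (f t) ((fderivWithin ℝ (fun q : ℝ × Plane => f q.1 q.2) (Ici 0 ×ˢ univ) (t, x)).comp
      (ContinuousLinearMap.inr ℝ ℝ Plane)) x := by
  have h1 := (hf.differentiableWithinAt ht x).hasFDerivWithinAt
  have h2 : HasFDerivWithinAt (fun z : Plane => ((t, z) : ℝ × Plane))
      (ContinuousLinearMap.inr ℝ ℝ Plane) univ x :=
    ((hasFDerivAt_const t x).prodMk (hasFDerivAt_id x)).hasFDerivWithinAt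
  have := HasFDerivWithinAt.comp x h1 h2 (fun s _ => ⟨ht, mem_univ _⟩)
  exact this.hasFDerivAt univ_mem

theorem Smooth.tderiv_eq (hf : Smooth f) (ht : 0 ≤ t) : tderiv f t = ddir (1, 0) f t := by
  ext1 x
  exact (hf.hasDerivWithinAt_ddir ht x).derivWithin (uniqueDiffOn_Ici 0 t ht)

theorem Smooth.dx_eq (hf : Smooth f) (i : Fin 2) (ht : 0 ≤ t) :
    dx i f t = ddir (0, basisVec i) f t := by
  ext1 x
  simp [dx, (hf.hasFDerivAt_slice ht x).fderiv, ddir]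

theorem Smooth.smooth_tderiv (hf : Smooth f) : Smooth (tderiv f) :=
  (hf.smooth_ddir (1, 0)).congr fun _ ht => (hf.tderiv_eq ht).symm

theorem Smooth.smooth_dx (hf : Smooth f) (i : Fin 2) : Smooth (dx i f) :=
  (hf.smooth_ddir (0, basisVec i)).congr fun _ ht => (hf.dx_eq i ht).symm

theorem Smooth.hasDerivWithinAt (hf : Smooth f) (ht : 0 ≤ t) (x : Plane) :
    HasDerivWithinAt (fun s => f s x) (tderiv f t x) (Ici 0) t := by
  rw [hf.tderiv_eq ht]; exact hf.hasDerivWithinAt_ddir ht x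

theorem Smooth.contDiff_slice (hf : Smooth f) (ht : 0 ≤ t) : ContDiff ℝ ∞ (f t) := by
  have h2 : ContDiff ℝ ∞ (fun z : Plane => ((t, z) : ℝ × Plane)) := by fun_prop
  have hm : MapsTo (fun z : Plane => ((t, z) : ℝ × Plane)) univ (Ici 0 ×ˢ univ) :=
    fun s _ => ⟨ht, mem_univ _⟩
  have hf' : ContDiffOn ℝ ∞ (fun q : ℝ × Plane => f q.1 q.2) (Ici 0 ×ˢ univ) := hf
  exact contDiffOn_univ.1 (hf'.comp h2.contDiffOn hm)

theorem tderiv_congr (h : ∀ t, 0 ≤ t → f t = g t) (ht : 0 ≤ t) : tderiv f t = tderiv g t := by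
  ext1 x
  exact derivWithin_congr (fun s hs => by simp only [h s hs]) (by simp only [h t ht])

theorem dx_congr (i : Fin 2) (h : ∀ t, 0 ≤ t → f t = g t) (ht : 0 ≤ t) : dx i f t = dx i g t := by
  ext1 x
  simp only [dx, h t ht]

theorem ddir_congr (v : ℝ × Plane) (h : ∀ t, 0 ≤ t → f t = g t) (ht : 0 ≤ t) :
    ddir v f t = ddir v g t := by
  ext1 x
  unfold ddir
  have h1 : EqOn (fun q : ℝ × Plane => f q.1 q.2) (fun q : ℝ × Plane => g q.1 q.2)
      (Ici 0 ×ˢ univ) := fun q hq => by simp only [h q.1 hq.1]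
  rw [fderivWithin_congr h1 (by simp only [h t ht])]

theorem Smooth.ddir_comm (hf : Smooth f) (v w : ℝ × Plane) (ht : 0 ≤ t) :
    ddir v (ddir w f) t = ddir w (ddir v f) t := by
  ext1 x
  have hmem : ((t, x) : ℝ × Plane) ∈ (Ici 0 : Set ℝ) ×ˢ (univ : Set Plane) := ⟨ht, mem_univ _⟩
  have hcl : ((t, x) : ℝ × Plane) ∈ closure (interior ((Ici 0 : Set ℝ) ×ˢ (univ : Set Plane))) := by
    rw [interior_prod_eq, closure_prod_eq]
    simpa using ht
  have hs := (ContDiffOn.contDiffWithinAt hf hmem).isSymmSndFDerivWithinAt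
    (by simp; exact WithTop.coe_le_coe.2 le_top) uniqueDiffOn_halfSpace hcl hmem
  have h : DifferentiableWithinAt ℝ
      (fderivWithin ℝ (fun q : ℝ × Plane => f q.1 q.2) (Ici 0 ×ˢ univ)) (Ici 0 ×ˢ univ) (t, x) :=
    ((ContDiffOn.fderivWithin hf uniqueDiffOn_halfSpace (m := 1) (WithTop.coe_le_coe.2 le_top)).differentiableOn
      (by simp)) _ hmem
  have key : ∀ v w : ℝ × Plane, ddir v (ddir w f) t x =
      fderivWithin ℝ (fderivWithin ℝ (fun q : ℝ × Plane => f q.1 q.2) (Ici 0 ×ˢ univ))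
        (Ici 0 ×ˢ univ) (t, x) v w := by
    intro v w
    have := (h.hasFDerivWithinAt.clm_apply (hasFDerivWithinAt_const w (t, x) _)).fderivWithin
      (uniqueDiffOn_halfSpace _ hmem)
    change fderivWithin ℝ (fun q => fderivWithin ℝ (fun q : ℝ × Plane => f q.1 q.2)
      (Ici 0 ×ˢ univ) q w) _ _ _ = _
    rw [this]; simp
  rw [key, key]; exact hs v w

theorem Smooth.tderiv_dx (hf : Smooth f) (i : Fin 2) (ht : 0 ≤ t) :
    tderiv (dx i f) t = dx i (tderiv f) t := by
  rw [(hf.smooth_dx i).tderiv_eq ht, (hf.smooth_tderiv).dx_eq i ht,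
    ddir_congr _ (fun s hs => hf.dx_eq i hs) ht, ddir_congr _ (fun s hs => hf.tderiv_eq hs) ht,
    hf.ddir_comm _ _ ht]

theorem Smooth.dx_comm (hf : Smooth f) (i j : Fin 2) (ht : 0 ≤ t) :
    dx i (dx j f) t = dx j (dx i f) t := by
  rw [(hf.smooth_dx j).dx_eq i ht, (hf.smooth_dx i).dx_eq j ht,
    ddir_congr _ (fun s hs => hf.dx_eq i hs) ht, ddir_congr _ (fun s hs => hf.dx_eq j hs) ht,
    hf.ddir_comm _ _ ht]

theorem Smooth.tderiv_iterate (hf : Smooth f) (j : ℕ) : Smooth (tderiv^[j] f) := by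
  induction j generalizing f with
  | zero => exact hf
  | succ n ih => exact ih hf.smooth_tderiv

theorem tderiv_iterate_congr (j : ℕ) (h : ∀ t, 0 ≤ t → f t = g t) (ht : 0 ≤ t) :
    tderiv^[j] f t = tderiv^[j] g t := by
  induction j generalizing f g t with
  | zero => exact h t ht
  | succ n ih => exact ih (fun s hs => tderiv_congr h hs) ht

theorem Smooth.tderiv_iterate_dx (hf : Smooth f) (i : Fin 2) (j : ℕ) (ht : 0 ≤ t) :
    tderiv^[j] (dx i f) t = dx i (tderiv^[j] f) t := by
  induction j generalizing f with
  | zero => rfl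
  | succ n ih =>
    simp only [Function.iterate_succ_apply]
    rw [← ih hf.smooth_tderiv]
    exact tderiv_iterate_congr n (fun s hs => hf.tderiv_dx i hs) ht

variable {G : Type*} [NormedAddCommGroup G] [NormedSpace ℝ G]

theorem Smooth.clm_comp (hf : Smooth f) (L : F →L[ℝ] G) : Smooth (fun t x => L (f t x)) :=
  L.contDiff.comp_contDiffOn hf

theorem Smooth.tderiv_clm_comp (hf : Smooth f) (L : F →L[ℝ] G) (ht : 0 ≤ t) :
    tderiv (fun t x => L (f t x)) t = fun x => L (tderiv f t x) := by
  ext1 x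
  exact ((L.hasFDerivAt).comp_hasDerivWithinAt t (hf.hasDerivWithinAt ht x)).derivWithin
    (uniqueDiffOn_Ici 0 t ht)

theorem Smooth.dx_clm_comp (hf : Smooth f) (L : F →L[ℝ] G) (i : Fin 2) (ht : 0 ≤ t) :
    dx i (fun t x => L (f t x)) t = fun x => L (dx i f t x) := by
  ext1 x
  have := (L.hasFDerivAt (x := f t x)).comp x (hf.hasFDerivAt_slice ht x)
  have h2 := (hf.hasFDerivAt_slice ht x).fderiv
  have h3 : fderiv ℝ (fun x => L (f t x)) x = _ := this.fderiv
  simp only [dx]; rw [h2, h3]; rfl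

theorem Smooth.tderiv_iterate_clm_comp (hf : Smooth f) (L : F →L[ℝ] G) (j : ℕ) (ht : 0 ≤ t) :
    tderiv^[j] (fun t x => L (f t x)) t = fun x => L (tderiv^[j] f t x) := by
  induction j generalizing f with
  | zero => rfl
  | succ n ih =>
    simp only [Function.iterate_succ_apply]
    rw [← ih hf.smooth_tderiv]
    exact tderiv_iterate_congr n (fun s hs => hf.tderiv_clm_comp L hs) ht

end Calculus

section Sobolev

variable {F G : Type*} [NormedAddCommGroup F] [NormedSpace ℝ F]
  [NormedAddCommGroup G] [NormedSpace ℝ G]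

theorem SobolevSmooth.isSmooth {f : ℝ → Plane → F} (hf : SobolevSmooth f) : Smooth f := hf.smooth

theorem tendsto_eLpNorm_clm_sub {V : Type*} [NormedAddCommGroup V] [NormedSpace ℝ V]
    {V' : Type*} [NormedAddCommGroup V'] [NormedSpace ℝ V']
    (Φ : V →L[ℝ] V') {a : ℝ → Plane → V} {b : Plane → V} {l : Filter ℝ}
    (h : Tendsto (fun t => eLpNorm (fun x => a t x - b x) 2 volume) l (𝓝 0)) :
    Tendsto (fun t => eLpNorm (fun x => Φ (a t x) - Φ (b x)) 2 volume) l (𝓝 0) := by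
  have h2 : Tendsto (fun t => ENNReal.ofReal ‖Φ‖ * eLpNorm (fun x => a t x - b x) 2 volume) l
      (𝓝 0) := by
    have := ENNReal.Tendsto.const_mul (a := ENNReal.ofReal ‖Φ‖) h (Or.inr ENNReal.ofReal_ne_top)
    simpa using this
  refine tendsto_of_tendsto_of_tendsto_of_le_of_le tendsto_const_nhds h2 (fun _ => zero_le) ?_
  intro t
  refine eLpNorm_le_mul_eLpNorm_of_ae_le_mul (Eventually.of_forall fun x => ?_) 2
  rw [← map_sub]
  exact Φ.le_opNorm _

theorem SobolevSmooth.of_clm {f : ℝ → Plane → F} {g : ℝ → Plane → G} (hf : SobolevSmooth f)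
    (hg : Smooth g) (k : ℕ)
    (Φ : (m : ℕ) → (Plane [×(m + k)]→L[ℝ] F) →L[ℝ] (Plane [×m]→L[ℝ] G))
    (h : ∀ j m t x, 0 ≤ t → iteratedFDeriv ℝ m (tderiv^[j] g t) x =
      Φ m (iteratedFDeriv ℝ (m + k) (tderiv^[j] f t) x)) : SobolevSmooth g where
  smooth := hg
  memLp j m t ht := by
    simp only [h j m t _ ht]
    exact (Φ m).comp_memLp' (hf.memLp j (m + k) t ht)
  continuous j m t₀ ht₀ := by
    have h1 := tendsto_eLpNorm_clm_sub (Φ m) (hf.continuous j (m + k) t₀ ht₀)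
    refine h1.congr' ?_
    filter_upwards [self_mem_nhdsWithin] with t ht
    simp only [h j m t₀ _ ht₀, h j m t _ ht]

theorem SobolevSmooth.clm_comp {f : ℝ → Plane → F} (hf : SobolevSmooth f) (L : F →L[ℝ] G) :
    SobolevSmooth (fun t x => L (f t x)) := by
  refine hf.of_clm (hf.isSmooth.clm_comp L) 0
    (fun m => ContinuousLinearMap.compContinuousMultilinearMapL ℝ (fun _ : Fin m => Plane) F G L) ?_
  intro j m t x ht
  rw [hf.isSmooth.tderiv_iterate_clm_comp L j ht]
  exact L.iteratedFDeriv_comp_left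
    (((hf.isSmooth.tderiv_iterate j).contDiff_slice ht).contDiffAt) (i := m)
      (WithTop.coe_le_coe.2 le_top)

theorem SobolevSmooth.tderiv {f : ℝ → Plane → F} (hf : SobolevSmooth f) :
    SobolevSmooth (tderiv f) where
  smooth := hf.isSmooth.smooth_tderiv
  memLp j m t ht := hf.memLp (j + 1) m t ht
  continuous j m t ht := hf.continuous (j + 1) m t ht

theorem SobolevSmooth.dx {f : ℝ → Plane → F} (hf : SobolevSmooth f) (i : Fin 2) :
    SobolevSmooth (dx i f) := by
  let L : (Plane →L[ℝ] F) →L[ℝ] F := ContinuousLinearMap.apply ℝ F (basisVec i)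
  refine hf.of_clm (hf.isSmooth.smooth_dx i) 1
    (fun m => (ContinuousLinearMap.compContinuousMultilinearMapL ℝ (fun _ : Fin m => Plane) _ _ L).comp
      (continuousMultilinearCurryRightEquiv' ℝ m Plane F).toContinuousLinearEquiv.toContinuousLinearMap) ?_
  intro j m t x ht
  rw [hf.isSmooth.tderiv_iterate_dx i j ht]
  have hs := (hf.isSmooth.tderiv_iterate j).contDiff_slice ht
  have h1 : ContDiff ℝ ∞ (fderiv ℝ (INS2D.tderiv^[j] f t)) := hs.fderiv_right (by simp)
  have h2 := L.iteratedFDeriv_comp_left (h1.contDiffAt (x := x)) (i := m)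
      (WithTop.coe_le_coe.2 le_top)
  have h3 := iteratedFDeriv_succ_eq_comp_right (𝕜 := ℝ) (f := INS2D.tderiv^[j] f t) (n := m) (x := x)
  change iteratedFDeriv ℝ m (L ∘ (fderiv ℝ (INS2D.tderiv^[j] f t))) x = _
  rw [h2]
  simp only [ContinuousLinearMap.comp_apply]
  rw [h3]
  simp

end Sobolev

section Embedding

theorem abs_le_integral_of_compactSupport (H : ℝ × ℝ → ℝ) (hH : ContDiff ℝ 2 H)
    (hs : HasCompactSupport H) (a : ℝ × ℝ) :
    |H a| ≤ ∫ q, |fderiv ℝ (fun q => fderiv ℝ H q (1, 0)) q (0, 1)| := by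
  set H1 : ℝ × ℝ → ℝ := fun q => fderiv ℝ H q (1, 0) with hH1
  set H2 : ℝ × ℝ → ℝ := fun q => fderiv ℝ H1 q (0, 1) with hH2
  have c1 : ContDiff ℝ 1 H1 := (hH.fderiv_right (m := 1) (by norm_num)).clm_apply contDiff_const
  have c2 : Continuous H2 := (c1.continuous_fderiv (by norm_num)).clm_apply continuous_const
  have s1 : HasCompactSupport H1 := (hs.fderiv ℝ).comp_left (g := fun L : (ℝ × ℝ) →L[ℝ] ℝ => L (1, 0)) rfl
  have s2 : HasCompactSupport H2 := (s1.fderiv ℝ).comp_left (g := fun L : (ℝ × ℝ) →L[ℝ] ℝ => L (0, 1)) rfl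
  have i2 : Integrable (fun q => |H2 q|) := (c2.integrable_of_hasCompactSupport s2).abs
  have d1 : ∀ r s : ℝ, HasDerivAt (fun s => H (s, r)) (H1 (s, r)) s := fun r s =>
    ((hH.differentiable (by norm_num)) (s, r)).hasFDerivAt.comp_hasDerivAt s
      ((hasDerivAt_id s).prodMk (hasDerivAt_const s r))
  have d2 : ∀ s r : ℝ, HasDerivAt (fun r => H1 (s, r)) (H2 (s, r)) r := fun s r =>
    ((c1.differentiable (by norm_num)) (s, r)).hasFDerivAt.comp_hasDerivAt r
      ((hasDerivAt_const r s).prodMk (hasDerivAt_id r))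
  have line : ∀ (g g' : ℝ → ℝ), (∀ s, HasDerivAt g (g' s) s) → Continuous g' →
      HasCompactSupport g → ∀ s, |g s| ≤ ∫ r, |g' r| := by
    intro g g' hg hg' hgs s
    have hd : deriv g = g' := funext fun s => (hg s).deriv
    have hc : ContDiff ℝ 1 g := contDiff_one_iff_deriv.2 ⟨fun s => (hg s).differentiableAt, hd ▸ hg'⟩
    have hi : Integrable g' := by
      refine hg'.integrable_of_hasCompactSupport ?_
      rw [← hd]; exact hgs.deriv
    rw [← HasCompactSupport.integral_Iic_deriv_eq hc hgs s, hd]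
    calc |∫ r in Iic s, g' r| ≤ ∫ r in Iic s, |g' r| := abs_integral_le_integral_abs
      _ ≤ ∫ r, |g' r| := setIntegral_le_integral hi.abs (Eventually.of_forall fun _ => abs_nonneg _)
  have emb1 : ∀ r : ℝ, Topology.IsClosedEmbedding (fun s : ℝ => ((s, r) : ℝ × ℝ)) := fun r =>
    (Topology.IsClosedEmbedding.of_continuous_injective_isClosedMap (by fun_prop)
      (fun a b h => (Prod.mk.inj h).1) (isClosedMap_prodMk_right r))
  have emb2 : ∀ s : ℝ, Topology.IsClosedEmbedding (fun r : ℝ => ((s, r) : ℝ × ℝ)) := fun r =>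
    (Topology.IsClosedEmbedding.of_continuous_injective_isClosedMap (by fun_prop)
      (fun a b h => (Prod.mk.inj h).2) (isClosedMap_prodMk_left r))
  have e1 : |H a| ≤ ∫ s, |H1 (s, a.2)| :=
    line (fun s => H (s, a.2)) _ (d1 a.2) (c1.continuous.comp (by fun_prop))
      (hs.comp_isClosedEmbedding (emb1 a.2)) a.1
  have e2 : ∀ s, |H1 (s, a.2)| ≤ ∫ r, |H2 (s, r)| := fun s =>
    line (fun r => H1 (s, r)) _ (d2 s) (c2.comp (by fun_prop))
      (s1.comp_isClosedEmbedding (emb2 s)) a.2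
  refine e1.trans ?_
  rw [Measure.volume_eq_prod, integral_prod _ i2]
  refine integral_mono ?_ i2.integral_prod_left e2
  refine Integrable.abs ?_
  exact (c1.continuous.comp (by fun_prop)).integrable_of_hasCompactSupport
    (s1.comp_isClosedEmbedding (emb1 a.2))

/-- The affine parametrization of the plane by its coordinates, based at `a`. -/
def chart (a : Plane) (q : ℝ × ℝ) : Plane := a + (q.1 • basisVec 0 + q.2 • basisVec 1)

theorem measurePreserving_chart (a : Plane) : MeasurePreserving (chart a) := by
  have h1 := (EuclideanSpace.volume_preserving_symm_measurableEquiv_toLp (Fin 2)).symm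
  have h2 := (volume_preserving_finTwoArrow ℝ).symm
  have h3 := (measurePreserving_add_left volume a).comp (h1.comp h2)
  have : chart a = (fun x => a + x) ∘ ((MeasurableEquiv.toLp 2 (Fin 2 → ℝ)) ∘
      (MeasurableEquiv.finTwoArrow (α := ℝ)).symm) := by
    ext q i
    fin_cases i <;> simp [chart, basisVec, MeasurableEquiv.finTwoArrow]
  rw [this]
  exact h3

theorem hasFDerivAt_chart (a : Plane) (q : ℝ × ℝ) :
    HasFDerivAt (chart a) ((ContinuousLinearMap.fst ℝ ℝ ℝ).smulRight (basisVec 0) +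
      (ContinuousLinearMap.snd ℝ ℝ ℝ).smulRight (basisVec 1)) q := by
  refine HasFDerivAt.const_add a ?_
  exact ((hasFDerivAt_fst (p := q)).smul_const _).add ((hasFDerivAt_snd (p := q)).smul_const _)

theorem measurableEmbedding_chart (a : Plane) : MeasurableEmbedding (chart a) := by
  have h3 := (measurableEmbedding_addLeft a).comp
    (((MeasurableEquiv.toLp 2 (Fin 2 → ℝ)).measurableEmbedding).comp
      (MeasurableEquiv.finTwoArrow (α := ℝ)).symm.measurableEmbedding)
  convert h3 using 1
  ext q i
  fin_cases i <;> simp [chart, basisVec, MeasurableEquiv.finTwoArrow]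

theorem integral_add₄ {α : Type*} [MeasurableSpace α] {μ : Measure α} {f g h k : α → ℝ}
    (hf : Integrable f μ) (hg : Integrable g μ) (hh : Integrable h μ) (hk : Integrable k μ) :
    ∫ x, (f x + g x + h x + k x) ∂μ = (∫ x, f x ∂μ) + (∫ x, g x ∂μ) + (∫ x, h x ∂μ) + ∫ x, k x ∂μ := by
  have h1 : Integrable (fun x => f x + g x) μ := hf.add hg
  have h2 : Integrable (fun x => f x + g x + h x) μ := h1.add hh
  rw [integral_add h2 hk, integral_add h1 hh, integral_add hf hg]

/-- Qualitative Sobolev embedding of `H²(ℝ²)` into bounded functions. -/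
theorem exists_abs_le_sobolev : ∃ K : ℝ, ∀ g g0 g1 g01 : Plane → ℝ,
    ContDiff ℝ 2 g → (∀ x, fderiv ℝ g x (basisVec 0) = g0 x) →
    (∀ x, fderiv ℝ g x (basisVec 1) = g1 x) → (∀ x, fderiv ℝ g0 x (basisVec 1) = g01 x) →
    MemLp g 2 → MemLp g0 2 → MemLp g1 2 → MemLp g01 2 → ∀ x,
    |g x| ≤ K + ((∫ x, g x ^ 2) + (∫ x, g0 x ^ 2) + (∫ x, g1 x ^ 2) + ∫ x, g01 x ^ 2) := by
  let χ : ContDiffBump (0 : ℝ × ℝ) := ⟨1, 2, one_pos, one_lt_two⟩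
  have hχ : ContDiff ℝ 2 χ := χ.contDiff
  set χ1 : ℝ × ℝ → ℝ := fun q => fderiv ℝ χ q (1, 0) with hχ1
  set χ2 : ℝ × ℝ → ℝ := fun q => fderiv ℝ χ q (0, 1) with hχ2
  set χ12 : ℝ × ℝ → ℝ := fun q => fderiv ℝ χ1 q (0, 1) with hχ12
  have c1 : ContDiff ℝ 1 χ1 := (hχ.fderiv_right (m := 1) (by norm_num)).clm_apply contDiff_const
  have c2 : ContDiff ℝ 1 χ2 := (hχ.fderiv_right (m := 1) (by norm_num)).clm_apply contDiff_const
  have c12 : Continuous χ12 := (c1.continuous_fderiv (by norm_num)).clm_apply continuous_const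
  have s0 : HasCompactSupport χ := χ.hasCompactSupport
  have s1 : HasCompactSupport χ1 :=
    (s0.fderiv ℝ).comp_left (g := fun L : (ℝ × ℝ) →L[ℝ] ℝ => L (1, 0)) rfl
  have s2 : HasCompactSupport χ2 :=
    (s0.fderiv ℝ).comp_left (g := fun L : (ℝ × ℝ) →L[ℝ] ℝ => L (0, 1)) rfl
  have s12 : HasCompactSupport χ12 :=
    (s1.fderiv ℝ).comp_left (g := fun L : (ℝ × ℝ) →L[ℝ] ℝ => L (0, 1)) rfl
  have m0 : MemLp χ 2 := hχ.continuous.memLp_of_hasCompactSupport s0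
  have m1 : MemLp χ1 2 := c1.continuous.memLp_of_hasCompactSupport s1
  have m2 : MemLp χ2 2 := c2.continuous.memLp_of_hasCompactSupport s2
  have m12 : MemLp χ12 2 := c12.memLp_of_hasCompactSupport s12
  refine ⟨(∫ q, χ q ^ 2) + (∫ q, χ1 q ^ 2) + (∫ q, χ2 q ^ 2) + ∫ q, χ12 q ^ 2, ?_⟩
  intro g g0 g1 g01 hg h0 h1 h01 mg mg0 mg1 mg01 x
  have mp := measurePreserving_chart x
  have me := measurableEmbedding_chart x
  have cg0 : ContDiff ℝ 1 g0 := by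
    have : g0 = fun x => fderiv ℝ g x (basisVec 0) := funext fun x => (h0 x).symm
    rw [this]
    exact (hg.fderiv_right (m := 1) (by norm_num)).clm_apply contDiff_const
  have hch : ContDiff ℝ 2 (chart x) := by unfold chart; fun_prop
  set H : ℝ × ℝ → ℝ := fun q => χ q * g (chart x q) with hH
  have cH : ContDiff ℝ 2 H := hχ.mul (hg.comp hch)
  have sH : HasCompactSupport H := s0.mul_right
  have dg : ∀ q, HasFDerivAt (fun q => g (chart x q)) _ q := fun q =>
    ((hg.differentiable (by norm_num)) (chart x q)).hasFDerivAt.comp q (hasFDerivAt_chart x q)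
  have dg0 : ∀ q, HasFDerivAt (fun q => g0 (chart x q)) _ q := fun q =>
    ((cg0.differentiable (by norm_num)) (chart x q)).hasFDerivAt.comp q (hasFDerivAt_chart x q)
  have e1 : ∀ q, fderiv ℝ H q (1, 0) = χ1 q * g (chart x q) + χ q * g0 (chart x q) := by
    intro q
    have : HasFDerivAt H _ q := ((hχ.differentiable (by norm_num)) q).hasFDerivAt.mul (dg q)
    rw [this.fderiv]
    simp [hχ1, h0]; ring
  have e2 : ∀ q, fderiv ℝ (fun q => fderiv ℝ H q (1, 0)) q (0, 1) =
      χ12 q * g (chart x q) + χ1 q * g1 (chart x q) + χ2 q * g0 (chart x q)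
        + χ q * g01 (chart x q) := by
    intro q
    have := (((c1.differentiable (by norm_num)) q).hasFDerivAt.mul (dg q)).add
      (((hχ.differentiable (by norm_num)) q).hasFDerivAt.mul (dg0 q))
    rw [show (fun q => fderiv ℝ H q (1, 0)) = (fun q => χ1 q * g (chart x q) + χ q * g0 (chart x q))
      from funext e1]
    erw [this.fderiv]
    simp [hχ12, hχ2, h1, h01]; ring
  have key := abs_le_integral_of_compactSupport H cH sH (0, 0)
  have hx : H (0, 0) = g x := by
    have : χ (0 : ℝ × ℝ) = 1 := χ.one_of_mem_closedBall (by simp [χ])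
    have h0 : ((0 : ℝ), (0 : ℝ)) = 0 := rfl
    simp only [hH, chart, h0, this]; simp
  rw [hx] at key
  refine key.trans ?_
  have tr : ∀ f : Plane → ℝ, ∫ q, f (chart x q) = ∫ x, f x := fun f => mp.integral_comp me f
  have cp : ∀ f : Plane → ℝ, MemLp f 2 → MemLp (fun q => f (chart x q)) 2 := fun f hf =>
    hf.comp_measurePreserving mp
  rw [← tr (fun x => g x ^ 2), ← tr (fun x => g0 x ^ 2), ← tr (fun x => g1 x ^ 2),
    ← tr (fun x => g01 x ^ 2)]
  have i0 := m0.integrable_sq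
  have i1 := m1.integrable_sq
  have i2 := m2.integrable_sq
  have i12 := m12.integrable_sq
  have j0 := (cp g mg).integrable_sq
  have j1 := (cp g0 mg0).integrable_sq
  have j2 := (cp g1 mg1).integrable_sq
  have j12 := (cp g01 mg01).integrable_sq
  rw [← integral_add₄ i0 i1 i2 i12, ← integral_add₄ j0 j1 j2 j12,
    ← integral_add (f := fun q => χ q ^ 2 + χ1 q ^ 2 + χ2 q ^ 2 + χ12 q ^ 2)
      (g := fun q => g (chart x q) ^ 2 + g0 (chart x q) ^ 2 + g1 (chart x q) ^ 2 + g01 (chart x q) ^ 2)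
      (((i0.add i1).add i2).add i12) (((j0.add j1).add j2).add j12)]
  refine integral_mono_of_nonneg (Eventually.of_forall fun _ => abs_nonneg _)
    ((((i0.add i1).add i2).add i12).add (((j0.add j1).add j2).add j12))
    (Eventually.of_forall fun q => ?_)
  simp only [e2]
  have young : ∀ a b : ℝ, |a * b| ≤ a ^ 2 + b ^ 2 := fun a b => by
    rw [abs_le]; constructor <;> nlinarith [sq_nonneg (a - b), sq_nonneg (a + b)]
  have := young (χ12 q) (g (chart x q))
  have := young (χ1 q) (g1 (chart x q))
  have := young (χ2 q) (g0 (chart x q))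
  have := young (χ q) (g01 (chart x q))
  have t1 := abs_add_le (χ12 q * g (chart x q) + χ1 q * g1 (chart x q) + χ2 q * g0 (chart x q))
    (χ q * g01 (chart x q))
  have t2 := abs_add_le (χ12 q * g (chart x q) + χ1 q * g1 (chart x q)) (χ2 q * g0 (chart x q))
  have t3 := abs_add_le (χ12 q * g (chart x q)) (χ1 q * g1 (chart x q))
  linarith

end Embedding

section Classes

/-- A time-dependent scalar function that is continuous from `[0,∞)` to `L²(ℝ²)`. -/
structure L2Cont (f : ℝ → Plane → ℝ) : Prop where
  memLp : ∀ t, 0 ≤ t → MemLp (f t) 2 volume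
  tendsto : ∀ t₀, 0 ≤ t₀ → Tendsto (fun t => eLpNorm (fun x => f t x - f t₀ x) 2 volume)
    (𝓝[Ici 0] t₀) (𝓝 0)

theorem L2Cont.continuousOn_integral_mul {f g : ℝ → Plane → ℝ} (hf : L2Cont f) (hg : L2Cont g) :
    ContinuousOn (fun t => ∫ x, f t x * g t x) (Ici 0) := by
  classical
  let toL : ∀ f : ℝ → Plane → ℝ, L2Cont f → ℝ → Lp ℝ 2 (volume : Measure Plane) := fun f hf t =>
    if h : 0 ≤ t then (hf.memLp t h).toLp (f t) else 0
  have key : ∀ f hf, ContinuousOn (toL f hf) (Ici 0) := by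
    intro f hf t₀ ht₀
    have ht₀' : 0 ≤ t₀ := ht₀
    refine (Lp.tendsto_Lp_iff_tendsto_eLpNorm' _ _).2 ?_
    refine (hf.tendsto t₀ ht₀).congr' ?_
    filter_upwards [self_mem_nhdsWithin] with t ht
    have ht' : 0 ≤ t := ht
    refine eLpNorm_congr_ae ?_
    simp only [toL, ht', ht₀', dif_pos]
    filter_upwards [(hf.memLp t ht').coeFn_toLp, (hf.memLp t₀ ht₀').coeFn_toLp] with x h1 h2
    simp [h1, h2]
  have h := (key f hf).inner (𝕜 := ℝ) (key g hg)
  refine h.congr fun t ht => ?_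
  have ht' : 0 ≤ t := ht
  change _ = inner ℝ (toL f hf t) (toL g hg t)
  rw [L2.inner_def]
  refine integral_congr_ae ?_
  simp only [toL, ht', dif_pos]
  filter_upwards [(hf.memLp t ht').coeFn_toLp, (hg.memLp t ht').coeFn_toLp] with x h1 h2
  simp [h1, h2, mul_comm]

/-- `L²`-continuity together with bounds that are uniform in space and locally uniform in time. -/
structure BddL2 (f : ℝ → Plane → ℝ) : Prop where
  l2 : L2Cont f
  cont : ContinuousOn (fun q : ℝ × Plane => f q.1 q.2) (Ici 0 ×ˢ univ)
  bdd : ∀ b : ℝ, ∃ B : ℝ, ∀ t ∈ Icc 0 b, ∀ x, |f t x| ≤ B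

theorem BddL2.congr {f g : ℝ → Plane → ℝ} (hf : BddL2 f) (h : ∀ t, 0 ≤ t → f t = g t) :
    BddL2 g where
  l2 := ⟨fun t ht => h t ht ▸ hf.l2.memLp t ht, fun t₀ ht₀ => by
    refine (hf.l2.tendsto t₀ ht₀).congr' ?_
    filter_upwards [self_mem_nhdsWithin] with t ht
    rw [h t ht, h t₀ ht₀]⟩
  cont := hf.cont.congr fun q hq => by simp only [h q.1 hq.1]
  bdd b := by
    obtain ⟨B, hB⟩ := hf.bdd b
    exact ⟨B, fun t ht x => h t ht.1 ▸ hB t ht x⟩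

theorem tendsto_zero_of_le_add {α : Type*} {l : Filter α} {u v w : α → ℝ≥0∞}
    (hv : Tendsto v l (𝓝 0)) (hw : Tendsto w l (𝓝 0)) (h : ∀ᶠ t in l, u t ≤ v t + w t) :
    Tendsto u l (𝓝 0) := by
  have := hv.add hw
  rw [add_zero] at this
  exact tendsto_of_tendsto_of_tendsto_of_le_of_le' tendsto_const_nhds this
    (Eventually.of_forall fun _ => zero_le) h

theorem BddL2.add {f g : ℝ → Plane → ℝ} (hf : BddL2 f) (hg : BddL2 g) :
    BddL2 (fun t x => f t x + g t x) where
  l2 := ⟨fun t ht => (hf.l2.memLp t ht).add (hg.l2.memLp t ht), fun t₀ ht₀ => by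
    refine tendsto_zero_of_le_add (hf.l2.tendsto t₀ ht₀) (hg.l2.tendsto t₀ ht₀) ?_
    filter_upwards [self_mem_nhdsWithin] with t ht
    refine le_trans (le_of_eq ?_) (eLpNorm_add_le
      ((hf.l2.memLp t ht).sub (hf.l2.memLp t₀ ht₀)).1
      ((hg.l2.memLp t ht).sub (hg.l2.memLp t₀ ht₀)).1 one_le_two)
    congr 1; ext x; simp; ring⟩
  cont := hf.cont.add hg.cont
  bdd b := by
    obtain ⟨B, hB⟩ := hf.bdd b
    obtain ⟨B', hB'⟩ := hg.bdd b
    exact ⟨B + B', fun t ht x => (abs_add_le _ _).trans (add_le_add (hB t ht x) (hB' t ht x))⟩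

theorem BddL2.memLp_mul {f g : ℝ → Plane → ℝ} (hf : BddL2 f) (hg : BddL2 g) {t : ℝ} (ht : 0 ≤ t) :
    MemLp (fun x => f t x * g t x) 2 volume := by
  obtain ⟨B, hB⟩ := hg.bdd t
  refine ((hf.l2.memLp t ht).const_mul B).mono
    ((hf.l2.memLp t ht).1.mul (hg.l2.memLp t ht).1) (Eventually.of_forall fun x => ?_)
  have := hB t ⟨ht, le_rfl⟩ x
  rw [Real.norm_eq_abs, Real.norm_eq_abs, abs_mul, abs_mul, mul_comm]
  exact mul_le_mul_of_nonneg_right (this.trans (le_abs_self B)) (abs_nonneg _)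

theorem BddL2.mul {f g : ℝ → Plane → ℝ} (hf : BddL2 f) (hg : BddL2 g) :
    BddL2 (fun t x => f t x * g t x) where
  l2 := ⟨fun t ht => hf.memLp_mul hg ht, fun t₀ ht₀ => by
    obtain ⟨B, hB⟩ := hf.bdd (t₀ + 1)
    obtain ⟨B', hB'⟩ := hg.bdd t₀
    have h1 := ENNReal.Tendsto.const_mul (a := ENNReal.ofReal B) (hg.l2.tendsto t₀ ht₀)
      (Or.inr ENNReal.ofReal_ne_top)
    have h2 := ENNReal.Tendsto.const_mul (a := ENNReal.ofReal B') (hf.l2.tendsto t₀ ht₀)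
      (Or.inr ENNReal.ofReal_ne_top)
    rw [mul_zero] at h1 h2
    refine tendsto_zero_of_le_add h1 h2 ?_
    have hev : ∀ᶠ t in 𝓝[Ici 0] t₀, t < t₀ + 1 :=
      mem_nhdsWithin_of_mem_nhds (Iio_mem_nhds (by linarith))
    filter_upwards [self_mem_nhdsWithin, hev] with t ht ht1
    have e : (fun x => f t x * g t x - f t₀ x * g t₀ x) =
      (fun x => f t x * (g t x - g t₀ x)) + (fun x => (f t x - f t₀ x) * g t₀ x) := by
      ext x; simp; ring
    rw [e]
    refine (eLpNorm_add_le ((hf.l2.memLp t ht).1.mul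
      ((hg.l2.memLp t ht).sub (hg.l2.memLp t₀ ht₀)).1)
      (((hf.l2.memLp t ht).sub (hf.l2.memLp t₀ ht₀)).1.mul (hg.l2.memLp t₀ ht₀).1)
      one_le_two).trans (add_le_add ?_ ?_)
    · refine eLpNorm_le_mul_eLpNorm_of_ae_le_mul (Eventually.of_forall fun x => ?_) 2
      change ‖f t x * (g t x - g t₀ x)‖ ≤ _
      rw [norm_mul]
      exact mul_le_mul_of_nonneg_right (hB t ⟨ht, ht1.le⟩ x) (norm_nonneg _)
    · refine eLpNorm_le_mul_eLpNorm_of_ae_le_mul (Eventually.of_forall fun x => ?_) 2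
      change ‖(f t x - f t₀ x) * g t₀ x‖ ≤ _
      rw [norm_mul, mul_comm]
      exact mul_le_mul_of_nonneg_right (hB' t₀ ⟨ht₀, le_rfl⟩ x) (norm_nonneg _)⟩
  cont := hf.cont.mul hg.cont
  bdd b := by
    obtain ⟨B, hB⟩ := hf.bdd b
    obtain ⟨B', hB'⟩ := hg.bdd b
    refine ⟨B * B', fun t ht x => ?_⟩
    rw [abs_mul]
    exact mul_le_mul (hB t ht x) (hB' t ht x) (abs_nonneg _) ((abs_nonneg _).trans (hB t ht x))

theorem BddL2.const_mul {f : ℝ → Plane → ℝ} (hf : BddL2 f) (c : ℝ) :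
    BddL2 (fun t x => c * f t x) where
  l2 := ⟨fun t ht => (hf.l2.memLp t ht).const_mul c, fun t₀ ht₀ => by
    have h1 := ENNReal.Tendsto.const_mul (a := ENNReal.ofReal |c|) (hf.l2.tendsto t₀ ht₀)
      (Or.inr ENNReal.ofReal_ne_top)
    rw [mul_zero] at h1
    refine tendsto_of_tendsto_of_tendsto_of_le_of_le tendsto_const_nhds h1
      (fun _ => zero_le) fun t => ?_
    refine eLpNorm_le_mul_eLpNorm_of_ae_le_mul (Eventually.of_forall fun x => ?_) 2
    rw [← mul_sub, norm_mul, Real.norm_eq_abs]⟩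
  cont := continuousOn_const.mul hf.cont
  bdd b := by
    obtain ⟨B, hB⟩ := hf.bdd b
    refine ⟨|c| * B, fun t ht x => ?_⟩
    rw [abs_mul]
    exact mul_le_mul_of_nonneg_left (hB t ht x) (abs_nonneg _)

theorem SobolevSmooth.l2Cont {f : ℝ → Plane → ℝ} (hf : SobolevSmooth f) : L2Cont f where
  memLp t ht := by
    have := (continuousMultilinearCurryFin0 ℝ Plane ℝ).toContinuousLinearEquiv.toContinuousLinearMap.comp_memLp'
      (hf.memLp 0 0 t ht)
    refine (memLp_congr_ae (Eventually.of_forall fun x => ?_)).1 this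
    simp
  tendsto t₀ ht₀ := by
    have := tendsto_eLpNorm_clm_sub
      (continuousMultilinearCurryFin0 ℝ Plane ℝ).toContinuousLinearEquiv.toContinuousLinearMap
      (hf.continuous 0 0 t₀ ht₀)
    simpa using this

theorem SobolevSmooth.bddL2 {f : ℝ → Plane → ℝ} (hf : SobolevSmooth f) : BddL2 f where
  l2 := hf.l2Cont
  cont := hf.smooth.continuousOn
  bdd b := by
    obtain ⟨K, hK⟩ := exists_abs_le_sobolev
    have hc : ∀ {g : ℝ → Plane → ℝ}, SobolevSmooth g → ContinuousOn (fun t => ∫ x, g t x ^ 2) (Icc 0 b) := by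
      intro g hg
      have := (hg.l2Cont.continuousOn_integral_mul hg.l2Cont).mono
        (fun t ht => ht.1 : Icc 0 b ⊆ Ici 0)
      simpa only [← pow_two] using this
    have hcont := ((continuousOn_const (c := K)).add
      ((((hc hf).add (hc (hf.dx 0))).add (hc (hf.dx 1))).add (hc ((hf.dx 0).dx 1))))
    obtain ⟨B, hB⟩ := isCompact_Icc.bddAbove_image hcont
    refine ⟨B, fun t ht x => ?_⟩
    refine le_trans ?_ (hB ⟨t, ht, rfl⟩)
    exact hK (f t) (INS2D.dx 0 f t) (INS2D.dx 1 f t) (INS2D.dx 1 (INS2D.dx 0 f) t)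
      ((hf.isSmooth.contDiff_slice ht.1).of_le (WithTop.coe_le_coe.2 le_top)) (fun _ => rfl)
      (fun _ => rfl) (fun _ => rfl) (hf.l2Cont.memLp t ht.1) ((hf.dx 0).l2Cont.memLp t ht.1)
      ((hf.dx 1).l2Cont.memLp t ht.1) (((hf.dx 0).dx 1).l2Cont.memLp t ht.1) x

/-- `BddL2` for all derivatives up to order `n`. -/
def BddUpTo : ℕ → (ℝ → Plane → ℝ) → Prop
  | 0, f => BddL2 f
  | n + 1, f => BddL2 f ∧ BddUpTo n (tderiv f) ∧ ∀ i, BddUpTo n (dx i f)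

theorem BddUpTo.of_succ {n : ℕ} {f : ℝ → Plane → ℝ} (h : BddUpTo (n + 1) f) : BddUpTo n f := by
  induction n generalizing f with
  | zero => exact h.1
  | succ n ih => exact ⟨h.1, ih h.2.1, fun i => ih (h.2.2 i)⟩

theorem BddUpTo.congr {n : ℕ} {f g : ℝ → Plane → ℝ} (hf : BddUpTo n f)
    (h : ∀ t, 0 ≤ t → f t = g t) : BddUpTo n g := by
  induction n generalizing f g with
  | zero => exact BddL2.congr hf h
  | succ n ih =>
    exact ⟨hf.1.congr h, ih hf.2.1 fun t ht => tderiv_congr h ht,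
      fun i => ih (hf.2.2 i) fun t ht => dx_congr i h ht⟩

variable {f g : ℝ → Plane → ℝ} {t : ℝ}

theorem Smooth.add (hf : Smooth f) (hg : Smooth g) : Smooth (fun t x => f t x + g t x) :=
  ContDiffOn.add hf hg

theorem Smooth.mul (hf : Smooth f) (hg : Smooth g) : Smooth (fun t x => f t x * g t x) :=
  ContDiffOn.mul hf hg

theorem Smooth.const_mul (hf : Smooth f) (c : ℝ) : Smooth (fun t x => c * f t x) :=
  contDiffOn_const.mul hf

theorem Smooth.tderiv_add (hf : Smooth f) (hg : Smooth g) (ht : 0 ≤ t) :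
    tderiv (fun t x => f t x + g t x) t = fun x => tderiv f t x + tderiv g t x := by
  ext1 x
  exact ((hf.hasDerivWithinAt ht x).add (hg.hasDerivWithinAt ht x)).derivWithin
    (uniqueDiffOn_Ici 0 t ht)

theorem Smooth.tderiv_mul (hf : Smooth f) (hg : Smooth g) (ht : 0 ≤ t) :
    tderiv (fun t x => f t x * g t x) t = fun x => tderiv f t x * g t x + f t x * tderiv g t x := by
  ext1 x
  exact ((hf.hasDerivWithinAt ht x).mul (hg.hasDerivWithinAt ht x)).derivWithin
    (uniqueDiffOn_Ici 0 t ht)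

theorem Smooth.tderiv_const_mul (hf : Smooth f) (c : ℝ) (ht : 0 ≤ t) :
    tderiv (fun t x => c * f t x) t = fun x => c * tderiv f t x := by
  ext1 x
  exact ((hf.hasDerivWithinAt ht x).const_mul c).derivWithin (uniqueDiffOn_Ici 0 t ht)

theorem Smooth.differentiable (hf : Smooth f) (ht : 0 ≤ t) : Differentiable ℝ (f t) :=
  (hf.contDiff_slice ht).differentiable (by simp)

theorem Smooth.dx_add (hf : Smooth f) (hg : Smooth g) (i : Fin 2) (ht : 0 ≤ t) :
    dx i (fun t x => f t x + g t x) t = fun x => dx i f t x + dx i g t x := by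
  ext1 x
  have : fderiv ℝ (fun x => f t x + g t x) x = _ :=
    ((hf.differentiable ht x).hasFDerivAt.add (hg.differentiable ht x).hasFDerivAt).fderiv
  simp only [dx, this]; rfl

theorem Smooth.dx_mul (hf : Smooth f) (hg : Smooth g) (i : Fin 2) (ht : 0 ≤ t) :
    dx i (fun t x => f t x * g t x) t = fun x => dx i f t x * g t x + f t x * dx i g t x := by
  ext1 x
  have : fderiv ℝ (fun x => f t x * g t x) x = _ :=
    ((hf.differentiable ht x).hasFDerivAt.mul (hg.differentiable ht x).hasFDerivAt).fderiv
  simp only [dx, this]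
  simp; ring

theorem Smooth.dx_const_mul (hf : Smooth f) (c : ℝ) (i : Fin 2) (ht : 0 ≤ t) :
    dx i (fun t x => c * f t x) t = fun x => c * dx i f t x := by
  ext1 x
  have : fderiv ℝ (fun x => c * f t x) x = _ :=
    ((hf.differentiable ht x).hasFDerivAt.const_mul c).fderiv
  simp only [dx, this]; rfl

theorem BddUpTo.add {n : ℕ} (sf : Smooth f) (sg : Smooth g) (hf : BddUpTo n f) (hg : BddUpTo n g) :
    BddUpTo n (fun t x => f t x + g t x) := by
  induction n generalizing f g with
  | zero => exact BddL2.add hf hg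
  | succ n ih =>
    exact ⟨hf.1.add hg.1, (ih sf.smooth_tderiv sg.smooth_tderiv hf.2.1 hg.2.1).congr
        fun t ht => (sf.tderiv_add sg ht).symm,
      fun i => (ih (sf.smooth_dx i) (sg.smooth_dx i) (hf.2.2 i) (hg.2.2 i)).congr
        fun t ht => (sf.dx_add sg i ht).symm⟩

theorem BddUpTo.const_mul {n : ℕ} (sf : Smooth f) (hf : BddUpTo n f) (c : ℝ) :
    BddUpTo n (fun t x => c * f t x) := by
  induction n generalizing f with
  | zero => exact BddL2.const_mul hf c
  | succ n ih =>
    exact ⟨hf.1.const_mul c, (ih sf.smooth_tderiv hf.2.1).congr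
        fun t ht => (sf.tderiv_const_mul c ht).symm,
      fun i => (ih (sf.smooth_dx i) (hf.2.2 i)).congr fun t ht => (sf.dx_const_mul c i ht).symm⟩

theorem BddUpTo.mul {n : ℕ} (sf : Smooth f) (sg : Smooth g) (hf : BddUpTo n f) (hg : BddUpTo n g) :
    BddUpTo n (fun t x => f t x * g t x) := by
  induction n generalizing f g with
  | zero => exact BddL2.mul hf hg
  | succ n ih =>
    exact ⟨hf.1.mul hg.1, (BddUpTo.add (sf.smooth_tderiv.mul sg) (sf.mul sg.smooth_tderiv)
        (ih sf.smooth_tderiv sg hf.2.1 hg.of_succ) (ih sf sg.smooth_tderiv hf.of_succ hg.2.1)).congr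
        fun t ht => (sf.tderiv_mul sg ht).symm,
      fun i => (BddUpTo.add ((sf.smooth_dx i).mul sg) (sf.mul (sg.smooth_dx i))
        (ih (sf.smooth_dx i) sg (hf.2.2 i) hg.of_succ)
        (ih sf (sg.smooth_dx i) hf.of_succ (hg.2.2 i))).congr
        fun t ht => (sf.dx_mul sg i ht).symm⟩

/-- Smooth scalar functions on `[0,∞) × ℝ²` all of whose derivatives are continuous in time with
values in `L²(ℝ²)` and bounded, uniformly in space and locally uniformly in time. -/
structure Regular (f : ℝ → Plane → ℝ) : Prop where
  smooth : Smooth f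
  bddUpTo : ∀ n, BddUpTo n f

theorem SobolevSmooth.regular (hf : SobolevSmooth f) : Regular f where
  smooth := hf.smooth
  bddUpTo n := by
    induction n generalizing f with
    | zero => exact hf.bddL2
    | succ n ih => exact ⟨hf.bddL2, ih hf.tderiv, fun i => ih (hf.dx i)⟩

theorem Regular.add (hf : Regular f) (hg : Regular g) : Regular (fun t x => f t x + g t x) :=
  ⟨hf.smooth.add hg.smooth, fun n => (hf.bddUpTo n).add hf.smooth hg.smooth (hg.bddUpTo n)⟩

theorem Regular.mul (hf : Regular f) (hg : Regular g) : Regular (fun t x => f t x * g t x) :=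
  ⟨hf.smooth.mul hg.smooth, fun n => (hf.bddUpTo n).mul hf.smooth hg.smooth (hg.bddUpTo n)⟩

theorem Regular.const_mul (hf : Regular f) (c : ℝ) : Regular (fun t x => c * f t x) :=
  ⟨hf.smooth.const_mul c, fun n => (hf.bddUpTo n).const_mul hf.smooth c⟩

theorem Regular.tderiv (hf : Regular f) : Regular (tderiv f) :=
  ⟨hf.smooth.smooth_tderiv, fun n => (hf.bddUpTo (n + 1)).2.1⟩

theorem Regular.dx (hf : Regular f) (i : Fin 2) : Regular (dx i f) :=
  ⟨hf.smooth.smooth_dx i, fun n => (hf.bddUpTo (n + 1)).2.2 i⟩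

theorem Regular.bddL2 (hf : Regular f) : BddL2 f := hf.bddUpTo 0

theorem Regular.memLp (hf : Regular f) (ht : 0 ≤ t) : MemLp (f t) 2 volume :=
  hf.bddL2.l2.memLp t ht

theorem Regular.integrable_mul (hf : Regular f) (hg : Regular g) (ht : 0 ≤ t) :
    Integrable (fun x => f t x * g t x) :=
  (hf.memLp ht).integrable_mul (hg.memLp ht)

end Classes

section Slices

/-- Continuously differentiable functions in `H¹(ℝ²)`. -/
structure H1 (f : Plane → ℝ) : Prop where
  contDiff : ContDiff ℝ 1 f
  memLp : MemLp f 2 volume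
  memLp_fderiv : ∀ i, MemLp (fun x => fderiv ℝ f x (basisVec i)) 2 volume

theorem H1.integral_mul_fderiv {f g : Plane → ℝ} (hf : H1 f) (hg : H1 g) (i : Fin 2) :
    ∫ x, f x * fderiv ℝ g x (basisVec i) = -∫ x, fderiv ℝ f x (basisVec i) * g x :=
  integral_mul_fderiv_eq_neg_fderiv_mul_of_integrable
    ((hf.memLp_fderiv i).integrable_mul hg.memLp) (hf.memLp.integrable_mul (hg.memLp_fderiv i))
    (hf.memLp.integrable_mul hg.memLp) (fun x _ => hf.contDiff.differentiable (by norm_num) x)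
    (fun x _ => hg.contDiff.differentiable (by norm_num) x)

theorem Regular.h1 {f : ℝ → Plane → ℝ} (hf : Regular f) {t : ℝ} (ht : 0 ≤ t) : H1 (f t) where
  contDiff := (hf.smooth.contDiff_slice ht).of_le (WithTop.coe_le_coe.2 le_top)
  memLp := hf.memLp ht
  memLp_fderiv i := (hf.dx i).memLp ht

theorem Regular.integral_mul_dx {f g : ℝ → Plane → ℝ} (hf : Regular f) (hg : Regular g)
    {t : ℝ} (ht : 0 ≤ t) (i : Fin 2) :
    ∫ x, f t x * INS2D.dx i g t x = -∫ x, INS2D.dx i f t x * g t x :=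
  (hf.h1 ht).integral_mul_fderiv (hg.h1 ht) i

end Slices

section TimeDerivative

theorem integrable_prod_Icc {f' : ℝ → Plane → ℝ} {a b B : ℝ}
    (hc : ContinuousOn (fun q : ℝ × Plane => f' q.1 q.2) (Icc a b ×ˢ univ))
    (hi : ∀ s ∈ Icc a b, Integrable (f' s)) (hB : ∀ s ∈ Icc a b, ∫ x, |f' s x| ≤ B) :
    Integrable (fun q : ℝ × Plane => f' q.1 q.2) ((volume.restrict (Icc a b)).prod volume) := by
  have hm : AEStronglyMeasurable (fun q : ℝ × Plane => f' q.1 q.2)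
      ((volume.restrict (Icc a b)).prod volume) := by
    have h1 := hc.aestronglyMeasurable (μ := (volume : Measure (ℝ × Plane)))
      (measurableSet_Icc.prod MeasurableSet.univ)
    rwa [Measure.volume_eq_prod, ← Measure.prod_restrict, Measure.restrict_univ] at h1
  rw [integrable_prod_iff hm]
  constructor
  · exact (ae_restrict_iff' measurableSet_Icc).2 (Eventually.of_forall fun s hs => hi s hs)
  · refine Integrable.mono' (g := fun _ => B) (integrable_const B) hm.norm.integral_prod_right' ?_
    refine (ae_restrict_iff' measurableSet_Icc).2 (Eventually.of_forall fun s hs => ?_)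
    simp only [Real.norm_eq_abs]
    rw [abs_of_nonneg (integral_nonneg fun _ => abs_nonneg _)]
    exact hB s hs

theorem intervalIntegrable_integral {f' : ℝ → Plane → ℝ} {a b B : ℝ} (hab : a ≤ b)
    (hc : ContinuousOn (fun q : ℝ × Plane => f' q.1 q.2) (Icc a b ×ˢ univ))
    (hi : ∀ s ∈ Icc a b, Integrable (f' s)) (hB : ∀ s ∈ Icc a b, ∫ x, |f' s x| ≤ B) :
    IntervalIntegrable (fun s => ∫ x, f' s x) volume a b := by
  rw [intervalIntegrable_iff_integrableOn_Icc_of_le hab]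
  exact (integrable_prod_Icc hc hi hB).integral_prod_left

theorem integral_sub_eq_intervalIntegral {f f' : ℝ → Plane → ℝ} {a b B : ℝ} (hab : a ≤ b)
    (hd : ∀ x, ∀ s ∈ Icc a b, HasDerivWithinAt (fun s => f s x) (f' s x) (Icc a b) s)
    (hc : ContinuousOn (fun q : ℝ × Plane => f' q.1 q.2) (Icc a b ×ˢ univ))
    (hi : ∀ s ∈ Icc a b, Integrable (f' s)) (hB : ∀ s ∈ Icc a b, ∫ x, |f' s x| ≤ B)
    (ha : Integrable (f a)) (hb : Integrable (f b)) :
    (∫ x, f b x) - ∫ x, f a x = ∫ s in a..b, ∫ x, f' s x := by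
  have hintg := integrable_prod_Icc hc hi hB
  rw [intervalIntegral.integral_of_le hab, ← integral_Icc_eq_integral_Ioc, ← integral_sub hb ha,
    integral_integral_swap hintg]
  refine integral_congr_ae (Eventually.of_forall fun x => ?_)
  have hcx : ContinuousOn (fun s => f' s x) (Icc a b) :=
    hc.comp (f := fun s : ℝ => ((s, x) : ℝ × Plane)) (by fun_prop) (fun s hs => ⟨hs, mem_univ _⟩)
  change f b x - f a x = ∫ s in Icc a b, f' s x
  rw [integral_Icc_eq_integral_Ioc, ← intervalIntegral.integral_of_le hab]
  symm
  refine intervalIntegral.integral_eq_sub_of_hasDeriv_right_of_le hab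
    (fun s hs => (hd x s hs).continuousWithinAt)
    (fun s hs => ?_) (hcx.intervalIntegrable_of_Icc hab)
  have := (hd x s (Ioo_subset_Icc_self hs)).hasDerivAt (Icc_mem_nhds hs.1 hs.2)
  exact this.hasDerivWithinAt

variable {f g : ℝ → Plane → ℝ}

theorem Regular.continuousOn_integral_mul (hf : Regular f) (hg : Regular g) :
    ContinuousOn (fun t => ∫ x, f t x * g t x) (Ici 0) :=
  hf.bddL2.l2.continuousOn_integral_mul hg.bddL2.l2

theorem MemLp.integral_abs_mul_le {f g : Plane → ℝ} (hf : MemLp f 2 volume) (hg : MemLp g 2 volume) :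
    ∫ x, |f x * g x| ≤ (∫ x, f x * f x) + ∫ x, g x * g x := by
  have i1 : Integrable (fun x => f x * f x) := hf.integrable_mul hf
  have i2 : Integrable (fun x => g x * g x) := hg.integrable_mul hg
  rw [← integral_add i1 i2]
  refine integral_mono (hf.integrable_mul hg).abs
    ((hf.integrable_mul hf).add (hg.integrable_mul hg)) fun x => ?_
  change |f x * g x| ≤ f x * f x + g x * g x
  rw [abs_le]
  constructor <;> nlinarith [sq_nonneg (f x - g x), sq_nonneg (f x + g x)]

theorem Regular.integral_mul_sub (hf : Regular f) (hg : Regular g) {b : ℝ} (hb : 0 ≤ b) :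
    (∫ x, f b x * g b x) - ∫ x, f 0 x * g 0 x =
      ∫ s in (0 : ℝ)..b, ∫ x, (INS2D.tderiv f s x * g s x + f s x * INS2D.tderiv g s x) := by
  have hsub : Icc 0 b ⊆ Ici 0 := fun t ht => ht.1
  have hcont := (((hf.tderiv.continuousOn_integral_mul hf.tderiv).add
    (hg.continuousOn_integral_mul hg)).add ((hf.continuousOn_integral_mul hf).add
      (hg.tderiv.continuousOn_integral_mul hg.tderiv))).mono hsub
  obtain ⟨B, hB⟩ := isCompact_Icc.bddAbove_image hcont
  refine integral_sub_eq_intervalIntegral (f := fun t x => f t x * g t x) (B := B) hb ?_ ?_ ?_ ?_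
    (hf.integrable_mul hg le_rfl) (hf.integrable_mul hg hb)
  · intro x s hs
    exact ((hf.smooth.hasDerivWithinAt hs.1 x).mul (hg.smooth.hasDerivWithinAt hs.1 x)).mono hsub
  · exact ((hf.tderiv.bddL2.cont.mul hg.bddL2.cont).add
      (hf.bddL2.cont.mul hg.tderiv.bddL2.cont)).mono (prod_mono hsub subset_rfl)
  · intro s hs
    exact (hf.tderiv.integrable_mul hg hs.1).add (hf.integrable_mul hg.tderiv hs.1)
  · intro s hs
    refine le_trans ?_ (hB ⟨s, hs, rfl⟩)
    have i1 := hf.tderiv.integrable_mul hg hs.1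
    have i2 := hf.integrable_mul hg.tderiv hs.1
    calc _ ≤ ∫ x, (|INS2D.tderiv f s x * g s x| + |f s x * INS2D.tderiv g s x|) :=
          integral_mono (i1.add i2).abs (i1.abs.add i2.abs) fun x => abs_add_le _ _
      _ = (∫ x, |INS2D.tderiv f s x * g s x|) + ∫ x, |f s x * INS2D.tderiv g s x| :=
          integral_add i1.abs i2.abs
      _ ≤ _ := add_le_add (MemLp.integral_abs_mul_le (hf.tderiv.memLp hs.1) (hg.memLp hs.1))
          (MemLp.integral_abs_mul_le (hf.memLp hs.1) (hg.tderiv.memLp hs.1))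

theorem Regular.hasDerivAt_integral_mul (hf : Regular f) (hg : Regular g) {t : ℝ} (ht : 0 < t) :
    HasDerivAt (fun t => ∫ x, f t x * g t x)
      ((∫ x, INS2D.tderiv f t x * g t x) + ∫ x, f t x * INS2D.tderiv g t x) t := by
  set G : ℝ → ℝ := fun s => (∫ x, INS2D.tderiv f s x * g s x) + ∫ x, f s x * INS2D.tderiv g s x
  have hG : ContinuousOn G (Ici 0) :=
    (hf.tderiv.continuousOn_integral_mul hg).add (hf.continuousOn_integral_mul hg.tderiv)
  have hG' : Continuous (fun s => G (max s 0)) :=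
    hG.comp_continuous (by fun_prop) fun s => mem_Ici.2 (le_max_right _ _)
  have h1 : HasDerivAt (fun b => (∫ x, f 0 x * g 0 x) + ∫ s in (0 : ℝ)..b, G (max s 0))
      (G (max t 0)) t :=
    (intervalIntegral.integral_hasDerivAt_right (hG'.intervalIntegrable 0 t)
      (hG'.stronglyMeasurableAtFilter _ _) hG'.continuousAt).const_add _
  rw [max_eq_left ht.le] at h1
  refine h1.congr_of_eventuallyEq ?_
  filter_upwards [Ioi_mem_nhds ht] with b hb
  have hb' : 0 ≤ b := le_of_lt hb
  have h2 := hf.integral_mul_sub hg hb'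
  have h3 : ∫ s in (0 : ℝ)..b, G (max s 0) = ∫ s in (0 : ℝ)..b,
      ∫ x, (INS2D.tderiv f s x * g s x + f s x * INS2D.tderiv g s x) := by
    refine intervalIntegral.integral_congr fun s hs => ?_
    rw [uIcc_of_le hb'] at hs
    simp only [max_eq_left hs.1, G]
    exact (integral_add (hf.tderiv.integrable_mul hg hs.1) (hf.integrable_mul hg.tderiv hs.1)).symm
  rw [h3, ← h2]; ring

end TimeDerivative

section Orthogonality

theorem tendsto_integral_tail {f : Plane → ℝ} (hf : Integrable f) :
    Tendsto (fun h : ℝ => ∫ x, {x : Plane | h / 2 ≤ ‖x‖}.indicator f x) atTop (𝓝 0) := by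
  have h0 : (0 : ℝ) = ∫ _ : Plane, (0 : ℝ) := by simp
  rw [h0]
  refine tendsto_integral_filter_of_dominated_convergence (fun x => ‖f x‖)
    (Eventually.of_forall fun h => ?_) (Eventually.of_forall fun h => Eventually.of_forall fun x => ?_)
    hf.norm (Eventually.of_forall fun x => ?_)
  · exact hf.1.indicator (measurableSet_le measurable_const measurable_norm)
  · exact norm_indicator_le_norm_self _ _
  · refine tendsto_const_nhds.congr' ?_
    filter_upwards [eventually_gt_atTop (2 * ‖x‖)] with h hh
    rw [indicator_of_notMem]
    simp only [mem_ofPred_eq, not_le]; linarith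

theorem norm_basisVec (i : Fin 2) : ‖basisVec i‖ = 1 := by simp [basisVec]

theorem tendsto_integral_mul_translate {f g : Plane → ℝ} (hf : MemLp f 2 volume)
    (hg : MemLp g 2 volume) :
    Tendsto (fun h : ℝ => ∫ x, f x * g (x + h • basisVec 0)) atTop (𝓝 0) := by
  have jf : Integrable (fun x => f x ^ 2) := hf.integrable_sq
  have jg : Integrable (fun x => g x ^ 2) := hg.integrable_sq
  have tf := tendsto_integral_tail jf
  have tg := tendsto_integral_tail jg
  rw [Metric.tendsto_atTop]
  intro ε hε
  set S := (∫ x, f x ^ 2) + ∫ x, g x ^ 2 with hS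
  have hS0 : 0 ≤ S := add_nonneg (integral_nonneg fun _ => sq_nonneg _)
    (integral_nonneg fun _ => sq_nonneg _)
  set δ := ε / (4 * (S + 1)) with hδ
  have hδ0 : 0 < δ := by positivity
  have hδS : δ * S ≤ ε / 4 := by
    rw [hδ, div_mul_eq_mul_div, div_le_iff₀ (by positivity)]; nlinarith
  have hsum := tf.add tg
  rw [add_zero] at hsum
  obtain ⟨N, hN⟩ := (Metric.tendsto_atTop.1 hsum) (δ * (ε / 4)) (by positivity)
  refine ⟨max N 0, fun h hh => ?_⟩
  have hh0 : 0 ≤ h := (le_max_right _ _).trans hh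
  have hN' := hN h ((le_max_left _ _).trans hh)
  rw [Real.dist_eq, sub_zero] at hN' ⊢
  set A : Set Plane := {x : Plane | h / 2 ≤ ‖x‖} with hA
  have hAm : MeasurableSet A := measurableSet_le measurable_const measurable_norm
  set e : Plane := h • basisVec 0 with he
  have hen : ‖e‖ = h := by rw [he, norm_smul, norm_basisVec, mul_one, Real.norm_of_nonneg hh0]
  have tr : ∀ F : Plane → ℝ, ∫ x, F (x + e) = ∫ x, F x := fun F => integral_add_right_eq_self F e
  have kf : Integrable (A.indicator fun x => f x ^ 2) := jf.indicator hAm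
  have kg : Integrable (A.indicator fun x => g x ^ 2) := jg.indicator hAm
  have jg' : Integrable (fun x => g (x + e) ^ 2) := jg.comp_add_right e
  have kg' : Integrable (fun x => A.indicator (fun x => g x ^ 2) (x + e)) := kg.comp_add_right e
  have hpt : ∀ x, ‖f x * g (x + e)‖ ≤ δ * (f x ^ 2 + g (x + e) ^ 2) +
      δ⁻¹ * (A.indicator (fun x => f x ^ 2) x + A.indicator (fun x => g x ^ 2) (x + e)) := by
    intro x
    have n1 : 0 ≤ A.indicator (fun x => f x ^ 2) x := indicator_nonneg (fun _ _ => sq_nonneg _) _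
    have n2 : 0 ≤ A.indicator (fun x => g x ^ 2) (x + e) :=
      indicator_nonneg (fun _ _ => sq_nonneg _) _
    have am : ∀ a b : ℝ, |a * b| ≤ δ * a ^ 2 + δ⁻¹ * b ^ 2 := by
      intro a b
      have h1 : δ * δ⁻¹ = 1 := mul_inv_cancel₀ hδ0.ne'
      have h2 : δ⁻¹ * (δ * a - b) ^ 2 = δ * a ^ 2 - 2 * a * b + δ⁻¹ * b ^ 2 := by
        field_simp; ring
      have h3 : δ⁻¹ * (δ * a + b) ^ 2 = δ * a ^ 2 + 2 * a * b + δ⁻¹ * b ^ 2 := by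
        field_simp; ring
      have h4 : 0 ≤ δ⁻¹ * (δ * a - b) ^ 2 := by positivity
      have h5 : 0 ≤ δ⁻¹ * (δ * a + b) ^ 2 := by positivity
      have h6 : 0 ≤ δ * a ^ 2 := by positivity
      have h7 : 0 ≤ δ⁻¹ * b ^ 2 := by positivity
      rw [abs_le]; constructor <;> linarith
    have hδi : 0 < δ⁻¹ := inv_pos.2 hδ0
    rw [Real.norm_eq_abs]
    by_cases hx : x ∈ A
    · have := am (g (x + e)) (f x)
      rw [indicator_of_mem hx, mul_comm (f x)]
      have : 0 ≤ δ * f x ^ 2 := by positivity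
      have : 0 ≤ δ⁻¹ * A.indicator (fun x => g x ^ 2) (x + e) := by positivity
      linarith
    · have hx' : x + e ∈ A := by
        simp only [hA, mem_ofPred_eq, not_le] at hx ⊢
        have : ‖e‖ ≤ ‖x + e‖ + ‖x‖ := by
          have := norm_sub_le (x + e) x
          simpa using this
        linarith
      have := am (f x) (g (x + e))
      rw [indicator_of_mem hx']
      have : 0 ≤ δ * g (x + e) ^ 2 := by positivity
      have : 0 ≤ δ⁻¹ * A.indicator (fun x => f x ^ 2) x := by positivity
      linarith
  have hle := norm_integral_le_of_norm_le
    (((jf.add jg').const_mul δ).add ((kf.add kg').const_mul δ⁻¹)) (Eventually.of_forall hpt)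
  have hval : ∫ x, (δ * (f x ^ 2 + g (x + e) ^ 2) +
      δ⁻¹ * (A.indicator (fun x => f x ^ 2) x + A.indicator (fun x => g x ^ 2) (x + e))) =
      δ * S + δ⁻¹ * ((∫ x, A.indicator (fun x => f x ^ 2) x) +
        ∫ x, A.indicator (fun x => g x ^ 2) x) := by
    have i1 : Integrable (fun x => δ * (f x ^ 2 + g (x + e) ^ 2)) := (jf.add jg').const_mul δ
    have i2 : Integrable (fun x => δ⁻¹ * (A.indicator (fun x => f x ^ 2) x
      + A.indicator (fun x => g x ^ 2) (x + e))) := (kf.add kg').const_mul δ⁻¹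
    rw [integral_add i1 i2, integral_const_mul, integral_const_mul, integral_add jf jg',
      integral_add kf kg', tr (fun x => g x ^ 2), tr (A.indicator (fun x => g x ^ 2))]
  have hle' : ‖∫ x, f x * g (x + e)‖ ≤ _ := hle.trans_eq hval
  rw [Real.norm_eq_abs] at hle'
  refine hle'.trans_lt ?_
  have h8 := (abs_lt.1 hN').2
  have h9 : δ⁻¹ * ((∫ x, A.indicator (fun x => f x ^ 2) x) +
        ∫ x, A.indicator (fun x => g x ^ 2) x) ≤ ε / 4 := by
    rw [inv_mul_le_iff₀ hδ0]; exact h8.le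
  linarith

theorem H1.translate {f : Plane → ℝ} (hf : H1 f) (e : Plane) : H1 (fun x => f (x + e)) where
  contDiff := hf.contDiff.comp (contDiff_id.add contDiff_const)
  memLp := hf.memLp.comp_measurePreserving (measurePreserving_add_right volume e)
  memLp_fderiv i := by
    simp only [fderiv_comp_add_right]
    exact (hf.memLp_fderiv i).comp_measurePreserving (measurePreserving_add_right volume e)

/-- Curl-free fields are orthogonal in `L²` to derivatives of divergence-free fields. -/
theorem H1.integral_curlFree_fderiv_divFree {F₀ F₁ φ₀ φ₁ : Plane → ℝ} (hF₀ : H1 F₀) (hF₁ : H1 F₁)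
    (h₀ : H1 φ₀) (h₁ : H1 φ₁)
    (hcurl : ∀ x, fderiv ℝ F₀ x (basisVec 1) = fderiv ℝ F₁ x (basisVec 0))
    (hdiv : ∀ x, fderiv ℝ φ₀ x (basisVec 0) + fderiv ℝ φ₁ x (basisVec 1) = 0) :
    ∫ x, (F₀ x * fderiv ℝ φ₀ x (basisVec 0) + F₁ x * fderiv ℝ φ₁ x (basisVec 0)) = 0 := by
  have i1 : Integrable (fun x => F₀ x * fderiv ℝ φ₀ x (basisVec 0)) :=
    hF₀.memLp.integrable_mul (h₀.memLp_fderiv 0)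
  have i2 : Integrable (fun x => F₁ x * fderiv ℝ φ₁ x (basisVec 0)) :=
    hF₁.memLp.integrable_mul (h₁.memLp_fderiv 0)
  rw [integral_add i1 i2, hF₁.integral_mul_fderiv h₁ 0]
  have e1 : ∫ x, F₀ x * fderiv ℝ φ₀ x (basisVec 0) = -∫ x, F₀ x * fderiv ℝ φ₁ x (basisVec 1) := by
    rw [← integral_neg]
    refine integral_congr_ae (Eventually.of_forall fun x => ?_)
    change F₀ x * fderiv ℝ φ₀ x (basisVec 0) = -(F₀ x * fderiv ℝ φ₁ x (basisVec 1))
    rw [eq_neg_of_add_eq_zero_left (hdiv x)]; ring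
  rw [e1, hF₀.integral_mul_fderiv h₁ 1]
  simp only [hcurl]; ring

/-- Curl-free fields are orthogonal in `L²` to divergence-free fields. -/
theorem H1.integral_curlFree_divFree {F₀ F₁ φ₀ φ₁ : Plane → ℝ} (hF₀ : H1 F₀) (hF₁ : H1 F₁)
    (h₀ : H1 φ₀) (h₁ : H1 φ₁)
    (hcurl : ∀ x, fderiv ℝ F₀ x (basisVec 1) = fderiv ℝ F₁ x (basisVec 0))
    (hdiv : ∀ x, fderiv ℝ φ₀ x (basisVec 0) + fderiv ℝ φ₁ x (basisVec 1) = 0) :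
    (∫ x, F₀ x * φ₀ x) + ∫ x, F₁ x * φ₁ x = 0 := by
  have hlim := (tendsto_integral_mul_translate hF₀.memLp h₀.memLp).add
    (tendsto_integral_mul_translate hF₁.memLp h₁.memLp)
  rw [add_zero] at hlim
  refine tendsto_nhds_unique (tendsto_const_nhds.congr' ?_) hlim
  filter_upwards [eventually_ge_atTop 0] with h hh
  have tl : ∀ s : ℝ, ∀ f : Plane → ℝ, MemLp f 2 volume →
      MemLp (fun x => f (x + s • basisVec 0)) 2 volume := fun s f hf =>
    hf.comp_measurePreserving (measurePreserving_add_right volume _)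
  have tr : ∀ s : ℝ, ∀ f : Plane → ℝ, ∫ x, f (x + s • basisVec 0) = ∫ x, f x := fun s f =>
    integral_add_right_eq_self f _
  set f : ℝ → Plane → ℝ := fun s x =>
    F₀ x * φ₀ (x + s • basisVec 0) + F₁ x * φ₁ (x + s • basisVec 0) with hf
  set f' : ℝ → Plane → ℝ := fun s x => F₀ x * fderiv ℝ φ₀ (x + s • basisVec 0) (basisVec 0)
    + F₁ x * fderiv ℝ φ₁ (x + s • basisVec 0) (basisVec 0) with hf'
  have intf : ∀ s, Integrable (f s) := fun s =>
    (hF₀.memLp.integrable_mul (tl s _ h₀.memLp)).add (hF₁.memLp.integrable_mul (tl s _ h₁.memLp))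
  have j0 : ∀ s, Integrable (fun x => F₀ x * fderiv ℝ φ₀ (x + s • basisVec 0) (basisVec 0)) :=
    fun s => hF₀.memLp.integrable_mul (tl s _ (h₀.memLp_fderiv 0))
  have j1 : ∀ s, Integrable (fun x => F₁ x * fderiv ℝ φ₁ (x + s • basisVec 0) (basisVec 0)) :=
    fun s => hF₁.memLp.integrable_mul (tl s _ (h₁.memLp_fderiv 0))
  have intf' : ∀ s, Integrable (f' s) := fun s => (j0 s).add (j1 s)
  have zero : ∀ s, ∫ x, f' s x = 0 := by
    intro s
    have := H1.integral_curlFree_fderiv_divFree hF₀ hF₁ (h₀.translate (s • basisVec 0))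
      (h₁.translate (s • basisVec 0)) hcurl (fun x => by
        simp only [fderiv_comp_add_right]; exact hdiv _)
    simpa only [fderiv_comp_add_right] using this
  have key := integral_sub_eq_intervalIntegral (f := f) (f' := f') hh
    (B := ((∫ x, F₀ x * F₀ x) + ∫ x, fderiv ℝ φ₀ x (basisVec 0) * fderiv ℝ φ₀ x (basisVec 0)) +
      ((∫ x, F₁ x * F₁ x) + ∫ x, fderiv ℝ φ₁ x (basisVec 0) * fderiv ℝ φ₁ x (basisVec 0)))
    ?_ ?_ (fun s _ => intf' s) ?_ (intf 0) (intf h)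
  · simp only [zero, intervalIntegral.integral_zero] at key
    have e0 : ∀ s, ∫ x, f s x = (∫ x, F₀ x * φ₀ (x + s • basisVec 0)) +
        ∫ x, F₁ x * φ₁ (x + s • basisVec 0) := fun s =>
      integral_add (hF₀.memLp.integrable_mul (tl s _ h₀.memLp))
        (hF₁.memLp.integrable_mul (tl s _ h₁.memLp))
    rw [e0, e0] at key
    simp only [zero_smul, add_zero] at key
    linarith
  · intro x s _
    have d : HasDerivAt (fun s : ℝ => x + s • basisVec 0) (basisVec 0) s := by
      simpa using ((hasDerivAt_id s).smul_const (basisVec 0)).const_add x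
    have d0 := ((h₀.contDiff.differentiable (by norm_num)) (x + s • basisVec 0)).hasFDerivAt.comp_hasDerivAt s d
    have d1 := ((h₁.contDiff.differentiable (by norm_num)) (x + s • basisVec 0)).hasFDerivAt.comp_hasDerivAt s d
    exact ((d0.const_mul (F₀ x)).add (d1.const_mul (F₁ x))).hasDerivWithinAt
  · have c0 := h₀.contDiff.continuous_fderiv (by norm_num)
    have c1 := h₁.contDiff.continuous_fderiv (by norm_num)
    have cF₀ := hF₀.contDiff.continuous
    have cF₁ := hF₁.contDiff.continuous
    refine Continuous.continuousOn ?_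
    simp only [hf']
    have hsh : Continuous (fun q : ℝ × Plane => q.2 + q.1 • basisVec 0) := by fun_prop
    exact ((cF₀.comp continuous_snd).mul ((c0.comp hsh).clm_apply continuous_const)).add
      ((cF₁.comp continuous_snd).mul ((c1.comp hsh).clm_apply continuous_const))
  · intro s _
    calc _ ≤ ∫ x, (|F₀ x * fderiv ℝ φ₀ (x + s • basisVec 0) (basisVec 0)| +
          |F₁ x * fderiv ℝ φ₁ (x + s • basisVec 0) (basisVec 0)|) :=
          integral_mono (intf' s).abs ((j0 s).abs.add (j1 s).abs) fun x => abs_add_le _ _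
      _ = _ := integral_add (j0 s).abs (j1 s).abs
      _ ≤ _ := by
        refine add_le_add ?_ ?_
        · have := MemLp.integral_abs_mul_le hF₀.memLp (tl s _ (h₀.memLp_fderiv 0))
          rwa [tr s (fun x => fderiv ℝ φ₀ x (basisVec 0) * fderiv ℝ φ₀ x (basisVec 0))] at this
        · have := MemLp.integral_abs_mul_le hF₁.memLp (tl s _ (h₁.memLp_fderiv 0))
          rwa [tr s (fun x => fderiv ℝ φ₁ x (basisVec 0) * fderiv ℝ φ₁ x (basisVec 0))] at this

end Orthogonality

section Inequalities

theorem eq_sum_basisVec (v : Plane) : v = v 0 • basisVec 0 + v 1 • basisVec 1 := by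
  ext i; fin_cases i <;> simp [basisVec]

theorem norm_clm_le (L : Plane →L[ℝ] ℝ) : ‖L‖ ≤ |L (basisVec 0)| + |L (basisVec 1)| := by
  refine L.opNorm_le_bound (by positivity) fun v => ?_
  have h0 : |v 0| ≤ ‖v‖ := by simpa using PiLp.norm_apply_le v 0
  have h1 : |v 1| ≤ ‖v‖ := by simpa using PiLp.norm_apply_le v 1
  conv_lhs => rw [eq_sum_basisVec v, map_add, map_smul, map_smul]
  simp only [smul_eq_mul, Real.norm_eq_abs]
  calc |v 0 * L (basisVec 0) + v 1 * L (basisVec 1)|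
      ≤ |v 0| * |L (basisVec 0)| + |v 1| * |L (basisVec 1)| := by
        rw [← abs_mul, ← abs_mul]; exact abs_add_le _ _
    _ ≤ ‖v‖ * |L (basisVec 0)| + ‖v‖ * |L (basisVec 1)| := by gcongr
    _ = _ := by ring

/-- Gagliardo–Nirenberg–Sobolev inequality for compactly supported functions. -/
theorem exists_sq_integral_le_of_compactSupport : ∃ C : ℝ, 0 ≤ C ∧ ∀ (h : Plane → ℝ) (B : Plane → ℝ),
    ContDiff ℝ 1 h → HasCompactSupport h → Integrable B → (∀ x, ‖fderiv ℝ h x‖ ≤ B x) →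
    ∫ x, h x ^ 2 ≤ C * (∫ x, B x) ^ 2 := by
  have hp : Real.HolderConjugate (Module.finrank ℝ Plane) 2 := by
    simp only [finrank_euclideanSpace, Fintype.card_fin, Nat.cast_ofNat]
    exact Real.HolderConjugate.two_two
  refine ⟨(lintegralPowLePowLIntegralFDerivConst (volume : Measure Plane) 2 : ℝ≥0), NNReal.coe_nonneg _, ?_⟩
  intro h B hh hs hB hb
  have key := lintegral_pow_le_pow_lintegral_fderiv (volume : Measure Plane) hh hs hp
  have hi : Integrable (fun x => h x ^ 2) :=
    (hh.continuous.memLp_of_hasCompactSupport hs (p := 2) (μ := volume)).integrable_sq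
  have hB0 : 0 ≤ ∫ x, B x := integral_nonneg fun x => (norm_nonneg _).trans (hb x)
  have e1 : ∫⁻ x, ‖h x‖ₑ ^ (2 : ℝ) = ENNReal.ofReal (∫ x, h x ^ 2) := by
    rw [ofReal_integral_eq_lintegral_ofReal hi (Eventually.of_forall fun _ => sq_nonneg _)]
    refine lintegral_congr fun x => ?_
    rw [← ofReal_norm, ENNReal.ofReal_rpow_of_nonneg (norm_nonneg _) (by norm_num)]
    congr 1
    rw [Real.norm_eq_abs, Real.rpow_two, sq_abs]
  have e2 : ∫⁻ x, ‖fderiv ℝ h x‖ₑ ≤ ENNReal.ofReal (∫ x, B x) := by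
    rw [ofReal_integral_eq_lintegral_ofReal hB
      (Eventually.of_forall fun x => (norm_nonneg _).trans (hb x))]
    refine lintegral_mono fun x => ?_
    rw [← ofReal_norm]
    exact ENNReal.ofReal_le_ofReal (hb x)
  rw [e1] at key
  have e3 := key.trans (mul_le_mul_right (ENNReal.rpow_le_rpow e2 (by norm_num : (0:ℝ) ≤ 2)) _)
  rw [ENNReal.ofReal_rpow_of_nonneg hB0 (by norm_num), ← ENNReal.ofReal_coe_nnreal,
    ← ENNReal.ofReal_mul (NNReal.coe_nonneg _), Real.rpow_two] at e3
  exact (ENNReal.ofReal_le_ofReal_iff (by positivity)).1 e3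

/-- Gagliardo–Nirenberg–Sobolev inequality `‖h‖_{L²} ≤ C ‖∇h‖_{L¹}`. -/
theorem exists_sq_integral_le : ∃ C : ℝ, 0 ≤ C ∧ ∀ h : Plane → ℝ,
    ContDiff ℝ 1 h → Integrable h → MemLp h 2 volume →
    (∀ i, Integrable (fun x => fderiv ℝ h x (basisVec i))) →
    ∫ x, h x ^ 2 ≤ C * ((∫ x, |fderiv ℝ h x (basisVec 0)|) + ∫ x, |fderiv ℝ h x (basisVec 1)|) ^ 2 := by
  obtain ⟨C, hC, key⟩ := exists_sq_integral_le_of_compactSupport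
  refine ⟨C, hC, ?_⟩
  intro h hh hi h2 hd
  let χ : ContDiffBump (0 : Plane) := ⟨1, 2, one_pos, one_lt_two⟩
  have hχ : ContDiff ℝ 1 χ := χ.contDiff
  obtain ⟨K, hK⟩ := (χ.hasCompactSupport.fderiv ℝ).exists_bound_of_continuous
    (hχ.continuous_fderiv (by norm_num))
  let r : ℕ → ℝ := fun n => ((n : ℝ) + 1)⁻¹
  have hr : Tendsto r atTop (𝓝 0) := by
    have := tendsto_one_div_add_atTop_nhds_zero_nat (𝕜 := ℝ)
    simpa [r] using this
  have hr0 : ∀ n, 0 < r n := fun n => by positivity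
  let cut : ℕ → Plane → ℝ := fun n x => χ (r n • x)
  have hcut : ∀ n, ContDiff ℝ 1 (cut n) := fun n => hχ.comp (contDiff_const_smul (r n))
  have scut : ∀ n, HasCompactSupport (cut n) := fun n =>
    χ.hasCompactSupport.comp_smul (hr0 n).ne'
  have dcut : ∀ n x, ‖fderiv ℝ (cut n) x‖ ≤ r n * K := by
    intro n x
    have : HasFDerivAt (cut n) ((fderiv ℝ χ (r n • x)).comp
        (r n • ContinuousLinearMap.id ℝ Plane)) x :=
      ((hχ.differentiable (by norm_num)) (r n • x)).hasFDerivAt.comp x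
        ((hasFDerivAt_id x).const_smul (r n))
    rw [this.fderiv, ContinuousLinearMap.comp_smul, norm_smul, ContinuousLinearMap.comp_id,
      Real.norm_of_nonneg (hr0 n).le]
    exact mul_le_mul_of_nonneg_left (hK _) (hr0 n).le
  have bd : ∀ n x, |cut n x| ≤ 1 := fun n x => by
    rw [abs_of_nonneg χ.nonneg]; exact χ.le_one
  have hfd : ∀ n x, ‖fderiv ℝ (fun x => cut n x * h x) x‖ ≤
      (|fderiv ℝ h x (basisVec 0)| + |fderiv ℝ h x (basisVec 1)|) + r n * K * |h x| := by
    intro n x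
    have : fderiv ℝ (fun x => cut n x * h x) x = _ :=
      (((hcut n).differentiable (by norm_num) x).hasFDerivAt.mul
      ((hh.differentiable (by norm_num)) x).hasFDerivAt).fderiv
    rw [this]
    refine (norm_add_le _ _).trans (add_le_add ?_ ?_)
    · rw [norm_smul]
      refine le_trans (mul_le_of_le_one_left (norm_nonneg _) (bd n x)) (norm_clm_le _)
    · rw [norm_smul, mul_comm, Real.norm_eq_abs]
      exact mul_le_mul_of_nonneg_right (dcut n x) (abs_nonneg _)
  have hB : ∀ n, Integrable (fun x => (|fderiv ℝ h x (basisVec 0)| + |fderiv ℝ h x (basisVec 1)|)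
      + r n * K * |h x|) := fun n => (((hd 0).abs).add (hd 1).abs).add (hi.abs.const_mul _)
  have hn : ∀ n, ∫ x, (cut n x * h x) ^ 2 ≤ C * (((∫ x, |fderiv ℝ h x (basisVec 0)|) +
      ∫ x, |fderiv ℝ h x (basisVec 1)|) + r n * K * ∫ x, |h x|) ^ 2 := by
    intro n
    have := key (fun x => cut n x * h x) _ ((hcut n).mul hh) ((scut n).mul_right) (hB n) (hfd n)
    have i1 : Integrable (fun x => |fderiv ℝ h x (basisVec 0)| + |fderiv ℝ h x (basisVec 1)|) :=
      (hd 0).abs.add (hd 1).abs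
    rwa [integral_add i1 (hi.abs.const_mul _), integral_add (hd 0).abs (hd 1).abs,
      integral_const_mul] at this
  have lim1 : Tendsto (fun n => ∫ x, (cut n x * h x) ^ 2) atTop (𝓝 (∫ x, h x ^ 2)) := by
    refine tendsto_integral_of_dominated_convergence (fun x => h x ^ 2) (fun n => ?_)
      h2.integrable_sq (fun n => Eventually.of_forall fun x => ?_) (Eventually.of_forall fun x => ?_)
    · exact ((((hcut n).continuous.mul hh.continuous)).pow 2).aestronglyMeasurable
    · rw [Real.norm_eq_abs, abs_of_nonneg (sq_nonneg _), mul_pow]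
      exact mul_le_of_le_one_left (sq_nonneg _) ((sq_le_one_iff_abs_le_one _).2 (bd n x))
    · refine tendsto_const_nhds.congr' ?_
      have : Tendsto (fun n => r n * ‖x‖) atTop (𝓝 0) := by simpa using hr.mul_const ‖x‖
      filter_upwards [this.eventually_lt_const one_pos] with n hn
      have : cut n x = 1 := by
        refine χ.one_of_mem_closedBall ?_
        simp only [Metric.mem_closedBall, dist_zero_right, norm_smul, Real.norm_of_nonneg (hr0 n).le]
        exact hn.le
      rw [this, one_mul]
  have lim2 : Tendsto (fun n => C * (((∫ x, |fderiv ℝ h x (basisVec 0)|) +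
      ∫ x, |fderiv ℝ h x (basisVec 1)|) + r n * K * ∫ x, |h x|) ^ 2) atTop
      (𝓝 (C * ((∫ x, |fderiv ℝ h x (basisVec 0)|) + ∫ x, |fderiv ℝ h x (basisVec 1)|) ^ 2)) := by
    have := ((((hr.mul_const K).mul_const (∫ x, |h x|)).const_add
      ((∫ x, |fderiv ℝ h x (basisVec 0)|) + ∫ x, |fderiv ℝ h x (basisVec 1)|)).pow 2).const_mul C
    simpa using this
  exact le_of_tendsto_of_tendsto' lim1 lim2 hn

/-- The `L²` norm of a scalar function, through its integral. -/
def nrm (f : Plane → ℝ) : ℝ := Real.sqrt (∫ x, f x ^ 2)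

theorem nrm_nonneg (f : Plane → ℝ) : 0 ≤ nrm f := Real.sqrt_nonneg _

theorem nrm_sq (f : Plane → ℝ) : nrm f ^ 2 = ∫ x, f x ^ 2 :=
  Real.sq_sqrt (integral_nonneg fun _ => sq_nonneg _)

theorem integral_abs_mul_le_nrm {f g : Plane → ℝ} (hf : MemLp f 2 volume) (hg : MemLp g 2 volume) :
    ∫ x, |f x * g x| ≤ nrm f * nrm g := by
  have h := integral_mul_norm_le_Lp_mul_Lq (μ := (volume : Measure Plane)) (f := f) (g := g)
    Real.HolderConjugate.two_two (by simpa using hf) (by simpa using hg)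
  simp only [Real.norm_eq_abs, Real.rpow_two, sq_abs, ← abs_mul] at h
  simpa only [nrm, Real.sqrt_eq_rpow] using h

theorem abs_integral_mul_le_nrm {f g : Plane → ℝ} (hf : MemLp f 2 volume) (hg : MemLp g 2 volume) :
    |∫ x, f x * g x| ≤ nrm f * nrm g :=
  abs_integral_le_integral_abs.trans (integral_abs_mul_le_nrm hf hg)

end Inequalities

section Products

theorem exists_nrm_le : ∃ C : ℝ, 0 ≤ C ∧ ∀ h : Plane → ℝ,
    ContDiff ℝ 1 h → Integrable h → MemLp h 2 volume →
    (∀ i, Integrable (fun x => fderiv ℝ h x (basisVec i))) →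
    nrm h ≤ C * ((∫ x, |fderiv ℝ h x (basisVec 0)|) + ∫ x, |fderiv ℝ h x (basisVec 1)|) := by
  obtain ⟨C, hC, key⟩ := exists_sq_integral_le
  refine ⟨Real.sqrt C, Real.sqrt_nonneg _, fun h h1 h2 h3 h4 => ?_⟩
  have hs : 0 ≤ (∫ x, |fderiv ℝ h x (basisVec 0)|) + ∫ x, |fderiv ℝ h x (basisVec 1)| :=
    add_nonneg (integral_nonneg fun _ => abs_nonneg _) (integral_nonneg fun _ => abs_nonneg _)
  rw [← Real.sqrt_sq hs, ← Real.sqrt_mul hC]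
  exact Real.sqrt_le_sqrt (key h h1 h2 h3 h4)

/-- The constant of the inequality `‖h‖_{L²} ≤ κ ‖∇h‖_{L¹}`. -/
def gnsConst : ℝ := Classical.choose exists_nrm_le

theorem gnsConst_nonneg : 0 ≤ gnsConst := (Classical.choose_spec exists_nrm_le).1

/-- The sum of the `L²` norms of the partial derivatives. -/
def gnrm (f : ℝ → Plane → ℝ) (t : ℝ) : ℝ := nrm (dx 0 f t) + nrm (dx 1 f t)

theorem gnrm_nonneg (f : ℝ → Plane → ℝ) (t : ℝ) : 0 ≤ gnrm f t :=
  add_nonneg (nrm_nonneg _) (nrm_nonneg _)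

variable {f g h : ℝ → Plane → ℝ} {t : ℝ}

theorem Regular.dx_mul (hf : Regular f) (hg : Regular g) (ht : 0 ≤ t) (i : Fin 2) (x : Plane) :
    INS2D.dx i (fun t x => f t x * g t x) t x =
      INS2D.dx i f t x * g t x + f t x * INS2D.dx i g t x :=
  congrFun (hf.smooth.dx_mul hg.smooth i ht) x

theorem Regular.dx_add (hf : Regular f) (hg : Regular g) (ht : 0 ≤ t) (i : Fin 2) (x : Plane) :
    INS2D.dx i (fun t x => f t x + g t x) t x = INS2D.dx i f t x + INS2D.dx i g t x :=
  congrFun (hf.smooth.dx_add hg.smooth i ht) x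

theorem Regular.tderiv_mul (hf : Regular f) (hg : Regular g) (ht : 0 ≤ t) (x : Plane) :
    INS2D.tderiv (fun t x => f t x * g t x) t x =
      INS2D.tderiv f t x * g t x + f t x * INS2D.tderiv g t x :=
  congrFun (hf.smooth.tderiv_mul hg.smooth ht) x

theorem Regular.tderiv_add (hf : Regular f) (hg : Regular g) (ht : 0 ≤ t) (x : Plane) :
    INS2D.tderiv (fun t x => f t x + g t x) t x = INS2D.tderiv f t x + INS2D.tderiv g t x :=
  congrFun (hf.smooth.tderiv_add hg.smooth ht) x

theorem Regular.integral_abs_dx_mul_le (hf : Regular f) (hg : Regular g) (ht : 0 ≤ t) (i : Fin 2) :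
    Integrable (INS2D.dx i (fun t x => f t x * g t x) t) ∧
    ∫ x, |INS2D.dx i (fun t x => f t x * g t x) t x| ≤
      nrm (INS2D.dx i f t) * nrm (g t) + nrm (f t) * nrm (INS2D.dx i g t) := by
  have i1 := (hf.dx i).integrable_mul hg ht
  have i2 := hf.integrable_mul (hg.dx i) ht
  have e : INS2D.dx i (fun t x => f t x * g t x) t =
      fun x => INS2D.dx i f t x * g t x + f t x * INS2D.dx i g t x :=
    funext fun x => hf.dx_mul hg ht i x
  rw [e]
  refine ⟨i1.add i2, ?_⟩
  calc _ ≤ ∫ x, (|INS2D.dx i f t x * g t x| + |f t x * INS2D.dx i g t x|) :=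
        integral_mono (i1.add i2).abs (i1.abs.add i2.abs) fun x => abs_add_le _ _
    _ = (∫ x, |INS2D.dx i f t x * g t x|) + ∫ x, |f t x * INS2D.dx i g t x| :=
        integral_add i1.abs i2.abs
    _ ≤ _ := add_le_add (integral_abs_mul_le_nrm ((hf.dx i).memLp ht) (hg.memLp ht))
        (integral_abs_mul_le_nrm (hf.memLp ht) ((hg.dx i).memLp ht))

/-- The bilinear Gagliardo–Nirenberg inequality. -/
theorem Regular.nrm_mul_le (hf : Regular f) (hg : Regular g) (ht : 0 ≤ t) :
    nrm (fun x => f t x * g t x) ≤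
      gnsConst * (gnrm f t * nrm (g t) + nrm (f t) * gnrm g t) := by
  have key := (Classical.choose_spec exists_nrm_le).2 (fun x => f t x * g t x)
    ((hf.mul hg).h1 ht).contDiff (hf.integrable_mul hg ht) ((hf.mul hg).memLp ht)
    (fun i => (hf.integral_abs_dx_mul_le hg ht i).1)
  refine key.trans ?_
  refine mul_le_mul_of_nonneg_left ?_ gnsConst_nonneg
  have h0 := (hf.integral_abs_dx_mul_le hg ht 0).2
  have h1 := (hf.integral_abs_dx_mul_le hg ht 1).2
  have := add_le_add h0 h1
  refine this.trans (le_of_eq ?_)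
  unfold gnrm; ring

theorem Regular.nrm_sq_mul_le (hf : Regular f) (hg : Regular g) (ht : 0 ≤ t) :
    nrm (fun x => f t x * g t x) ^ 2 ≤
      (2 * gnsConst) ^ 2 * (nrm (f t) * gnrm f t * (nrm (g t) * gnrm g t)) := by
  have h1 := hf.nrm_mul_le hf ht
  have h2 := hg.nrm_mul_le hg ht
  have h3 := integral_abs_mul_le_nrm ((hf.mul hf).memLp ht) ((hg.mul hg).memLp ht)
  have e : nrm (fun x => f t x * g t x) ^ 2 = ∫ x, |f t x * f t x * (g t x * g t x)| := by
    rw [nrm_sq]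
    refine integral_congr_ae (Eventually.of_forall fun x => ?_)
    change (f t x * g t x) ^ 2 = |f t x * f t x * (g t x * g t x)|
    rw [abs_of_nonneg (mul_nonneg (mul_self_nonneg _) (mul_self_nonneg _))]; ring
  rw [e]
  refine h3.trans ((mul_le_mul h1 h2 (nrm_nonneg _) ((nrm_nonneg _).trans h1)).trans (le_of_eq ?_))
  ring

/-- The trilinear Gagliardo–Nirenberg inequality. -/
theorem Regular.nrm_mul_mul_le (hf : Regular f) (hg : Regular g) (hh : Regular h) (ht : 0 ≤ t) :
    nrm (fun x => f t x * g t x * h t x) ≤ gnsConst *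
      (gnrm f t * nrm (fun x => g t x * h t x) + gnrm g t * nrm (fun x => f t x * h t x)
        + gnrm h t * nrm (fun x => f t x * g t x)) := by
  have hd : ∀ i, Integrable (INS2D.dx i (fun t x => f t x * g t x * h t x) t) ∧
      ∫ x, |INS2D.dx i (fun t x => f t x * g t x * h t x) t x| ≤
        nrm (INS2D.dx i f t) * nrm (fun x => g t x * h t x)
        + nrm (INS2D.dx i g t) * nrm (fun x => f t x * h t x)
        + nrm (INS2D.dx i h t) * nrm (fun x => f t x * g t x) := by
    intro i
    have i1 := (hf.dx i).integrable_mul (hg.mul hh) ht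
    have i2 := (hg.dx i).integrable_mul (hf.mul hh) ht
    have i3 := (hh.dx i).integrable_mul (hf.mul hg) ht
    have e : INS2D.dx i (fun t x => f t x * g t x * h t x) t =
        fun x => INS2D.dx i f t x * (g t x * h t x) + INS2D.dx i g t x * (f t x * h t x)
          + INS2D.dx i h t x * (f t x * g t x) := by
      ext1 x
      rw [(hf.mul hg).dx_mul hh ht i x, hf.dx_mul hg ht i x]; ring
    rw [e]
    have i12 := i1.add i2
    have i12' : Integrable (fun x => |INS2D.dx i f t x * (g t x * h t x)|
      + |INS2D.dx i g t x * (f t x * h t x)|) := i1.abs.add i2.abs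
    refine ⟨i12.add i3, ?_⟩
    calc _ ≤ ∫ x, (|INS2D.dx i f t x * (g t x * h t x)| + |INS2D.dx i g t x * (f t x * h t x)|
            + |INS2D.dx i h t x * (f t x * g t x)|) :=
          integral_mono (i12.add i3).abs (i12'.add i3.abs) fun x => abs_add_three _ _ _
      _ = (∫ x, |INS2D.dx i f t x * (g t x * h t x)|) + (∫ x, |INS2D.dx i g t x * (f t x * h t x)|)
            + ∫ x, |INS2D.dx i h t x * (f t x * g t x)| := by
          rw [integral_add i12' i3.abs, integral_add i1.abs i2.abs]
      _ ≤ _ := add_le_add (add_le_add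
          (integral_abs_mul_le_nrm ((hf.dx i).memLp ht) ((hg.mul hh).memLp ht))
          (integral_abs_mul_le_nrm ((hg.dx i).memLp ht) ((hf.mul hh).memLp ht)))
          (integral_abs_mul_le_nrm ((hh.dx i).memLp ht) ((hf.mul hg).memLp ht))
  have key := (Classical.choose_spec exists_nrm_le).2 (fun x => f t x * g t x * h t x)
    (((hf.mul hg).mul hh).h1 ht).contDiff ((hf.mul hg).integrable_mul hh ht)
    (((hf.mul hg).mul hh).memLp ht) (fun i => (hd i).1)
  refine key.trans (mul_le_mul_of_nonneg_left ?_ gnsConst_nonneg)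
  refine (add_le_add (hd 0).2 (hd 1).2).trans (le_of_eq ?_)
  unfold gnrm; ring

end Products

section HasInt

/-- `F` is integrable on the plane with integral `c`. -/
structure HasInt (F : Plane → ℝ) (c : ℝ) : Prop where
  integrable : Integrable F
  eq : ∫ x, F x = c

variable {F G : Plane → ℝ} {c d : ℝ}

theorem HasInt.add (hF : HasInt F c) (hG : HasInt G d) : HasInt (fun x => F x + G x) (c + d) :=
  ⟨hF.1.add hG.1, by rw [integral_add hF.1 hG.1, hF.2, hG.2]⟩

theorem HasInt.sub (hF : HasInt F c) (hG : HasInt G d) : HasInt (fun x => F x - G x) (c - d) :=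
  ⟨hF.1.sub hG.1, by rw [integral_sub hF.1 hG.1, hF.2, hG.2]⟩

theorem HasInt.const_mul (hF : HasInt F c) (a : ℝ) : HasInt (fun x => a * F x) (a * c) :=
  ⟨hF.1.const_mul a, by rw [integral_const_mul, hF.2]⟩

theorem HasInt.congr (hF : HasInt F c) (h : ∀ x, G x = F x) : HasInt G c := by
  rwa [show G = F from funext h]

theorem HasInt.of_integrable (hF : Integrable F) : HasInt F (∫ x, F x) := ⟨hF, rfl⟩

theorem HasInt.unique (hF : HasInt F c) (hF' : HasInt F d) : c = d := hF.2.symm.trans hF'.2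

theorem HasInt.sum {ι : Type*} (s : Finset ι) {F : ι → Plane → ℝ} {c : ι → ℝ}
    (h : ∀ i ∈ s, HasInt (F i) (c i)) : HasInt (fun x => ∑ i ∈ s, F i x) (∑ i ∈ s, c i) :=
  ⟨integrable_finsetSum s fun i hi => (h i hi).1, by
    rw [integral_finsetSum s fun i hi => (h i hi).1]
    exact Finset.sum_congr rfl fun i hi => (h i hi).2⟩

variable {f g : ℝ → Plane → ℝ} {t : ℝ}

theorem Regular.hasInt_mul (hf : Regular f) (hg : Regular g) (ht : 0 ≤ t) :
    HasInt (fun x => f t x * g t x) (∫ x, f t x * g t x) :=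
  HasInt.of_integrable (hf.integrable_mul hg ht)

theorem Regular.hasInt_ibp (hf : Regular f) (hg : Regular g) (ht : 0 ≤ t) (i : Fin 2) :
    HasInt (fun x => INS2D.dx i f t x * g t x + f t x * INS2D.dx i g t x) 0 := by
  have := ((hf.dx i).hasInt_mul hg ht).add (hf.hasInt_mul (hg.dx i) ht)
  rwa [hf.integral_mul_dx hg ht i, add_neg_cancel] at this

end HasInt

/-- The inhomogeneous Navier–Stokes system in components: `1 + r` is the density, `v` the velocity
and `p` the pressure gradient. -/
structure Flow (r : ℝ → Plane → ℝ) (v p : Fin 2 → ℝ → Plane → ℝ) : Prop where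
  reg_r : Regular r
  reg_v : ∀ k, Regular (v k)
  reg_p : ∀ k, Regular (p k)
  mass : ∀ t, 0 ≤ t → ∀ x, tderiv r t x + (v 0 t x * dx 0 r t x + v 1 t x * dx 1 r t x) = 0
  mom : ∀ k, ∀ t, 0 ≤ t → ∀ x, (1 + r t x) * (tderiv (v k) t x +
    (v 0 t x * dx 0 (v k) t x + v 1 t x * dx 1 (v k) t x)) -
      (dx 0 (dx 0 (v k)) t x + dx 1 (dx 1 (v k)) t x) + p k t x = 0
  div : ∀ t, 0 ≤ t → ∀ x, dx 0 (v 0) t x + dx 1 (v 1) t x = 0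
  curl : ∀ t, 0 ≤ t → ∀ x, dx 1 (p 0) t x = dx 0 (p 1) t x

/-- The convective derivative `(v · ∇)f`. -/
def adv (v : Fin 2 → ℝ → Plane → ℝ) (f : ℝ → Plane → ℝ) (t : ℝ) (x : Plane) : ℝ :=
  v 0 t x * dx 0 f t x + v 1 t x * dx 1 f t x

/-- The Laplacian of a scalar function through its partial derivatives. -/
def slap (f : ℝ → Plane → ℝ) (t : ℝ) (x : Plane) : ℝ := dx 0 (dx 0 f) t x + dx 1 (dx 1 f) t x

/-- The weighted energy `∫ (1 + r)|v|²`. -/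
def energy (r : ℝ → Plane → ℝ) (v : Fin 2 → ℝ → Plane → ℝ) (t : ℝ) : ℝ :=
  ∑ k, ∫ x, (v k t x + r t x * v k t x) * v k t x

/-- The Dirichlet energy `∫ |∇v|²`. -/
def dirichlet (v : Fin 2 → ℝ → Plane → ℝ) (t : ℝ) : ℝ :=
  ∑ k, ∑ i, ∫ x, dx i (v k) t x * dx i (v k) t x

section Basic

variable {v : Fin 2 → ℝ → Plane → ℝ} {f : ℝ → Plane → ℝ} {t : ℝ}

theorem Regular.adv (hv : ∀ k, Regular (v k)) (hf : Regular f) : Regular (adv v f) :=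
  ((hv 0).mul (hf.dx 0)).add ((hv 1).mul (hf.dx 1))

theorem Regular.slap (hf : Regular f) : Regular (slap f) :=
  ((hf.dx 0).dx 0).add ((hf.dx 1).dx 1)

theorem hasInt_adv (hv : ∀ k, Regular (v k)) (hdiv : ∀ x, dx 0 (v 0) t x + dx 1 (v 1) t x = 0)
    (hf : Regular f) (ht : 0 ≤ t) : HasInt (adv v f t) 0 := by
  have h := ((hv 0).hasInt_ibp hf ht 0).add ((hv 1).hasInt_ibp hf ht 1)
  rw [add_zero] at h
  refine h.congr fun x => ?_
  simp only [INS2D.adv]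
  linear_combination (-f t x) * hdiv x

theorem hasInt_slap (hf : Regular f) (ht : 0 ≤ t) :
    HasInt (fun x => f t x * slap f t x) (-∑ i, ∫ x, dx i f t x * dx i f t x) := by
  have h : ∀ i, HasInt (fun x => f t x * dx i (dx i f) t x) (-∫ x, dx i f t x * dx i f t x) := by
    intro i
    rw [← hf.integral_mul_dx (hf.dx i) ht i]
    exact hf.hasInt_mul ((hf.dx i).dx i) ht
  have := (h 0).add (h 1)
  rw [Fin.sum_univ_two, neg_add]
  exact this.congr fun x => by simp only [INS2D.slap]; ring

end Basic

namespace Flow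

variable {r : ℝ → Plane → ℝ} {v p : Fin 2 → ℝ → Plane → ℝ} {t : ℝ}

theorem mom' (H : Flow r v p) (k : Fin 2) (ht : 0 ≤ t) (x : Plane) :
    (1 + r t x) * (tderiv (v k) t x + adv v (v k) t x) = slap (v k) t x - p k t x := by
  have := H.mom k t ht x
  simp only [adv, slap]; linarith

theorem mass' (H : Flow r v p) (ht : 0 ≤ t) (x : Plane) :
    tderiv r t x = -adv v r t x := by
  have := H.mass t ht x
  simp only [adv]; linarith

theorem tderiv_zero_fun (t : ℝ) : tderiv (fun (_ : ℝ) (_ : Plane) => (0 : ℝ)) t = fun _ => 0 := by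
  ext1 x; simp [tderiv]

theorem div_tderiv (H : Flow r v p) (ht : 0 ≤ t) (x : Plane) :
    dx 0 (tderiv (v 0)) t x + dx 1 (tderiv (v 1)) t x = 0 := by
  have h1 := ((H.reg_v 0).dx 0).tderiv_add ((H.reg_v 1).dx 1) ht x
  have h2 : tderiv (fun t x => dx 0 (v 0) t x + dx 1 (v 1) t x) t = fun _ => 0 := by
    rw [← tderiv_zero_fun t]
    exact tderiv_congr (fun s hs => funext fun x => H.div s hs x) ht
  rw [h2, (H.reg_v 0).smooth.tderiv_dx 0 ht, (H.reg_v 1).smooth.tderiv_dx 1 ht] at h1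
  exact h1.symm

theorem curl_tderiv (H : Flow r v p) (ht : 0 ≤ t) (x : Plane) :
    dx 1 (tderiv (p 0)) t x = dx 0 (tderiv (p 1)) t x := by
  rw [← (H.reg_p 0).smooth.tderiv_dx 1 ht, ← (H.reg_p 1).smooth.tderiv_dx 0 ht]
  exact congrFun (tderiv_congr (fun s hs => funext fun x => H.curl s hs x) ht) x

theorem mom_tderiv (H : Flow r v p) (k : Fin 2) (ht : 0 ≤ t) (x : Plane) :
    tderiv r t x * (tderiv (v k) t x + adv v (v k) t x) +
      (1 + r t x) * (tderiv (tderiv (v k)) t x + tderiv (adv v (v k)) t x) =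
      slap (tderiv (v k)) t x - tderiv (p k) t x := by
  have hN : Regular (fun t x => tderiv (v k) t x + adv v (v k) t x) :=
    (H.reg_v k).tderiv.add (Regular.adv H.reg_v (H.reg_v k))
  have hk := (H.reg_v k)
  have e1 : tderiv (fun t x => (tderiv (v k) t x + adv v (v k) t x)
      + r t x * (tderiv (v k) t x + adv v (v k) t x)) t =
      tderiv (fun t x => slap (v k) t x + (-1) * p k t x) t := by
    refine tderiv_congr (fun s hs => funext fun x => ?_) ht
    have := H.mom' k hs x
    linarith
  have e2 := congrFun e1 x
  rw [hN.tderiv_add (H.reg_r.mul hN) ht, H.reg_r.tderiv_mul hN ht,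
    hk.tderiv.tderiv_add (Regular.adv H.reg_v hk) ht,
    hk.slap.tderiv_add ((H.reg_p k).const_mul (-1)) ht,
    congrFun ((H.reg_p k).smooth.tderiv_const_mul (-1) ht) x] at e2
  have e3 : tderiv (slap (v k)) t x = slap (tderiv (v k)) t x := by
    have h0 : ∀ i, tderiv (dx i (dx i (v k))) t = dx i (dx i (tderiv (v k))) t := fun i => by
      rw [(hk.dx i).smooth.tderiv_dx i ht]
      exact dx_congr i (fun s hs => hk.smooth.tderiv_dx i hs) ht
    have := ((hk.dx 0).dx 0).tderiv_add ((hk.dx 1).dx 1) ht x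
    rw [h0, h0] at this
    exact this
  rw [e3] at e2
  linarith

theorem tderiv_adv (H : Flow r v p) (k : Fin 2) (ht : 0 ≤ t) (x : Plane) :
    tderiv (adv v (v k)) t x = adv (fun i => tderiv (v i)) (v k) t x + adv v (tderiv (v k)) t x := by
  have hk := (H.reg_v k)
  have := ((H.reg_v 0).mul (hk.dx 0)).tderiv_add ((H.reg_v 1).mul (hk.dx 1)) ht x
  rw [(H.reg_v 0).tderiv_mul (hk.dx 0) ht, (H.reg_v 1).tderiv_mul (hk.dx 1) ht,
    hk.smooth.tderiv_dx 0 ht, hk.smooth.tderiv_dx 1 ht] at this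
  refine this.trans ?_
  simp only [adv]; ring

theorem hasInt_pressure {F φ : Fin 2 → ℝ → Plane → ℝ} (hF : ∀ k, Regular (F k))
    (hφ : ∀ k, Regular (φ k)) (ht : 0 ≤ t) (hcurl : ∀ x, dx 1 (F 0) t x = dx 0 (F 1) t x)
    (hdiv : ∀ x, dx 0 (φ 0) t x + dx 1 (φ 1) t x = 0) :
    HasInt (fun x => F 0 t x * φ 0 t x + F 1 t x * φ 1 t x) 0 := by
  have := ((hF 0).hasInt_mul (hφ 0) ht).add ((hF 1).hasInt_mul (hφ 1) ht)
  rwa [H1.integral_curlFree_divFree ((hF 0).h1 ht) ((hF 1).h1 ht) ((hφ 0).h1 ht) ((hφ 1).h1 ht)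
    hcurl hdiv] at this

theorem continuousOn_energy {v : Fin 2 → ℝ → Plane → ℝ} (hr : Regular r) (hv : ∀ k, Regular (v k)) :
    ContinuousOn (energy r v) (Ici 0) :=
  continuousOn_finsetSum _ fun k _ =>
    ((hv k).add (hr.mul (hv k))).continuousOn_integral_mul (hv k)

theorem continuousOn_dirichlet {v : Fin 2 → ℝ → Plane → ℝ} (hv : ∀ k, Regular (v k)) :
    ContinuousOn (dirichlet v) (Ici 0) :=
  continuousOn_finsetSum _ fun k _ => continuousOn_finsetSum _ fun i _ =>
    ((hv k).dx i).continuousOn_integral_mul ((hv k).dx i)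

theorem hasDerivAt_energy_aux {v : Fin 2 → ℝ → Plane → ℝ} (hr : Regular r)
    (hv : ∀ k, Regular (v k)) (ht : 0 < t) {c : ℝ}
    (h : HasInt (fun x => ∑ k, (tderiv r t x * v k t x * v k t x +
      2 * ((1 + r t x) * tderiv (v k) t x * v k t x))) c) :
    HasDerivAt (energy r v) c t := by
  have hm : ∀ k, Regular (fun t x => v k t x + r t x * v k t x) := fun k =>
    (hv k).add (hr.mul (hv k))
  have hd : HasDerivAt (energy r v) (∑ k, _) t :=
    HasDerivAt.fun_sum fun k _ => (hm k).hasDerivAt_integral_mul (hv k) ht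
  convert hd using 1
  refine HasInt.unique (h.congr fun x => ?_) (HasInt.sum Finset.univ fun k _ =>
    ((hm k).tderiv.hasInt_mul (hv k) ht.le).add ((hm k).hasInt_mul (hv k).tderiv ht.le))
  refine Finset.sum_congr rfl fun k _ => ?_
  rw [(hv k).tderiv_add (hr.mul (hv k)) ht.le, hr.tderiv_mul (hv k) ht.le]
  ring

/-- The energy identity. -/
theorem hasDerivAt_energy (H : Flow r v p) (ht : 0 < t) :
    HasDerivAt (energy r v) (-2 * dirichlet v t) t := by
  refine hasDerivAt_energy_aux H.reg_r H.reg_v ht ?_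
  have hs : ∀ k, Regular (fun t x => v k t x * v k t x) := fun k => (H.reg_v k).mul (H.reg_v k)
  have hq : Regular (fun t x => v 0 t x * v 0 t x + v 1 t x * v 1 t x) := (hs 0).add (hs 1)
  have h1 := hasInt_adv H.reg_v (H.div t ht.le) (hq.add (H.reg_r.mul hq)) ht.le
  have h2 := ((hasInt_slap (H.reg_v 0) ht.le).add (hasInt_slap (H.reg_v 1) ht.le)).const_mul 2
  have h3 := (hasInt_pressure H.reg_p H.reg_v ht.le (H.curl t ht.le) (H.div t ht.le)).const_mul 2
  have h4 := (h2.sub h1).sub h3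
  have e : 2 * ((-∑ i, ∫ x, dx i (v 0) t x * dx i (v 0) t x)
      + -∑ i, ∫ x, dx i (v 1) t x * dx i (v 1) t x) - 0 - 2 * 0 = -2 * dirichlet v t := by
    simp only [dirichlet, Fin.sum_univ_two]; ring
  rw [e] at h4
  refine h4.congr fun x => ?_
  have m0 := H.mom' 0 ht.le x
  have m1 := H.mom' 1 ht.le x
  have mr := H.mass' ht.le x
  have d : ∀ i, dx i (fun t x => (v 0 t x * v 0 t x + v 1 t x * v 1 t x) +
      r t x * (v 0 t x * v 0 t x + v 1 t x * v 1 t x)) t x =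
      dx i r t x * (v 0 t x * v 0 t x + v 1 t x * v 1 t x) + (1 + r t x) *
        (2 * (v 0 t x * dx i (v 0) t x + v 1 t x * dx i (v 1) t x)) := by
    intro i
    rw [hq.dx_add (H.reg_r.mul hq) ht.le i, H.reg_r.dx_mul hq ht.le i, (hs 0).dx_add (hs 1) ht.le i,
      (H.reg_v 0).dx_mul (H.reg_v 0) ht.le i, (H.reg_v 1).dx_mul (H.reg_v 1) ht.le i]
    ring
  simp only [adv, Fin.sum_univ_two, d] at m0 m1 mr ⊢
  linear_combination (2 * v 0 t x) * m0 + (2 * v 1 t x) * m1 +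
    (v 0 t x * v 0 t x + v 1 t x * v 1 t x) * mr

/-- The evolution of the Dirichlet energy. -/
theorem hasDerivAt_dirichlet (H : Flow r v p) (ht : 0 < t) :
    HasDerivAt (dirichlet v) (-2 * energy r (fun k => tderiv (v k)) t -
      2 * ∑ k, ∫ x, (adv v (v k) t x + r t x * adv v (v k) t x) * tderiv (v k) t x) t := by
  have hd : HasDerivAt (dirichlet v) (∑ k, ∑ i, _) t :=
    HasDerivAt.fun_sum fun k _ => HasDerivAt.fun_sum fun i _ =>
      ((H.reg_v k).dx i).hasDerivAt_integral_mul ((H.reg_v k).dx i) ht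
  convert hd using 1
  have ha : ∀ k, Regular (adv v (v k)) := fun k => Regular.adv H.reg_v (H.reg_v k)
  have hv' := fun k => (H.reg_v k).tderiv
  have h1 : ∀ k i, (∫ x, tderiv (dx i (v k)) t x * dx i (v k) t x) +
      ∫ x, dx i (v k) t x * tderiv (dx i (v k)) t x =
      -2 * ∫ x, tderiv (v k) t x * dx i (dx i (v k)) t x := by
    intro k i
    rw [(H.reg_v k).smooth.tderiv_dx i ht.le, (hv' k).integral_mul_dx ((H.reg_v k).dx i) ht.le i]
    simp only [mul_comm (dx i (v k) t _)]
    ring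
  simp only [h1]
  have hp := (hasInt_pressure H.reg_p hv' ht.le (H.curl t ht.le)
    (H.div_tderiv ht.le)).const_mul (-2)
  have hE : HasInt _ (energy r (fun k => tderiv (v k)) t) := HasInt.sum Finset.univ fun k _ =>
    ((hv' k).add (H.reg_r.mul (hv' k))).hasInt_mul (hv' k) ht.le
  have hQ := HasInt.sum Finset.univ fun k _ =>
    ((ha k).add (H.reg_r.mul (ha k))).hasInt_mul (hv' k) ht.le
  have hL := HasInt.sum Finset.univ fun k _ => HasInt.sum Finset.univ fun i _ =>
    ((hv' k).hasInt_mul (((H.reg_v k).dx i).dx i) ht.le).const_mul (-2)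
  have hT := ((hE.const_mul (-2)).sub (hQ.const_mul 2)).add hp
  rw [mul_zero, add_zero] at hT
  refine HasInt.unique (hT.congr fun x => ?_) hL
  have m0 := H.mom' 0 ht.le x
  have m1 := H.mom' 1 ht.le x
  simp only [slap, Fin.sum_univ_two] at m0 m1 ⊢
  linear_combination (2 * tderiv (v 0) t x) * m0 + (2 * tderiv (v 1) t x) * m1

/-- The integrand of the cubic and quartic terms in the evolution of `∫ (1 + r)|∂ₜv|²`. -/
def quad (v : Fin 2 → ℝ → Plane → ℝ) (t : ℝ) (x : Plane) : ℝ :=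
  tderiv (v 0) t x * tderiv (v 0) t x + tderiv (v 1) t x * tderiv (v 1) t x +
    2 * (adv v (v 0) t x * tderiv (v 0) t x + adv v (v 1) t x * tderiv (v 1) t x)

theorem regular_quad (hv : ∀ k, Regular (v k)) : Regular (quad v) := by
  have hv' := fun k => (hv k).tderiv
  have ha := fun k => Regular.adv hv (hv k)
  exact (((hv' 0).mul (hv' 0)).add ((hv' 1).mul (hv' 1))).add
    ((((ha 0).mul (hv' 0)).add ((ha 1).mul (hv' 1))).const_mul 2)

/-- The evolution of `∫ (1 + r)|∂ₜv|²`. -/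
theorem hasDerivAt_energy_tderiv (H : Flow r v p) (ht : 0 < t) :
    HasDerivAt (energy r (fun k => tderiv (v k))) (-2 * dirichlet (fun k => tderiv (v k)) t
      - ((∑ i, ∫ x, (v i t x + r t x * v i t x) * dx i (quad v) t x) +
        2 * ∑ k, ∫ x, (tderiv (adv v (v k)) t x + r t x * tderiv (adv v (v k)) t x)
          * tderiv (v k) t x)) t := by
  have hv' := fun k => (H.reg_v k).tderiv
  refine hasDerivAt_energy_aux H.reg_r hv' ht ?_
  have hq := regular_quad H.reg_v
  have ha : ∀ k, Regular (adv v (v k)) := fun k => Regular.adv H.reg_v (H.reg_v k)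
  have h1 := hasInt_adv H.reg_v (H.div t ht.le) (hq.add (H.reg_r.mul hq)) ht.le
  have h2 := ((hasInt_slap (hv' 0) ht.le).add (hasInt_slap (hv' 1) ht.le)).const_mul 2
  have h3 := (hasInt_pressure (fun k => (H.reg_p k).tderiv) hv' ht.le (fun x => H.curl_tderiv ht.le x)
    (fun x => H.div_tderiv ht.le x)).const_mul 2
  have h4 := HasInt.sum Finset.univ fun i _ =>
    ((H.reg_v i).add (H.reg_r.mul (H.reg_v i))).hasInt_mul (hq.dx i) ht.le
  have h5 := (HasInt.sum Finset.univ fun k _ =>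
    ((ha k).tderiv.add (H.reg_r.mul (ha k).tderiv)).hasInt_mul (hv' k) ht.le).const_mul 2
  have h6 := ((h2.add h1).sub h3).sub (h4.add h5)
  have e : 2 * ((-∑ i, ∫ x, dx i (tderiv (v 0)) t x * dx i (tderiv (v 0)) t x)
      + -∑ i, ∫ x, dx i (tderiv (v 1)) t x * dx i (tderiv (v 1)) t x) + 0 - 2 * 0 =
      -2 * dirichlet (fun k => tderiv (v k)) t := by
    simp only [dirichlet, Fin.sum_univ_two]; ring
  rw [e] at h6
  refine h6.congr fun x => ?_
  have m0 := H.mom_tderiv 0 ht.le x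
  have m1 := H.mom_tderiv 1 ht.le x
  have mr := H.mass' ht.le x
  have d : ∀ i, dx i (fun t x => quad v t x + r t x * quad v t x) t x =
      dx i r t x * quad v t x + (1 + r t x) * dx i (quad v) t x := by
    intro i
    rw [hq.dx_add (H.reg_r.mul hq) ht.le i, H.reg_r.dx_mul hq ht.le i]
    ring
  have ea : adv v (fun t x => quad v t x + r t x * quad v t x) t x =
      adv v r t x * quad v t x + (1 + r t x) * (v 0 t x * dx 0 (quad v) t x
        + v 1 t x * dx 1 (quad v) t x) := by
    simp only [adv, d]; ring
  have eq : quad v t x = tderiv (v 0) t x * tderiv (v 0) t x + tderiv (v 1) t x * tderiv (v 1) t x +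
    2 * (adv v (v 0) t x * tderiv (v 0) t x + adv v (v 1) t x * tderiv (v 1) t x) := rfl
  simp only [Fin.sum_univ_two, ea]
  linear_combination (2 * tderiv (v 0) t x) * m0 + (2 * tderiv (v 1) t x) * m1 -
    quad v t x * mr + tderiv r t x * eq

/-- Transported quantities have constant `L²` norm. -/
theorem integral_sq_of_transport {f : ℝ → Plane → ℝ} (H : Flow r v p) (hf : Regular f)
    (htr : ∀ t, 0 ≤ t → ∀ x, tderiv f t x = -adv v f t x) (ht : 0 ≤ t) :
    ∫ x, f t x * f t x = ∫ x, f 0 x * f 0 x := by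
  have hd : ∀ s, 0 < s → HasDerivAt (fun t => ∫ x, f t x * f t x) 0 s := by
    intro s hs
    have h1 := hf.hasDerivAt_integral_mul hf hs
    convert h1 using 1
    have h2 := (hasInt_adv H.reg_v (H.div s hs.le) (hf.mul hf) hs.le).const_mul (-1)
    rw [mul_zero] at h2
    refine HasInt.unique (h2.congr fun x => ?_)
      ((hf.tderiv.hasInt_mul hf hs.le).add (hf.hasInt_mul hf.tderiv hs.le))
    simp only [htr s hs.le, adv, hf.dx_mul hf hs.le]
    ring
  rcases ht.eq_or_lt with rfl | ht
  · rfl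
  have hc := (hf.continuousOn_integral_mul hf).mono (fun s hs => hs.1 : Icc 0 t ⊆ Ici 0)
  obtain ⟨c, hc1, hc2⟩ := exists_hasDerivAt_eq_slope (fun t => ∫ x, f t x * f t x) (fun _ => 0) ht hc
    (fun s hs => hd s hs.1)
  rw [eq_div_iff (by linarith), zero_mul] at hc2
  linarith

theorem transport_pow (H : Flow r v p) (n : ℕ) :
    Regular (fun t x => r t x ^ (n + 1)) ∧ ∀ t, 0 ≤ t → ∀ x,
      tderiv (fun t x => r t x ^ (n + 1)) t x = -adv v (fun t x => r t x ^ (n + 1)) t x := by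
  induction n with
  | zero =>
    simp only [zero_add, pow_one]
    exact ⟨H.reg_r, fun t ht x => H.mass' ht x⟩
  | succ n ih =>
    have e : (fun t x => r t x ^ (n + 1 + 1)) = fun t x => r t x ^ (n + 1) * r t x := by
      ext t x; rw [pow_succ]
    rw [e]
    refine ⟨ih.1.mul H.reg_r, fun t ht x => ?_⟩
    rw [ih.1.tderiv_mul H.reg_r ht, ih.2 t ht x, H.mass' ht x]
    simp only [adv, ih.1.dx_mul H.reg_r ht]
    ring

/-- The bound of the density is preserved. -/
theorem abs_le_of_initial (H : Flow r v p) {δ : ℝ} (hδ : 0 < δ) (h0 : ∀ x, |r 0 x| ≤ δ) (ht : 0 ≤ t)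
    (x : Plane) : |r t x| ≤ δ := by
  by_contra hx
  push Not at hx
  obtain ⟨δ', hδ1, hδ2⟩ := exists_between hx
  have hδ'0 : 0 < δ' := hδ.trans hδ1
  have hcont : Continuous (fun x => |r t x|) := ((H.reg_r.h1 ht).contDiff.continuous).abs
  set A : Set Plane := {z | δ' < |r t z|} with hA
  have hAo : IsOpen A := isOpen_lt continuous_const hcont
  have hApos : 0 < volume A := hAo.measure_pos volume ⟨x, hδ2⟩
  have hi : Integrable (fun x => r t x * r t x) := H.reg_r.integrable_mul H.reg_r ht
  have hAfin : volume A < ⊤ := by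
    have hsub : A ⊆ {z | δ' * δ' ≤ ‖r t z * r t z‖} := by
      intro z hz
      have hz' : δ' < |r t z| := hz
      change δ' * δ' ≤ ‖r t z * r t z‖
      rw [norm_mul, Real.norm_eq_abs]
      exact mul_le_mul hz'.le hz'.le hδ'0.le (abs_nonneg _)
    exact (measure_mono hsub).trans_lt (hi.measure_norm_ge_lt_top (by positivity))
  have hAr : 0 < (volume A).toReal := ENNReal.toReal_pos hApos.ne' hAfin.ne
  set I : ℝ := ∫ x, r 0 x * r 0 x
  have key : ∀ n : ℕ, (volume A).toReal * (δ' ^ (n + 1)) ^ 2 ≤ (δ ^ n) ^ 2 * I := by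
    intro n
    obtain ⟨hreg, htr⟩ := H.transport_pow n
    have hcons := H.integral_sq_of_transport hreg htr ht
    have h1 : (volume A).toReal * (δ' ^ (n + 1)) ^ 2 ≤ ∫ x, r t x ^ (n + 1) * r t x ^ (n + 1) := by
      have hintg := hreg.integrable_mul hreg ht
      calc (volume A).toReal * (δ' ^ (n + 1)) ^ 2 = ∫ _ in A, (δ' ^ (n + 1)) ^ 2 := by
            rw [setIntegral_const]; simp [Measure.real]
        _ ≤ ∫ x in A, r t x ^ (n + 1) * r t x ^ (n + 1) := by
            refine setIntegral_mono_on (integrableOn_const hAfin.ne) hintg.integrableOn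
              hAo.measurableSet fun z hz => ?_
            have hz' : δ' < |r t z| := hz
            rw [← pow_two, ← sq_abs (r t z ^ (n + 1)), abs_pow]
            gcongr
        _ ≤ _ := setIntegral_le_integral hintg (Eventually.of_forall fun z => mul_self_nonneg _)
    have h2 : ∫ x, r 0 x ^ (n + 1) * r 0 x ^ (n + 1) ≤ (δ ^ n) ^ 2 * I := by
      rw [← integral_const_mul]
      refine integral_mono (hreg.integrable_mul hreg le_rfl)
        ((H.reg_r.integrable_mul H.reg_r le_rfl).const_mul _) fun z => ?_
      change r 0 z ^ (n + 1) * r 0 z ^ (n + 1) ≤ (δ ^ n) ^ 2 * (r 0 z * r 0 z)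
      have : (r 0 z ^ n) ^ 2 ≤ (δ ^ n) ^ 2 := by
        rw [← sq_abs (r 0 z ^ n), abs_pow]
        exact pow_le_pow_left₀ (by positivity) (pow_le_pow_left₀ (abs_nonneg _) (h0 z) n) 2
      calc _ = (r 0 z ^ n) ^ 2 * (r 0 z * r 0 z) := by ring
        _ ≤ _ := mul_le_mul_of_nonneg_right this (mul_self_nonneg _)
    exact h1.trans (hcons.le.trans h2)
  have hq : 1 < (δ' / δ) ^ 2 := by
    have : 1 < δ' / δ := (one_lt_div hδ).2 hδ1
    nlinarith
  obtain ⟨n, hn⟩ := pow_unbounded_of_one_lt (I / ((volume A).toReal * δ' ^ 2)) hq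
  have := key n
  rw [div_lt_iff₀ (by positivity), ← pow_mul, mul_comm 2 n, pow_mul, div_pow, div_pow, div_mul_eq_mul_div,
    lt_div_iff₀ (by positivity)] at hn
  have e : (δ' ^ n) ^ 2 * ((volume A).toReal * δ' ^ 2) = (volume A).toReal * (δ' ^ (n + 1)) ^ 2 := by ring
  linarith

end Flow

section Norms

/-- The squared `L²` norm of a planar field. -/
def sqNorm (v : Fin 2 → ℝ → Plane → ℝ) (t : ℝ) : ℝ := ∑ k, ∫ x, v k t x ^ 2

/-- The squared `L²` norm of the second derivatives of a planar field. -/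
def hessian (v : Fin 2 → ℝ → Plane → ℝ) (t : ℝ) : ℝ := ∑ k, dirichlet (fun i => dx i (v k)) t

variable {v : Fin 2 → ℝ → Plane → ℝ} {t : ℝ}

theorem sqNorm_nonneg (v : Fin 2 → ℝ → Plane → ℝ) (t : ℝ) : 0 ≤ sqNorm v t :=
  Finset.sum_nonneg fun _ _ => integral_nonneg fun _ => sq_nonneg _

theorem dirichlet_nonneg (v : Fin 2 → ℝ → Plane → ℝ) (t : ℝ) : 0 ≤ dirichlet v t :=
  Finset.sum_nonneg fun _ _ => Finset.sum_nonneg fun _ _ => integral_nonneg fun _ => mul_self_nonneg _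

theorem hessian_nonneg (v : Fin 2 → ℝ → Plane → ℝ) (t : ℝ) : 0 ≤ hessian v t :=
  Finset.sum_nonneg fun _ _ => dirichlet_nonneg _ _

theorem nrm_le_sqNorm (v : Fin 2 → ℝ → Plane → ℝ) (t : ℝ) (k : Fin 2) :
    nrm (v k t) ≤ Real.sqrt (sqNorm v t) :=
  Real.sqrt_le_sqrt (Finset.single_le_sum (f := fun k => ∫ x, v k t x ^ 2)
    (fun _ _ => integral_nonneg fun _ => sq_nonneg _) (Finset.mem_univ k))

theorem nrm_sq' (f : Plane → ℝ) : nrm f ^ 2 = ∫ x, f x * f x := by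
  rw [nrm_sq]; simp only [pow_two]

theorem nrm_dx_le (v : Fin 2 → ℝ → Plane → ℝ) (t : ℝ) (k i : Fin 2) :
    nrm (dx i (v k) t) ≤ Real.sqrt (dirichlet v t) := by
  refine Real.le_sqrt_of_sq_le ?_
  rw [nrm_sq']
  refine le_trans (Finset.single_le_sum (f := fun i => ∫ x, dx i (v k) t x * dx i (v k) t x)
    (fun _ _ => integral_nonneg fun _ => mul_self_nonneg _) (Finset.mem_univ i)) ?_
  exact Finset.single_le_sum (f := fun k => ∑ i, ∫ x, dx i (v k) t x * dx i (v k) t x)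
    (fun _ _ => Finset.sum_nonneg fun _ _ => integral_nonneg fun _ => mul_self_nonneg _)
    (Finset.mem_univ k)

theorem nrm_dx_dx_le (v : Fin 2 → ℝ → Plane → ℝ) (t : ℝ) (k i j : Fin 2) :
    nrm (dx j (dx i (v k)) t) ≤ Real.sqrt (hessian v t) :=
  (nrm_dx_le (fun i => dx i (v k)) t i j).trans (Real.sqrt_le_sqrt
    (Finset.single_le_sum (f := fun k => dirichlet (fun i => dx i (v k)) t)
      (fun _ _ => dirichlet_nonneg _ _) (Finset.mem_univ k)))

theorem gnrm_le (v : Fin 2 → ℝ → Plane → ℝ) (t : ℝ) (k : Fin 2) :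
    gnrm (v k) t ≤ 2 * Real.sqrt (dirichlet v t) := by
  have h0 := nrm_dx_le v t k 0
  have h1 := nrm_dx_le v t k 1
  unfold gnrm; linarith

theorem gnrm_dx_le (v : Fin 2 → ℝ → Plane → ℝ) (t : ℝ) (k i : Fin 2) :
    gnrm (dx i (v k)) t ≤ 2 * Real.sqrt (hessian v t) := by
  have h0 := nrm_dx_dx_le v t k i 0
  have h1 := nrm_dx_dx_le v t k i 1
  unfold gnrm; linarith

theorem nrm_mul_le_of_bounds {f g : ℝ → Plane → ℝ} (hf : Regular f) (hg : Regular g) (ht : 0 ≤ t)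
    {a b a' b' : ℝ} (h1 : nrm (f t) ≤ a) (h2 : gnrm f t ≤ 2 * b) (h3 : nrm (g t) ≤ a')
    (h4 : gnrm g t ≤ 2 * b') :
    nrm (fun x => f t x * g t x) ^ 2 ≤ (4 * gnsConst) ^ 2 * (a * b * (a' * b')) := by
  refine (hf.nrm_sq_mul_le hg ht).trans ?_
  have n1 := nrm_nonneg (f t)
  have n2 := gnrm_nonneg f t
  have n3 := nrm_nonneg (g t)
  have n4 := gnrm_nonneg g t
  have m1 : nrm (f t) * gnrm f t ≤ a * (2 * b) := mul_le_mul h1 h2 n2 (n1.trans h1)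
  have m2 : nrm (g t) * gnrm g t ≤ a' * (2 * b') := mul_le_mul h3 h4 n4 (n3.trans h3)
  have m3 := mul_le_mul m1 m2 (mul_nonneg n3 n4) ((mul_nonneg n1 n2).trans m1)
  calc _ ≤ (2 * gnsConst) ^ 2 * (a * (2 * b) * (a' * (2 * b'))) :=
        mul_le_mul_of_nonneg_left m3 (sq_nonneg _)
    _ = _ := by ring

theorem le_of_sq_le_mul {x y s : ℝ} (hy : 0 ≤ y) (hs : 0 ≤ s) (h : x ^ 2 ≤ y ^ 2 * s ^ 2) :
    x ≤ y * s := by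
  rw [← mul_pow] at h
  exact (abs_le_of_sq_le_sq' h (mul_nonneg hy hs)).2

end Norms

namespace Flow

variable {r : ℝ → Plane → ℝ} {v p : Fin 2 → ℝ → Plane → ℝ} {t : ℝ}

theorem energy_bounds {v : Fin 2 → ℝ → Plane → ℝ} (hr : Regular r) (hv : ∀ k, Regular (v k))
    (ht : 0 ≤ t) (hr4 : ∀ x, |r t x| ≤ 1 / 4) :
    3 / 4 * sqNorm v t ≤ energy r v t ∧ energy r v t ≤ 5 / 4 * sqNorm v t := by
  unfold sqNorm energy
  rw [Finset.mul_sum, Finset.mul_sum]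
  have hi : ∀ k, Integrable (fun x => (v k t x + r t x * v k t x) * v k t x) := fun k =>
    ((hv k).add (hr.mul (hv k))).integrable_mul (hv k) ht
  have hs : ∀ k, Integrable (fun x => v k t x ^ 2) := fun k => ((hv k).memLp ht).integrable_sq
  constructor
  · refine Finset.sum_le_sum fun k _ => ?_
    rw [← integral_const_mul]
    refine integral_mono ((hs k).const_mul _) (hi k) fun x => ?_
    have := (abs_le.1 (hr4 x)).1
    change 3 / 4 * v k t x ^ 2 ≤ (v k t x + r t x * v k t x) * v k t x
    nlinarith [sq_nonneg (v k t x)]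
  · refine Finset.sum_le_sum fun k _ => ?_
    rw [← integral_const_mul]
    refine integral_mono (hi k) ((hs k).const_mul _) fun x => ?_
    have := (abs_le.1 (hr4 x)).2
    change (v k t x + r t x * v k t x) * v k t x ≤ 5 / 4 * v k t x ^ 2
    nlinarith [sq_nonneg (v k t x)]

theorem hasInt_slap_sq {f : ℝ → Plane → ℝ} (hf : Regular f) (ht : 0 ≤ t) :
    HasInt (fun x => slap f t x ^ 2) (dirichlet (fun i => dx i f) t) := by
  have cross : ∫ x, dx 0 (dx 0 f) t x * dx 1 (dx 1 f) t x =
      ∫ x, dx 0 (dx 1 f) t x * dx 0 (dx 1 f) t x := by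
    rw [((hf.dx 0).dx 0).integral_mul_dx (hf.dx 1) ht 1]
    rw [((hf.dx 1).dx 0).integral_mul_dx (hf.dx 1) ht 0]
    have : dx 1 (dx 0 (dx 0 f)) t = dx 0 (dx 0 (dx 1 f)) t := by
      rw [(hf.dx 0).smooth.dx_comm 1 0 ht]
      exact dx_congr 0 (fun s hs => hf.smooth.dx_comm 1 0 hs) ht
    rw [this]
  have comm : dx 1 (dx 0 f) t = dx 0 (dx 1 f) t := hf.smooth.dx_comm 1 0 ht
  have h := ((((hf.dx 0).dx 0).hasInt_mul ((hf.dx 0).dx 0) ht).add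
    (((hf.dx 1).dx 1).hasInt_mul ((hf.dx 1).dx 1) ht)).add
    ((((hf.dx 0).dx 0).hasInt_mul ((hf.dx 1).dx 1) ht).const_mul 2)
  have e : dirichlet (fun i => dx i f) t = (∫ x, dx 0 (dx 0 f) t x * dx 0 (dx 0 f) t x) +
      (∫ x, dx 1 (dx 1 f) t x * dx 1 (dx 1 f) t x) +
      2 * ∫ x, dx 0 (dx 0 f) t x * dx 1 (dx 1 f) t x := by
    simp only [dirichlet, Fin.sum_univ_two, comm, cross]; ring
  rw [e]
  exact h.congr fun x => by simp only [slap]; ring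

theorem div_slap (H : Flow r v p) (ht : 0 ≤ t) (x : Plane) :
    dx 0 (slap (v 0)) t x + dx 1 (slap (v 1)) t x = 0 := by
  have hs := fun k => (H.reg_v k).smooth
  have e : ∀ i j k, dx k (dx i (dx i (v j))) t = dx i (dx i (dx k (v j))) t := by
    intro i j k
    rw [((hs j).smooth_dx i).dx_comm k i ht]
    exact dx_congr i (fun s h => (hs j).dx_comm k i h) ht
  have h0 := (((H.reg_v 0).dx 0).dx 0).dx_add (((H.reg_v 0).dx 1).dx 1) ht 0 x
  have h1 := (((H.reg_v 1).dx 0).dx 0).dx_add (((H.reg_v 1).dx 1).dx 1) ht 1 x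
  rw [e 1 0 0] at h0
  rw [e 0 1 1] at h1
  have hz : ∀ i, dx i (dx i (fun t x => dx 0 (v 0) t x + dx 1 (v 1) t x)) t x = 0 := by
    intro i
    have z : ∀ s, 0 ≤ s → (fun t x => dx 0 (v 0) t x + dx 1 (v 1) t x) s =
        (fun (_ : ℝ) (_ : Plane) => (0 : ℝ)) s := fun s hs => funext fun x => H.div s hs x
    have z' : dx i (fun (_ : ℝ) (_ : Plane) => (0 : ℝ)) = fun _ _ => 0 := by
      ext t x; simp [dx]
    rw [dx_congr i (fun s hs => dx_congr i z hs) ht, z', z']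
  have hd : ∀ i, dx i (dx i (fun t x => dx 0 (v 0) t x + dx 1 (v 1) t x)) t x =
      dx i (dx i (dx 0 (v 0))) t x + dx i (dx i (dx 1 (v 1))) t x := by
    intro i
    have h2 : dx i (dx i (fun t x => dx 0 (v 0) t x + dx 1 (v 1) t x)) t =
        dx i (fun t x => dx i (dx 0 (v 0)) t x + dx i (dx 1 (v 1)) t x) t :=
      dx_congr i (fun s hs => ((hs' H 0 0).dx_add (hs' H 1 1) i hs)) ht
    rw [h2]
    exact (((H.reg_v 0).dx 0).dx i).dx_add (((H.reg_v 1).dx 1).dx i) ht i x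
  have z0 := hz 0
  have z1 := hz 1
  rw [hd] at z0 z1
  change dx 0 (fun t x => dx 0 (dx 0 (v 0)) t x + dx 1 (dx 1 (v 0)) t x) t x +
    dx 1 (fun t x => dx 0 (dx 0 (v 1)) t x + dx 1 (dx 1 (v 1)) t x) t x = 0
  rw [h0, h1]
  linarith
where
  hs' {r : ℝ → Plane → ℝ} {v p : Fin 2 → ℝ → Plane → ℝ} (H : Flow r v p) (i k : Fin 2) :
      Smooth (dx i (v k)) := (H.reg_v k).smooth.smooth_dx i

/-- The orthogonal decomposition `‖∇²v‖² + ‖p‖² = ‖(1 + r)(∂ₜv + v·∇v)‖²`. -/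
theorem hessian_add_pressure (H : Flow r v p) (ht : 0 ≤ t) :
    hessian v t + sqNorm p t =
      ∑ k, ∫ x, ((1 + r t x) * (tderiv (v k) t x + adv v (v k) t x)) ^ 2 := by
  have h1 := HasInt.sum Finset.univ fun k _ => hasInt_slap_sq (H.reg_v k) ht
  have h2 := HasInt.sum Finset.univ fun k _ =>
    HasInt.of_integrable (((H.reg_p k).memLp ht).integrable_sq)
  have h3 := (hasInt_pressure H.reg_p (fun k => (H.reg_v k).slap) ht (H.curl t ht)
    (fun x => H.div_slap ht x)).const_mul 2
  have h4 := (h1.add h2).sub h3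
  rw [mul_zero, sub_zero] at h4
  have hR : ∀ k, Regular (fun t x => slap (v k) t x + (-1) * p k t x) := fun k =>
    (H.reg_v k).slap.add ((H.reg_p k).const_mul (-1))
  have h5 := HasInt.sum Finset.univ fun k _ =>
    HasInt.of_integrable (((hR k).memLp ht).integrable_sq)
  have e : ∀ k x, (1 + r t x) * (tderiv (v k) t x + adv v (v k) t x) =
      slap (v k) t x + (-1) * p k t x := fun k x => by rw [H.mom' k ht x]; ring
  simp only [e]
  refine HasInt.unique (h4.congr fun x => ?_) h5
  simp only [Fin.sum_univ_two]; ring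

end Flow

namespace Flow

variable {r : ℝ → Plane → ℝ} {v p : Fin 2 → ℝ → Plane → ℝ} {t : ℝ}

theorem integral_sq_convection_le (H : Flow r v p) (ht : 0 ≤ t) (i j k : Fin 2) :
    nrm (fun x => v i t x * dx j (v k) t x) ^ 2 ≤ (4 * gnsConst) ^ 2 *
      (Real.sqrt (sqNorm v t) * Real.sqrt (dirichlet v t) *
        (Real.sqrt (dirichlet v t) * Real.sqrt (hessian v t))) :=
  nrm_mul_le_of_bounds (H.reg_v i) ((H.reg_v k).dx j) ht (nrm_le_sqNorm v t i) (gnrm_le v t i)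
    (nrm_dx_le v t k j) (gnrm_dx_le v t k j)

theorem convection_bound_eq (v : Fin 2 → ℝ → Plane → ℝ) (t : ℝ) :
    (4 * gnsConst) ^ 2 * (Real.sqrt (sqNorm v t) * Real.sqrt (dirichlet v t) *
        (Real.sqrt (dirichlet v t) * Real.sqrt (hessian v t))) =
    16 * gnsConst ^ 2 * (Real.sqrt (sqNorm v t) * dirichlet v t * Real.sqrt (hessian v t)) := by
  have := Real.mul_self_sqrt (dirichlet_nonneg v t)
  linear_combination (16 * gnsConst ^ 2 * Real.sqrt (sqNorm v t) * Real.sqrt (hessian v t)) * this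

theorem integral_adv_sq_le (H : Flow r v p) (ht : 0 ≤ t) :
    ∑ k, ∫ x, adv v (v k) t x ^ 2 ≤
      128 * gnsConst ^ 2 * (Real.sqrt (sqNorm v t) * dirichlet v t * Real.sqrt (hessian v t)) := by
  set S := 16 * gnsConst ^ 2 * (Real.sqrt (sqNorm v t) * dirichlet v t * Real.sqrt (hessian v t))
    with hS
  have hb : ∀ k i, ∫ x, (v i t x * dx i (v k) t x) ^ 2 ≤ S := by
    intro k i
    have := H.integral_sq_convection_le ht i i k
    rwa [nrm_sq, convection_bound_eq] at this
  have hk : ∀ k, ∫ x, adv v (v k) t x ^ 2 ≤ 4 * S := by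
    intro k
    have hI : ∀ i, Integrable (fun x => (v i t x * dx i (v k) t x) ^ 2) := fun i =>
      (((H.reg_v i).mul ((H.reg_v k).dx i)).memLp ht).integrable_sq
    calc ∫ x, adv v (v k) t x ^ 2 ≤ ∫ x, (2 * (v 0 t x * dx 0 (v k) t x) ^ 2
          + 2 * (v 1 t x * dx 1 (v k) t x) ^ 2) := by
          refine integral_mono ((Regular.adv H.reg_v (H.reg_v k)).memLp ht).integrable_sq
            (((hI 0).const_mul 2).add ((hI 1).const_mul 2)) fun x => ?_
          simp only [adv]
          nlinarith [sq_nonneg (v 0 t x * dx 0 (v k) t x - v 1 t x * dx 1 (v k) t x)]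
      _ = 2 * (∫ x, (v 0 t x * dx 0 (v k) t x) ^ 2) + 2 * ∫ x, (v 1 t x * dx 1 (v k) t x) ^ 2 := by
          rw [integral_add ((hI 0).const_mul 2) ((hI 1).const_mul 2), integral_const_mul,
            integral_const_mul]
      _ ≤ 4 * S := by linarith [hb k 0, hb k 1]
  calc _ ≤ ∑ _k : Fin 2, 4 * S := Finset.sum_le_sum fun k _ => hk k
    _ = _ := by simp [hS]; ring

/-- Elliptic estimate for the second derivatives and the pressure gradient. -/
theorem hessian_le (H : Flow r v p) (ht : 0 ≤ t) (hr : ∀ x, |r t x| ≤ 1 / 4) :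
    hessian v t + sqNorm p t ≤ 8 * sqNorm (fun k => tderiv (v k)) t +
      (512 * gnsConst ^ 2) ^ 2 * (sqNorm v t * dirichlet v t ^ 2) := by
  have h0 := H.hessian_add_pressure ht
  have hA := H.integral_adv_sq_le ht
  have h1 : ∀ k, ∫ x, ((1 + r t x) * (tderiv (v k) t x + adv v (v k) t x)) ^ 2 ≤
      4 * (∫ x, tderiv (v k) t x ^ 2) + 4 * ∫ x, adv v (v k) t x ^ 2 := by
    intro k
    have i1 := (((H.reg_v k).tderiv).memLp ht).integrable_sq
    have i2 := ((Regular.adv H.reg_v (H.reg_v k)).memLp ht).integrable_sq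
    rw [← integral_const_mul, ← integral_const_mul, ← integral_add (i1.const_mul 4) (i2.const_mul 4)]
    refine integral_mono_of_nonneg (Eventually.of_forall fun _ => sq_nonneg _)
      ((i1.const_mul 4).add (i2.const_mul 4)) (Eventually.of_forall fun x => ?_)
    change ((1 + r t x) * (tderiv (v k) t x + adv v (v k) t x)) ^ 2 ≤
      4 * tderiv (v k) t x ^ 2 + 4 * adv v (v k) t x ^ 2
    have hx := abs_le.1 (hr x)
    have h2 : (1 + r t x) ^ 2 ≤ 2 := by nlinarith [hx.1, hx.2]
    rw [mul_pow]
    calc _ ≤ 2 * (tderiv (v k) t x + adv v (v k) t x) ^ 2 :=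
          mul_le_mul_of_nonneg_right h2 (sq_nonneg _)
      _ ≤ _ := by nlinarith [sq_nonneg (tderiv (v k) t x - adv v (v k) t x)]
  have h2 := Finset.sum_le_sum fun k (_ : k ∈ Finset.univ) => h1 k
  rw [← h0, Finset.sum_add_distrib, ← Finset.mul_sum, ← Finset.mul_sum] at h2
  have hc := Real.sq_sqrt (hessian_nonneg v t)
  have ha := Real.sq_sqrt (sqNorm_nonneg v t)
  have hp := sqNorm_nonneg p t
  set c := Real.sqrt (hessian v t)
  set a := Real.sqrt (sqNorm v t)
  set Z := dirichlet v t
  have hw : ∑ k, ∫ x, tderiv (v k) t x ^ 2 = sqNorm (fun k => tderiv (v k)) t := rfl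
  rw [hw] at h2
  have h3 : 2 * (512 * gnsConst ^ 2 * (a * Z)) * c ≤ c ^ 2 + (512 * gnsConst ^ 2 * (a * Z)) ^ 2 := by
    nlinarith [sq_nonneg (512 * gnsConst ^ 2 * (a * Z) - c)]
  have h4 : (512 * gnsConst ^ 2) ^ 2 * (sqNorm v t * Z ^ 2) = (512 * gnsConst ^ 2 * (a * Z)) ^ 2 := by
    rw [← ha]; ring
  rw [h4]
  have h5 : 4 * (128 * gnsConst ^ 2 * (a * Z * c)) = 512 * gnsConst ^ 2 * (a * Z) * c := by ring
  linarith

/-- The constant in the differential inequality of the Dirichlet energy. -/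
def dirichletConst : ℝ := (512 * gnsConst ^ 2) ^ 2 / 32 + 8 * (160 * gnsConst ^ 2) ^ 2

theorem dirichlet_deriv_le (H : Flow r v p) (ht : 0 ≤ t) (hr : ∀ x, |r t x| ≤ 1 / 4) :
    -2 * energy r (fun k => tderiv (v k)) t -
      2 * ∑ k, (∫ x, (adv v (v k) t x + r t x * adv v (v k) t x) * tderiv (v k) t x) ≤
    -(1 / 2) * energy r (fun k => tderiv (v k)) t +
      dirichletConst * (sqNorm v t * dirichlet v t ^ 2) := by
  have hv' := fun k => (H.reg_v k).tderiv
  have ha := fun k => Regular.adv H.reg_v (H.reg_v k)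
  have hA := H.integral_adv_sq_le ht
  have hk : ∀ k, -2 * (∫ x, (adv v (v k) t x + r t x * adv v (v k) t x) * tderiv (v k) t x) ≤
      (∫ x, (tderiv (v k) t x + r t x * tderiv (v k) t x) * tderiv (v k) t x) +
        5 / 4 * ∫ x, adv v (v k) t x ^ 2 := by
    intro k
    have i1 := ((ha k).add (H.reg_r.mul (ha k))).integrable_mul (hv' k) ht
    have i2 := ((hv' k).add (H.reg_r.mul (hv' k))).integrable_mul (hv' k) ht
    have i3 := ((ha k).memLp ht).integrable_sq
    rw [← integral_const_mul, ← integral_const_mul, ← integral_add i2 (i3.const_mul _)]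
    refine integral_mono (i1.const_mul _) (i2.add (i3.const_mul _)) fun x => ?_
    change -2 * ((adv v (v k) t x + r t x * adv v (v k) t x) * tderiv (v k) t x) ≤
      (tderiv (v k) t x + r t x * tderiv (v k) t x) * tderiv (v k) t x + 5 / 4 * adv v (v k) t x ^ 2
    have hx := abs_le.1 (hr x)
    nlinarith [mul_nonneg (by linarith [hx.1] : 0 ≤ 1 + r t x)
      (sq_nonneg (adv v (v k) t x + tderiv (v k) t x)),
      mul_nonneg (by linarith [hx.2] : 0 ≤ 1 / 4 - r t x) (sq_nonneg (adv v (v k) t x))]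
  have h2 := Finset.sum_le_sum fun k (_ : k ∈ Finset.univ) => hk k
  rw [← Finset.mul_sum, Finset.sum_add_distrib, ← Finset.mul_sum] at h2
  have hE : ∑ k, ∫ x, (tderiv (v k) t x + r t x * tderiv (v k) t x) * tderiv (v k) t x =
    energy r (fun k => tderiv (v k)) t := rfl
  rw [hE] at h2
  have hh := H.hessian_le ht hr
  have hW := (energy_bounds H.reg_r hv' ht hr).1
  have hc := Real.sq_sqrt (hessian_nonneg v t)
  have ha' := Real.sq_sqrt (sqNorm_nonneg v t)
  have hp := sqNorm_nonneg p t
  have hW0 := sqNorm_nonneg (fun k => tderiv (v k)) t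
  set c := Real.sqrt (hessian v t)
  set a := Real.sqrt (sqNorm v t)
  set Z := dirichlet v t
  have h3 : 2 * (c / 4 * (4 * (80 * gnsConst ^ 2 * (a * Z)) * 2)) ≤ 2 * (c ^ 2 / 32) + 2 * (8 * (160 * gnsConst ^ 2 * (a * Z)) ^ 2) := by
    nlinarith [sq_nonneg (c / 4 - 4 * (160 * gnsConst ^ 2 * (a * Z)))]
  have h4 : dirichletConst * (sqNorm v t * Z ^ 2) = ((512 * gnsConst ^ 2) ^ 2 * (sqNorm v t * Z ^ 2)) / 32
      + 8 * (160 * gnsConst ^ 2 * (a * Z)) ^ 2 := by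
    unfold dirichletConst; rw [← ha']; ring
  rw [h4]
  have h5 : 5 / 4 * (128 * gnsConst ^ 2 * (a * Z * c)) = 160 * gnsConst ^ 2 * (a * Z) * c := by ring
  nlinarith

end Flow

theorem hasInt_abs_mul_le {f g : Plane → ℝ} (hf : MemLp f 2 volume) (hg : MemLp g 2 volume) {A B : ℝ}
    (hA : nrm f ≤ A) (hB : nrm g ≤ B) :
    ∃ c, c ≤ A * B ∧ HasInt (fun x => |f x * g x|) c :=
  ⟨_, (integral_abs_mul_le_nrm hf hg).trans
    (mul_le_mul hA hB (nrm_nonneg _) ((nrm_nonneg _).trans hA)),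
    HasInt.of_integrable (hf.integrable_mul hg).abs⟩

theorem mul_le_sq_div_add (x y : ℝ) : x * y ≤ x ^ 2 / 32 + 8 * y ^ 2 := by
  linarith [sq_nonneg (x - 16 * y), show (x - 16 * y) ^ 2 = x ^ 2 - 32 * (x * y) + 256 * y ^ 2 by ring]

theorem young_sum_le {L a b c w d s m : ℝ}
    (hs2 : s ^ 2 = a * b * (w * d)) (hm2 : m ^ 2 = a * c) :
    L * (s * d) + L * (b * c * s) + L * (a * b * c * d) + L * (b ^ 2 * m * d) + L * (w * d * b) ≤
    d ^ 2 + (512 * L ^ 4 * (a ^ 2 * b ^ 2 * w ^ 2) + 8 * (a ^ 2 * b ^ 2 * w ^ 2) + L ^ 2 * (b ^ 2 * c ^ 2)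
      + 8 * L ^ 2 * (a ^ 2 * b ^ 2 * c ^ 2) + 8 * L ^ 2 * (b ^ 2 * (c ^ 2 + a ^ 2 * b ^ 4))
      + 8 * L ^ 2 * (b ^ 2 * w ^ 2)) := by
  have e1 : L * (s * d) ≤ d ^ 2 / 16 + 512 * L ^ 4 * (a ^ 2 * b ^ 2 * w ^ 2) := by
    have h1 := mul_le_sq_div_add d (L * s)
    have h2 := mul_le_sq_div_add d (8 * L ^ 2 * (a * b * w))
    have h3 : 8 * (L * s) ^ 2 = d * (8 * L ^ 2 * (a * b * w)) := by rw [mul_pow, hs2]; ring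
    have h4 : 8 * (8 * L ^ 2 * (a * b * w)) ^ 2 = 512 * L ^ 4 * (a ^ 2 * b ^ 2 * w ^ 2) := by ring
    linarith
  have e2 : L * (b * c * s) ≤ d ^ 2 / 32 + 8 * (a ^ 2 * b ^ 2 * w ^ 2) + L ^ 2 * (b ^ 2 * c ^ 2) := by
    have h1 : L * (b * c * s) ≤ (L * (b * c)) ^ 2 + s ^ 2 := by
      have h := two_mul_le_add_sq (L * (b * c)) s
      linarith [sq_nonneg (L * (b * c)), sq_nonneg s]
    have h2 := mul_le_sq_div_add d (a * b * w)
    rw [hs2] at h1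
    linarith
  have e3 : L * (a * b * c * d) ≤ d ^ 2 / 32 + 8 * L ^ 2 * (a ^ 2 * b ^ 2 * c ^ 2) := by
    linarith [mul_le_sq_div_add d (L * (a * b * c))]
  have e4 : L * (b ^ 2 * m * d) ≤ d ^ 2 / 32 + 8 * L ^ 2 * (b ^ 2 * (c ^ 2 + a ^ 2 * b ^ 4)) := by
    have h1 := mul_le_sq_div_add d (L * (b ^ 2 * m))
    have h2 : (L * (b ^ 2 * m)) ^ 2 = L ^ 2 * (b ^ 2 * (a * b ^ 2 * c)) := by
      rw [mul_pow, mul_pow, hm2]; ring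
    have h3 : a * b ^ 2 * c ≤ c ^ 2 + a ^ 2 * b ^ 4 := by
      have h := two_mul_le_add_sq (a * b ^ 2) c
      linarith [sq_nonneg (a * b ^ 2), sq_nonneg c]
    have h4 : L ^ 2 * (b ^ 2 * (a * b ^ 2 * c)) ≤ L ^ 2 * (b ^ 2 * (c ^ 2 + a ^ 2 * b ^ 4)) := by
      gcongr
    rw [h2] at h1
    linarith
  have e5 : L * (w * d * b) ≤ d ^ 2 / 32 + 8 * L ^ 2 * (b ^ 2 * w ^ 2) := by
    linarith [mul_le_sq_div_add d (L * (w * b))]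
  linarith [sq_nonneg d]

theorem young_remainder_le {L a b c w : ℝ} :
    512 * L ^ 4 * (a ^ 2 * b ^ 2 * w ^ 2) + 8 * (a ^ 2 * b ^ 2 * w ^ 2) + L ^ 2 * (b ^ 2 * c ^ 2)
      + 8 * L ^ 2 * (a ^ 2 * b ^ 2 * c ^ 2) + 8 * L ^ 2 * (b ^ 2 * (c ^ 2 + a ^ 2 * b ^ 4))
      + 8 * L ^ 2 * (b ^ 2 * w ^ 2) ≤
    512 * (L ^ 4 + L ^ 2 + 1) * ((1 + a ^ 2) * b ^ 2 * (w ^ 2 + c ^ 2 + a ^ 2 * b ^ 4)) := by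
  rw [← sub_nonneg]
  ring_nf
  positivity

/-- Absorption of the nonlinear terms into the dissipation. -/
theorem exists_young_bound (κ : ℝ) (hκ : 0 ≤ κ) : ∃ K : ℝ, 0 ≤ K ∧ ∀ a b c w d s m : ℝ, 0 ≤ a → 0 ≤ b →
    0 ≤ c → 0 ≤ w → 0 ≤ d → 0 ≤ s → 0 ≤ m → s ^ 2 = a * b * (w * d) → m ^ 2 = a * c →
    20 * (4 * κ * s * d) + 20 * (16 * κ ^ 2 * (b * c * s)) +
      20 * (16 * κ ^ 2 * (b * c * s) + 8 * κ ^ 2 * (a * b * c * d)) +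
      20 * (16 * κ ^ 2 * (b ^ 2 * m * d) + 8 * κ ^ 2 * (a * b * c * d)) + 10 * (4 * κ * (w * d * b)) ≤
    d ^ 2 + K * ((1 + a ^ 2) * b ^ 2 * (w ^ 2 + c ^ 2 + a ^ 2 * b ^ 4)) := by
  refine ⟨512 * ((80 * κ + 640 * κ ^ 2) ^ 4 + (80 * κ + 640 * κ ^ 2) ^ 2 + 1), by positivity, ?_⟩
  intro a b c w d s m ha hb hc hw hd hs hm hs2 hm2
  refine le_trans ?_ ((young_sum_le hs2 hm2).trans (add_le_add_right young_remainder_le (d ^ 2)))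
  rw [← sub_nonneg]
  ring_nf
  positivity

namespace Flow

variable {r : ℝ → Plane → ℝ} {v p : Fin 2 → ℝ → Plane → ℝ} {t : ℝ}

theorem dx_adv (H : Flow r v p) (ht : 0 ≤ t) (i k : Fin 2) (x : Plane) :
    dx i (adv v (v k)) t x = ∑ j, (dx i (v j) t x * dx j (v k) t x
      + v j t x * dx i (dx j (v k)) t x) := by
  have hk := H.reg_v k
  have := ((H.reg_v 0).mul (hk.dx 0)).dx_add ((H.reg_v 1).mul (hk.dx 1)) ht i x
  rw [(H.reg_v 0).dx_mul (hk.dx 0) ht, (H.reg_v 1).dx_mul (hk.dx 1) ht] at this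
  rw [Fin.sum_univ_two]
  exact this

theorem dx_quad (H : Flow r v p) (ht : 0 ≤ t) (i : Fin 2) (x : Plane) :
    dx i (quad v) t x = ∑ k, (2 * (tderiv (v k) t x * dx i (tderiv (v k)) t x) +
      2 * (dx i (adv v (v k)) t x * tderiv (v k) t x + adv v (v k) t x * dx i (tderiv (v k)) t x)) := by
  have hv' := fun k => (H.reg_v k).tderiv
  have ha := fun k => Regular.adv H.reg_v (H.reg_v k)
  have h1 := (((hv' 0).mul (hv' 0)).add ((hv' 1).mul (hv' 1))).dx_add
    ((((ha 0).mul (hv' 0)).add ((ha 1).mul (hv' 1))).const_mul 2) ht i x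
  rw [((hv' 0).mul (hv' 0)).dx_add ((hv' 1).mul (hv' 1)) ht,
    congrFun ((((ha 0).mul (hv' 0)).add ((ha 1).mul (hv' 1))).smooth.dx_const_mul 2 i ht) x,
    ((ha 0).mul (hv' 0)).dx_add ((ha 1).mul (hv' 1)) ht,
    (hv' 0).dx_mul (hv' 0) ht, (hv' 1).dx_mul (hv' 1) ht, (ha 0).dx_mul (hv' 0) ht,
    (ha 1).dx_mul (hv' 1) ht] at h1
  refine h1.trans ?_
  rw [Fin.sum_univ_two]; ring

theorem abs_density_mul_le {ρ f g G : ℝ} (hr : |ρ| ≤ 1 / 4) (h : |f * g| ≤ G) :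
    ‖(f + ρ * f) * g‖ ≤ 5 / 4 * G := by
  have hx := abs_le.1 hr
  have e : (f + ρ * f) * g = (1 + ρ) * (f * g) := by ring
  rw [e, norm_mul, Real.norm_eq_abs, Real.norm_eq_abs, abs_of_nonneg (by linarith)]
  exact mul_le_mul (by linarith) h (abs_nonneg _) (by norm_num)

theorem abs_remainder_le (H : Flow r v p) (ht : 0 ≤ t) (hr : ∀ x, |r t x| ≤ 1 / 4)
    {P₁ P₂ P₃ P₄ P₅ : ℝ}
    (h₁ : ∀ i j k, ∃ c, c ≤ P₁ ∧
      HasInt (fun x => |v i t x * tderiv (v k) t x * dx j (tderiv (v k)) t x|) c)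
    (h₂ : ∀ i j k, ∃ c, c ≤ P₂ ∧ HasInt (fun x => |v i t x * dx i (v j) t x *
      (dx j (v k) t x * tderiv (v k) t x)|) c)
    (h₃ : ∀ i j k, ∃ c, c ≤ P₃ ∧ HasInt (fun x => |v i t x * v j t x * tderiv (v k) t x *
      dx i (dx j (v k)) t x|) c)
    (h₄ : ∀ i j k, ∃ c, c ≤ P₄ ∧ HasInt (fun x => |v i t x * v j t x * dx j (v k) t x *
      dx i (tderiv (v k)) t x|) c)
    (h₅ : ∀ j k, ∃ c, c ≤ P₅ ∧
      HasInt (fun x => |tderiv (v j) t x * tderiv (v k) t x * dx j (v k) t x|) c) :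
    |(∑ i, ∫ x, (v i t x + r t x * v i t x) * dx i (quad v) t x) +
        2 * ∑ k, ∫ x, (tderiv (adv v (v k)) t x + r t x * tderiv (adv v (v k)) t x)
          * tderiv (v k) t x| ≤ 20 * P₁ + 20 * P₂ + 20 * P₃ + 20 * P₄ + 10 * P₅ := by
  choose c₁ b₁ i₁ using h₁
  choose c₂ b₂ i₂ using h₂
  choose c₃ b₃ i₃ using h₃
  choose c₄ b₄ i₄ using h₄
  choose c₅ b₅ i₅ using h₅
  have A : ∀ i, |∫ x, (v i t x + r t x * v i t x) * dx i (quad v) t x| ≤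
      5 / 4 * ∑ k, (2 * c₁ i i k + ∑ j, (2 * c₂ i j k + 2 * c₃ i j k + 2 * c₄ i j k)) := by
    intro i
    have hI := (HasInt.sum Finset.univ fun k _ => ((i₁ i i k).const_mul 2).add
      (HasInt.sum Finset.univ fun j _ => (((i₂ i j k).const_mul 2).add
        ((i₃ i j k).const_mul 2)).add ((i₄ i j k).const_mul 2))).const_mul (5 / 4)
    rw [← hI.eq, ← Real.norm_eq_abs]
    refine norm_integral_le_of_norm_le hI.integrable (Eventually.of_forall fun x => ?_)
    refine abs_density_mul_le (hr x) ?_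
    rw [H.dx_quad ht, Finset.mul_sum]
    refine (Finset.abs_sum_le_sum_abs _ _).trans (Finset.sum_le_sum fun k _ => ?_)
    rw [H.dx_adv ht]
    have e : v i t x * (2 * (tderiv (v k) t x * dx i (tderiv (v k)) t x) +
        2 * ((∑ j, (dx i (v j) t x * dx j (v k) t x + v j t x * dx i (dx j (v k)) t x)) *
          tderiv (v k) t x + adv v (v k) t x * dx i (tderiv (v k)) t x)) =
        2 * (v i t x * tderiv (v k) t x * dx i (tderiv (v k)) t x) +
        ∑ j, (2 * (v i t x * dx i (v j) t x * (dx j (v k) t x * tderiv (v k) t x)) +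
          2 * (v i t x * v j t x * tderiv (v k) t x * dx i (dx j (v k)) t x) +
          2 * (v i t x * v j t x * dx j (v k) t x * dx i (tderiv (v k)) t x)) := by
      simp only [Fin.sum_univ_two, adv]; ring
    rw [e]
    refine (abs_add_le _ _).trans (add_le_add ?_ ((Finset.abs_sum_le_sum_abs _ _).trans
      (Finset.sum_le_sum fun j _ => ?_)))
    · rw [abs_mul, abs_two]
    · refine (abs_add_three _ _ _).trans (le_of_eq ?_)
      simp only [abs_mul (2 : ℝ), abs_two]
  have B : ∀ k, |∫ x, (tderiv (adv v (v k)) t x + r t x * tderiv (adv v (v k)) t x)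
      * tderiv (v k) t x| ≤ 5 / 4 * ∑ j, (c₅ j k + c₁ j j k) := by
    intro k
    have hI := (HasInt.sum Finset.univ fun j _ => (i₅ j k).add (i₁ j j k)).const_mul (5 / 4)
    rw [← hI.eq, ← Real.norm_eq_abs]
    refine norm_integral_le_of_norm_le hI.integrable (Eventually.of_forall fun x => ?_)
    refine abs_density_mul_le (hr x) ?_
    rw [H.tderiv_adv k ht]
    have e : (adv (fun i => tderiv (v i)) (v k) t x + adv v (tderiv (v k)) t x) * tderiv (v k) t x =
        ∑ j, (tderiv (v j) t x * tderiv (v k) t x * dx j (v k) t x +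
          v j t x * tderiv (v k) t x * dx j (tderiv (v k)) t x) := by
      simp only [Fin.sum_univ_two, adv]; ring
    rw [e]
    exact (Finset.abs_sum_le_sum_abs _ _).trans (Finset.sum_le_sum fun j _ => abs_add_le _ _)
  have A' : ∀ i, |∫ x, (v i t x + r t x * v i t x) * dx i (quad v) t x| ≤
      5 / 4 * (4 * P₁ + 8 * P₂ + 8 * P₃ + 8 * P₄) := by
    intro i
    refine (A i).trans (mul_le_mul_of_nonneg_left ?_ (by norm_num))
    simp only [Fin.sum_univ_two]
    linarith [b₁ i i 0, b₁ i i 1, b₂ i 0 0, b₂ i 0 1, b₂ i 1 0, b₂ i 1 1, b₃ i 0 0, b₃ i 0 1,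
      b₃ i 1 0, b₃ i 1 1, b₄ i 0 0, b₄ i 0 1, b₄ i 1 0, b₄ i 1 1]
  have B' : ∀ k, |∫ x, (tderiv (adv v (v k)) t x + r t x * tderiv (adv v (v k)) t x)
      * tderiv (v k) t x| ≤ 5 / 4 * (2 * P₅ + 2 * P₁) := by
    intro k
    refine (B k).trans (mul_le_mul_of_nonneg_left ?_ (by norm_num))
    simp only [Fin.sum_univ_two]
    linarith [b₁ 0 0 k, b₁ 1 1 k, b₅ 0 k, b₅ 1 k]
  refine (abs_add_le _ _).trans ?_
  rw [abs_mul, abs_two, Fin.sum_univ_two, Fin.sum_univ_two]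
  have t1 := abs_add_le (∫ x, (v 0 t x + r t x * v 0 t x) * dx 0 (quad v) t x)
    (∫ x, (v 1 t x + r t x * v 1 t x) * dx 1 (quad v) t x)
  have t2 := abs_add_le (∫ x, (tderiv (adv v (v 0)) t x + r t x * tderiv (adv v (v 0)) t x)
      * tderiv (v 0) t x) (∫ x, (tderiv (adv v (v 1)) t x + r t x * tderiv (adv v (v 1)) t x)
      * tderiv (v 1) t x)
  linarith [A' 0, A' 1, B' 0, B' 1]

/-- The constant in the differential inequality of `∫ (1 + r)|∂ₜv|²`. -/
def youngConst : ℝ := Classical.choose (exists_young_bound gnsConst gnsConst_nonneg)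

theorem youngConst_nonneg : 0 ≤ youngConst :=
  (Classical.choose_spec (exists_young_bound gnsConst gnsConst_nonneg)).1

theorem energy_tderiv_deriv_le (H : Flow r v p) (ht : 0 ≤ t) (hr : ∀ x, |r t x| ≤ 1 / 4) :
    -2 * dirichlet (fun k => tderiv (v k)) t
      - ((∑ i, ∫ x, (v i t x + r t x * v i t x) * dx i (quad v) t x) +
        2 * ∑ k, ∫ x, (tderiv (adv v (v k)) t x + r t x * tderiv (adv v (v k)) t x)
          * tderiv (v k) t x) ≤
    youngConst * ((1 + sqNorm v t) * dirichlet v t *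
      (sqNorm (fun k => tderiv (v k)) t + hessian v t + sqNorm v t * dirichlet v t ^ 2)) := by
  have hv := H.reg_v
  have hv' := fun k => (H.reg_v k).tderiv
  have na := nrm_le_sqNorm v t
  have nb := nrm_dx_le v t
  have nc := nrm_dx_dx_le v t
  have nw := nrm_le_sqNorm (fun k => tderiv (v k)) t
  have nd := nrm_dx_le (fun k => tderiv (v k)) t
  have gb := gnrm_le v t
  have gc := gnrm_dx_le v t
  have gd := gnrm_le (fun k => tderiv (v k)) t
  have ha2 := Real.sq_sqrt (sqNorm_nonneg v t)
  have hb2 := Real.sq_sqrt (dirichlet_nonneg v t)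
  have hc2 := Real.sq_sqrt (hessian_nonneg v t)
  have hw2 := Real.sq_sqrt (sqNorm_nonneg (fun k => tderiv (v k)) t)
  have hd2 := Real.sq_sqrt (dirichlet_nonneg (fun k => tderiv (v k)) t)
  have ha := Real.sqrt_nonneg (sqNorm v t)
  have hb := Real.sqrt_nonneg (dirichlet v t)
  have hc := Real.sqrt_nonneg (hessian v t)
  have hw := Real.sqrt_nonneg (sqNorm (fun k => tderiv (v k)) t)
  have hd := Real.sqrt_nonneg (dirichlet (fun k => tderiv (v k)) t)
  set a := Real.sqrt (sqNorm v t)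
  set b := Real.sqrt (dirichlet v t)
  set c := Real.sqrt (hessian v t)
  set w := Real.sqrt (sqNorm (fun k => tderiv (v k)) t)
  set d := Real.sqrt (dirichlet (fun k => tderiv (v k)) t)
  have hκ := gnsConst_nonneg
  set κ := gnsConst
  set s := Real.sqrt (a * b * (w * d)) with hs
  set m := Real.sqrt (a * c) with hm
  have hs0 : 0 ≤ s := Real.sqrt_nonneg _
  have hm0 : 0 ≤ m := Real.sqrt_nonneg _
  have hs2 : s ^ 2 = a * b * (w * d) := Real.sq_sqrt (by positivity)
  have hm2 : m ^ 2 = a * c := Real.sq_sqrt (by positivity)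
  have κ4 : 0 ≤ 4 * κ := by positivity
  have n1 : ∀ i k, nrm (fun x => v i t x * tderiv (v k) t x) ≤ 4 * κ * s := fun i k =>
    le_of_sq_le_mul κ4 hs0 (by
      rw [hs2]; exact nrm_mul_le_of_bounds (hv i) (hv' k) ht (na i) (gb i) (nw k) (gd k))
  have n2 : ∀ i j k, nrm (fun x => v i t x * dx j (v k) t x) ≤ 4 * κ * (b * m) := fun i j k =>
    le_of_sq_le_mul κ4 (by positivity) (by
      rw [mul_pow b m, hm2]
      refine (nrm_mul_le_of_bounds (hv i) ((hv k).dx j) ht (na i) (gb i) (nb k j) (gc k j)).trans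
        (le_of_eq ?_)
      ring)
  have n3 : ∀ i j, nrm (fun x => v i t x * v j t x) ≤ 4 * κ * (a * b) := fun i j =>
    le_of_sq_le_mul κ4 (by positivity) (by
      refine (nrm_mul_le_of_bounds (hv i) (hv j) ht (na i) (gb i) (na j) (gb j)).trans (le_of_eq ?_)
      ring)
  have n4 : ∀ j k, nrm (fun x => tderiv (v j) t x * tderiv (v k) t x) ≤ 4 * κ * (w * d) := fun j k =>
    le_of_sq_le_mul κ4 (by positivity) (by
      refine (nrm_mul_le_of_bounds (hv' j) (hv' k) ht (nw j) (gd j) (nw k) (gd k)).trans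
        (le_of_eq ?_)
      ring)
  have n5 : ∀ j k, nrm (fun x => dx j (v k) t x * tderiv (v k) t x) ≤
      4 * κ * Real.sqrt (b * c * (w * d)) := fun j k =>
    le_of_sq_le_mul κ4 (Real.sqrt_nonneg _) (by
      rw [Real.sq_sqrt (by positivity)]
      exact nrm_mul_le_of_bounds ((hv k).dx j) (hv' k) ht (nb k j) (gc k j) (nw k) (gd k))
  have n6 : ∀ i j k, nrm (fun x => v i t x * v j t x * tderiv (v k) t x) ≤
      16 * κ ^ 2 * (b * s) + 8 * κ ^ 2 * (a * b * d) := fun i j k => by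
    refine ((hv i).nrm_mul_mul_le (hv j) (hv' k) ht).trans ?_
    have q1 := mul_le_mul (gb i) (n1 j k) (nrm_nonneg _) (by positivity)
    have q2 := mul_le_mul (gb j) (n1 i k) (nrm_nonneg _) (by positivity)
    have q3 := mul_le_mul (gd k) (n3 i j) (nrm_nonneg _) (by positivity)
    calc _ ≤ κ * (2 * b * (4 * κ * s) + 2 * b * (4 * κ * s) + 2 * d * (4 * κ * (a * b))) :=
          mul_le_mul_of_nonneg_left (add_le_add (add_le_add q1 q2) q3) hκ
      _ = _ := by ring
  have n7 : ∀ i j k, nrm (fun x => v i t x * v j t x * dx j (v k) t x) ≤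
      16 * κ ^ 2 * (b ^ 2 * m) + 8 * κ ^ 2 * (a * b * c) := fun i j k => by
    refine ((hv i).nrm_mul_mul_le (hv j) ((hv k).dx j) ht).trans ?_
    have q1 := mul_le_mul (gb i) (n2 j j k) (nrm_nonneg _) (by positivity)
    have q2 := mul_le_mul (gb j) (n2 i j k) (nrm_nonneg _) (by positivity)
    have q3 := mul_le_mul (gc k j) (n3 i j) (nrm_nonneg _) (by positivity)
    calc _ ≤ κ * (2 * b * (4 * κ * (b * m)) + 2 * b * (4 * κ * (b * m)) + 2 * c * (4 * κ * (a * b))) :=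
          mul_le_mul_of_nonneg_left (add_le_add (add_le_add q1 q2) q3) hκ
      _ = _ := by ring
  have hsm : b * m * Real.sqrt (b * c * (w * d)) = b * c * s := by
    have e1 : m * Real.sqrt (b * c * (w * d)) = c * s := by
      rw [hm, hs, ← Real.sqrt_mul (by positivity)]
      have : a * c * (b * c * (w * d)) = c ^ 2 * (a * b * (w * d)) := by ring
      rw [this, Real.sqrt_mul (sq_nonneg c), Real.sqrt_sq hc]
    rw [mul_assoc, e1, mul_assoc]
  have key := H.abs_remainder_le ht hr (P₁ := 4 * κ * s * d) (P₂ := 16 * κ ^ 2 * (b * c * s))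
    (P₃ := 16 * κ ^ 2 * (b * c * s) + 8 * κ ^ 2 * (a * b * c * d))
    (P₄ := 16 * κ ^ 2 * (b ^ 2 * m * d) + 8 * κ ^ 2 * (a * b * c * d)) (P₅ := 4 * κ * (w * d * b))
    (fun i j k => hasInt_abs_mul_le (((hv i).mul (hv' k)).memLp ht) (((hv' k).dx j).memLp ht)
      (n1 i k) (nd k j))
    (fun i j k => by
      obtain ⟨c', h1, h2⟩ := hasInt_abs_mul_le (((hv i).mul ((hv j).dx i)).memLp ht)
        ((((hv k).dx j).mul (hv' k)).memLp ht) (n2 i i j) (n5 j k)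
      refine ⟨c', h1.trans (le_of_eq ?_), h2⟩
      linear_combination (16 * κ ^ 2) * hsm)
    (fun i j k => by
      obtain ⟨c', h1, h2⟩ := hasInt_abs_mul_le ((((hv i).mul (hv j)).mul (hv' k)).memLp ht)
        ((((hv k).dx j).dx i).memLp ht) (n6 i j k) (nc k j i)
      exact ⟨c', h1.trans (le_of_eq (by ring)), h2⟩)
    (fun i j k => by
      obtain ⟨c', h1, h2⟩ := hasInt_abs_mul_le ((((hv i).mul (hv j)).mul ((hv k).dx j)).memLp ht)
        (((hv' k).dx i).memLp ht) (n7 i j k) (nd k i)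
      exact ⟨c', h1.trans (le_of_eq (by ring)), h2⟩)
    (fun j k => by
      obtain ⟨c', h1, h2⟩ := hasInt_abs_mul_le (((hv' j).mul (hv' k)).memLp ht)
        (((hv k).dx j).memLp ht) (n4 j k) (nb k j)
      exact ⟨c', h1.trans (le_of_eq (by ring)), h2⟩)
  have hy := (Classical.choose_spec (exists_young_bound gnsConst gnsConst_nonneg)).2 a b c w d s m
    ha hb hc hw hd hs0 hm0 hs2 hm2
  have hy' := key.trans hy
  have e4 : b ^ 4 = dirichlet v t ^ 2 := by rw [← hb2]; ring
  rw [ha2, hb2, hc2, hw2, hd2, e4] at hy'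
  have hD := dirichlet_nonneg (fun k => tderiv (v k)) t
  have := (abs_le.1 hy').1
  unfold youngConst
  linarith

end Flow

section Gaussian

/-- The Gaussian `(4π)⁻¹ exp(-|z|²/4)`, the heat kernel of `ℝ²` at time one. -/
def gauss (z : Plane) : ℝ := (4 * Real.pi)⁻¹ * Real.exp (-(1 / 4) * ‖z‖ ^ 2)

theorem gauss_nonneg (z : Plane) : 0 ≤ gauss z := by unfold gauss; positivity

theorem integrable_exp_neg_mul_sq {b : ℝ} (hb : 0 < b) :
    Integrable (fun z : Plane => Real.exp (-b * ‖z‖ ^ 2)) := by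
  refine Integrable.of_integral_ne_zero ?_
  rw [GaussianFourier.integral_rexp_neg_mul_sq_norm hb]
  positivity

theorem integral_gauss : ∫ z, gauss z = 1 := by
  unfold gauss
  rw [integral_const_mul, GaussianFourier.integral_rexp_neg_mul_sq_norm (by norm_num)]
  simp only [finrank_euclideanSpace, Fintype.card_fin]
  norm_num
  field_simp

theorem contDiff_gauss : ContDiff ℝ ∞ gauss := by
  unfold gauss
  exact contDiff_const.mul ((contDiff_const.mul (contDiff_norm_sq ℝ)).exp)

theorem sq_mul_gauss_le (z : Plane) : (1 + ‖z‖ ^ 2) * gauss z ≤ 8 * Real.exp (-(1 / 8) * ‖z‖ ^ 2) := by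
  have h1 : 1 + ‖z‖ ^ 2 ≤ 8 * Real.exp (‖z‖ ^ 2 / 8) := by
    have := Real.add_one_le_exp (‖z‖ ^ 2 / 8); linarith [sq_nonneg ‖z‖]
  have h2 : gauss z ≤ Real.exp (-(1 / 4) * ‖z‖ ^ 2) := by
    unfold gauss
    have : (4 * Real.pi)⁻¹ ≤ 1 := inv_le_one_of_one_le₀ (by linarith [Real.pi_gt_three])
    nlinarith [Real.exp_pos (-(1 / 4) * ‖z‖ ^ 2)]
  calc _ ≤ 8 * Real.exp (‖z‖ ^ 2 / 8) * Real.exp (-(1 / 4) * ‖z‖ ^ 2) :=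
        mul_le_mul h1 h2 (gauss_nonneg z) (by positivity)
    _ = _ := by rw [mul_assoc, ← Real.exp_add]; congr 2; ring

/-- A continuous function bounded by a multiple of `(1 + |z|²)` times the Gaussian. -/
structure GaussBdd (g : Plane → ℝ) : Prop where
  cont : Continuous g
  le : ∃ C, 0 ≤ C ∧ ∀ z, |g z| ≤ C * ((1 + ‖z‖ ^ 2) * gauss z)

theorem GaussBdd.exists_le_exp {g : Plane → ℝ} (hg : GaussBdd g) :
    ∃ C, 0 ≤ C ∧ ∀ z, |g z| ≤ C * Real.exp (-(1 / 8) * ‖z‖ ^ 2) := by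
  obtain ⟨C, hC, h⟩ := hg.le
  refine ⟨C * 8, by positivity, fun z => (h z).trans ?_⟩
  rw [mul_assoc]
  exact mul_le_mul_of_nonneg_left (sq_mul_gauss_le z) hC

theorem GaussBdd.integrable {g : Plane → ℝ} (hg : GaussBdd g) : Integrable g := by
  obtain ⟨C, hC, h⟩ := hg.exists_le_exp
  exact ((integrable_exp_neg_mul_sq (b := 1 / 8) (by norm_num)).const_mul C).mono'
    hg.cont.aestronglyMeasurable (Eventually.of_forall h)

theorem GaussBdd.memLp {g : Plane → ℝ} (hg : GaussBdd g) : MemLp g 2 volume := by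
  obtain ⟨C, hC, h⟩ := hg.exists_le_exp
  refine (memLp_two_iff_integrable_sq hg.cont.aestronglyMeasurable).2 ?_
  refine ((integrable_exp_neg_mul_sq (b := 1 / 4) (by norm_num)).const_mul (C ^ 2)).mono'
    (hg.cont.pow 2).aestronglyMeasurable (Eventually.of_forall fun z => ?_)
  rw [norm_pow, Real.norm_eq_abs]
  refine (pow_le_pow_left₀ (abs_nonneg _) (h z) 2).trans (le_of_eq ?_)
  rw [mul_pow, ← Real.exp_nat_mul]
  congr 2
  push_cast; ring

theorem abs_apply_le (z : Plane) (i : Fin 2) : |z i| ≤ ‖z‖ := by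
  simpa using PiLp.norm_apply_le z i

theorem gaussBdd_gauss : GaussBdd gauss where
  cont := contDiff_gauss.continuous
  le := ⟨1, zero_le_one, fun z => by
    rw [abs_of_nonneg (gauss_nonneg z), one_mul]
    nlinarith [gauss_nonneg z, sq_nonneg ‖z‖]⟩

theorem gaussBdd_mul (i : Fin 2) : GaussBdd (fun z => -(z i / 2) * gauss z) where
  cont := by
    have := contDiff_gauss.continuous
    fun_prop
  le := ⟨1, zero_le_one, fun z => by
    rw [abs_mul, abs_of_nonneg (gauss_nonneg z), one_mul]
    refine mul_le_mul_of_nonneg_right ?_ (gauss_nonneg z)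
    rw [abs_neg, abs_div, abs_two]
    nlinarith [abs_apply_le z i, sq_nonneg (‖z‖ - 1)]⟩

theorem gaussBdd_mul_sq (i : Fin 2) : GaussBdd (fun z => (z i ^ 2 / 4 - 1 / 2) * gauss z) where
  cont := by
    have := contDiff_gauss.continuous
    fun_prop
  le := ⟨1, zero_le_one, fun z => by
    rw [abs_mul, abs_of_nonneg (gauss_nonneg z), one_mul]
    refine mul_le_mul_of_nonneg_right ?_ (gauss_nonneg z)
    have h : z i ^ 2 ≤ ‖z‖ ^ 2 := sq_le_sq' (by linarith [(abs_le.1 (abs_apply_le z i)).1])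
      (abs_le.1 (abs_apply_le z i)).2
    rw [abs_le]
    constructor <;> nlinarith [sq_nonneg (z i)]⟩

theorem hasFDerivAt_gauss (z : Plane) :
    HasFDerivAt gauss ((-(1 / 2) * gauss z) • (innerSL ℝ z)) z := by
  have h := ((((hasStrictFDerivAt_norm_sq z).hasFDerivAt.const_mul (-(1 / 4) : ℝ)).exp).const_mul
    (4 * Real.pi)⁻¹)
  refine h.congr_fderiv ?_
  ext w
  simp [gauss]
  ring

theorem fderiv_gauss (z : Plane) (i : Fin 2) :
    fderiv ℝ gauss z (basisVec i) = -(z i / 2) * gauss z := by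
  rw [(hasFDerivAt_gauss z).fderiv]
  simp [basisVec, EuclideanSpace.inner_single_right]
  ring

theorem fderiv_mul_gauss (z : Plane) (i : Fin 2) :
    fderiv ℝ (fun z => -(z i / 2) * gauss z) z (basisVec i) = (z i ^ 2 / 4 - 1 / 2) * gauss z := by
  have h1 : HasFDerivAt (fun z : Plane => -(z i / 2))
      (-(1 / 2 : ℝ) • (EuclideanSpace.proj i : Plane →L[ℝ] ℝ)) z := by
    refine (((EuclideanSpace.proj i : Plane →L[ℝ] ℝ).hasFDerivAt (x := z)).const_smul
      (-(1 / 2 : ℝ))).congr_of_eventuallyEq (Eventually.of_forall fun y => ?_)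
    simp; ring
  have h2 : HasFDerivAt (fun z : Plane => -(z i / 2) * gauss z) _ z := h1.mul (hasFDerivAt_gauss z)
  rw [h2.fderiv]
  simp [basisVec, EuclideanSpace.inner_single_right]
  ring

theorem contDiff_mul_gauss (i : Fin 2) : ContDiff ℝ 1 (fun z : Plane => -(z i / 2) * gauss z) := by
  have := contDiff_gauss.of_le (m := 1) (WithTop.coe_le_coe.2 le_top)
  fun_prop

end Gaussian

section Smear

/-- Bounded `H¹` functions with bounded first derivatives. -/
structure TestFun (f : Plane → ℝ) : Prop extends H1 f where
  bdd : ∃ B, 0 ≤ B ∧ ∀ x, |f x| ≤ B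
  bdd_fderiv : ∀ i, ∃ B, 0 ≤ B ∧ ∀ x, |fderiv ℝ f x (basisVec i)| ≤ B

theorem Regular.exists_abs_le {f : ℝ → Plane → ℝ} (hf : Regular f) {t : ℝ} (ht : 0 ≤ t) :
    ∃ B, 0 ≤ B ∧ ∀ x, |f t x| ≤ B := by
  obtain ⟨B, hB⟩ := hf.bddL2.bdd t
  exact ⟨B, (abs_nonneg _).trans (hB t ⟨ht, le_rfl⟩ 0), hB t ⟨ht, le_rfl⟩⟩

theorem Regular.testFun {f : ℝ → Plane → ℝ} (hf : Regular f) {t : ℝ} (ht : 0 ≤ t) :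
    TestFun (f t) where
  toH1 := hf.h1 ht
  bdd := hf.exists_abs_le ht
  bdd_fderiv i := (hf.dx i).exists_abs_le ht

/-- The Gaussian average of `f` at scale `a`, that is, the heat flow from `f` at time `a²`. -/
def smear (a : ℝ) (f : Plane → ℝ) (x : Plane) : ℝ := ∫ z, gauss z * f (x - a • z)

theorem GaussBdd.integrable_mul {g f : Plane → ℝ} (hg : GaussBdd g) (hf : Continuous f)
    (hb : ∃ B, 0 ≤ B ∧ ∀ x, |f x| ≤ B) (x : Plane) (a : ℝ) :
    Integrable (fun z => g z * f (x - a • z)) := by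
  obtain ⟨B, hB0, hB⟩ := hb
  refine (hg.integrable.abs.mul_const B).mono' ?_ (Eventually.of_forall fun z => ?_)
  · have := hg.cont
    exact Continuous.aestronglyMeasurable (by fun_prop)
  · rw [norm_mul, Real.norm_eq_abs, Real.norm_eq_abs]
    exact mul_le_mul_of_nonneg_left (hB _) (abs_nonneg _)

theorem smear_zero (f : Plane → ℝ) (x : Plane) : smear 0 f x = f x := by
  simp [smear, integral_mul_const, integral_gauss]

theorem continuous_smear {f : Plane → ℝ} (hf : Continuous f) (hb : ∃ B, 0 ≤ B ∧ ∀ x, |f x| ≤ B) :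
    Continuous (fun q : ℝ × Plane => smear q.1 f q.2) := by
  have hg := contDiff_gauss.continuous
  obtain ⟨B, hB0, hB⟩ := hb
  refine continuous_of_dominated (bound := fun z => gauss z * B) (fun q => ?_) (fun q => ?_)
    (gaussBdd_gauss.integrable.mul_const B) (Eventually.of_forall fun z => ?_)
  · exact Continuous.aestronglyMeasurable (by fun_prop)
  · refine Eventually.of_forall fun z => ?_
    rw [norm_mul, Real.norm_eq_abs, Real.norm_eq_abs, abs_of_nonneg (gauss_nonneg z)]
    exact mul_le_mul_of_nonneg_left (hB _) (gauss_nonneg z)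
  · fun_prop

theorem TestFun.norm_fderiv_le {f : Plane → ℝ} (hf : TestFun f) :
    ∃ B, 0 ≤ B ∧ ∀ x, ‖fderiv ℝ f x‖ ≤ B := by
  obtain ⟨B₀, h0, hB₀⟩ := hf.bdd_fderiv 0
  obtain ⟨B₁, h1, hB₁⟩ := hf.bdd_fderiv 1
  exact ⟨B₀ + B₁, by positivity, fun x => (norm_clm_le _).trans (add_le_add (hB₀ x) (hB₁ x))⟩

theorem TestFun.hasFDerivAt {f : Plane → ℝ} (hf : TestFun f) (x : Plane) :
    HasFDerivAt f (fderiv ℝ f x) x :=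
  (hf.contDiff.differentiable (by norm_num) x).hasFDerivAt

theorem TestFun.continuous_fderiv {f : Plane → ℝ} (hf : TestFun f) : Continuous (fderiv ℝ f) :=
  hf.contDiff.continuous_fderiv (by norm_num)

theorem TestFun.hasFDerivAt_smear {f : Plane → ℝ} (hf : TestFun f) (a : ℝ) (x : Plane) :
    HasFDerivAt (smear a f) (∫ z, gauss z • fderiv ℝ f (x - a • z)) x := by
  have hg := contDiff_gauss.continuous
  have hfc := hf.contDiff.continuous
  have hf'c := hf.continuous_fderiv
  obtain ⟨B, hB0, hB⟩ := hf.norm_fderiv_le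
  refine hasFDerivAt_integral_of_dominated_of_fderiv_le (bound := fun z => gauss z * B)
    (F := fun x z => gauss z * f (x - a • z)) (F' := fun x z => gauss z • fderiv ℝ f (x - a • z))
    (s := univ) univ_mem
    (Eventually.of_forall fun y => Continuous.aestronglyMeasurable (by fun_prop))
    (gaussBdd_gauss.integrable_mul hfc hf.bdd x a)
    (Continuous.aestronglyMeasurable (by fun_prop))
    (Eventually.of_forall fun z y _ => ?_) (gaussBdd_gauss.integrable.mul_const B)
    (Eventually.of_forall fun z y _ => ?_)
  · rw [norm_smul, Real.norm_eq_abs, abs_of_nonneg (gauss_nonneg z)]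
    exact mul_le_mul_of_nonneg_left (hB _) (gauss_nonneg z)
  · have h1 : HasFDerivAt (fun y : Plane => f (y - a • z)) (fderiv ℝ f (y - a • z)) y := by
      exact ((hf.hasFDerivAt (y - a • z)).comp y ((hasFDerivAt_id y).sub_const (a • z))).congr_fderiv
        (ContinuousLinearMap.comp_id _)
    exact h1.const_mul (gauss z)

theorem TestFun.integrable_smul_fderiv {f : Plane → ℝ} (hf : TestFun f) (a : ℝ) (x : Plane) :
    Integrable (fun z => gauss z • fderiv ℝ f (x - a • z)) := by
  have hg := contDiff_gauss.continuous
  have hf'c := hf.continuous_fderiv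
  obtain ⟨B, hB0, hB⟩ := hf.norm_fderiv_le
  refine (gaussBdd_gauss.integrable.mul_const B).mono'
    (Continuous.aestronglyMeasurable (by fun_prop)) (Eventually.of_forall fun z => ?_)
  rw [norm_smul, Real.norm_eq_abs, abs_of_nonneg (gauss_nonneg z)]
  exact mul_le_mul_of_nonneg_left (hB _) (gauss_nonneg z)

theorem TestFun.fderiv_smear {f : Plane → ℝ} (hf : TestFun f) (a : ℝ) (x : Plane) (i : Fin 2) :
    fderiv ℝ (smear a f) x (basisVec i) = smear a (fun x => fderiv ℝ f x (basisVec i)) x := by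
  rw [(hf.hasFDerivAt_smear a x).fderiv,
    ContinuousLinearMap.integral_apply (hf.integrable_smul_fderiv a x)]
  rfl

theorem TestFun.contDiff_smear {f : Plane → ℝ} (hf : TestFun f) (a : ℝ) :
    ContDiff ℝ 1 (smear a f) := by
  have hg := contDiff_gauss.continuous
  have hf'c := hf.continuous_fderiv
  rw [contDiff_one_iff_fderiv]
  refine ⟨fun x => (hf.hasFDerivAt_smear a x).differentiableAt, ?_⟩
  have : fderiv ℝ (smear a f) = fun x => ∫ z, gauss z • fderiv ℝ f (x - a • z) :=
    funext fun x => (hf.hasFDerivAt_smear a x).fderiv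
  rw [this]
  obtain ⟨B, hB0, hB⟩ := hf.norm_fderiv_le
  refine continuous_of_dominated (bound := fun z => gauss z * B)
    (fun q => Continuous.aestronglyMeasurable (by fun_prop))
    (fun q => Eventually.of_forall fun z => ?_)
    (gaussBdd_gauss.integrable.mul_const B) (Eventually.of_forall fun z => by fun_prop)
  rw [norm_smul, Real.norm_eq_abs, abs_of_nonneg (gauss_nonneg z)]
  exact mul_le_mul_of_nonneg_left (hB _) (gauss_nonneg z)

theorem integrable_gauss_mul_sq {f : Plane → ℝ} (hf : Continuous f) (hL : MemLp f 2 volume) (a : ℝ) :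
    Integrable (fun q : Plane × Plane => gauss q.2 * f (q.1 - a • q.2) ^ 2) (volume.prod volume) := by
  have hg := contDiff_gauss.continuous
  have hm : AEStronglyMeasurable (fun q : Plane × Plane => gauss q.2 * f (q.1 - a • q.2) ^ 2)
      (volume.prod volume) := Continuous.aestronglyMeasurable (by fun_prop)
  have hsq : Integrable (fun x => f x ^ 2) := hL.integrable_sq
  rw [integrable_prod_iff' hm]
  refine ⟨Eventually.of_forall fun z => ((hsq.comp_sub_right (a • z)).const_mul (gauss z)), ?_⟩
  have e : (fun z : Plane => ∫ x, ‖gauss z * f (x - a • z) ^ 2‖) =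
      fun z => gauss z * ∫ x, f x ^ 2 := by
    funext z
    simp only [Real.norm_eq_abs, abs_mul, abs_of_nonneg (gauss_nonneg z), abs_pow, sq_abs]
    rw [integral_const_mul, integral_sub_right_eq_self (fun x => f x ^ 2) (a • z)]
  simp only [e]
  exact gaussBdd_gauss.integrable.mul_const _

theorem smear_sq_le {f : Plane → ℝ} (hf : Continuous f) (hb : ∃ B, 0 ≤ B ∧ ∀ x, |f x| ≤ B) (a : ℝ)
    (x : Plane) : smear a f x ^ 2 ≤ ∫ z, gauss z * f (x - a • z) ^ 2 := by
  have i1 := gaussBdd_gauss.integrable_mul hf hb x a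
  have i2 : Integrable (fun z => gauss z * f (x - a • z) ^ 2) := by
    obtain ⟨B, hB0, hB⟩ := hb
    refine gaussBdd_gauss.integrable_mul (f := fun x => f x ^ 2) (hf.pow 2)
      ⟨B ^ 2, by positivity, fun y => ?_⟩ x a
    rw [abs_pow]; exact pow_le_pow_left₀ (abs_nonneg _) (hB y) 2
  have i3 := gaussBdd_gauss.integrable
  set m := smear a f x with hm
  have h0 : 0 ≤ ∫ z, gauss z * (f (x - a • z) - m) ^ 2 :=
    integral_nonneg fun z => mul_nonneg (gauss_nonneg z) (sq_nonneg _)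
  have e : (fun z => gauss z * (f (x - a • z) - m) ^ 2) = fun z =>
      (gauss z * f (x - a • z) ^ 2 - 2 * m * (gauss z * f (x - a • z))) + m ^ 2 * gauss z := by
    funext z; ring
  have hI := ((HasInt.of_integrable i2).sub ((HasInt.of_integrable i1).const_mul (2 * m))).add
    ((HasInt.of_integrable i3).const_mul (m ^ 2))
  rw [e, hI.eq, integral_gauss] at h0
  change 0 ≤ _ - 2 * m * m + _ at h0
  nlinarith

theorem memLp_smear {f : Plane → ℝ} (hf : Continuous f) (hb : ∃ B, 0 ≤ B ∧ ∀ x, |f x| ≤ B)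
    (hL : MemLp f 2 volume) (a : ℝ) : MemLp (smear a f) 2 volume := by
  have hc : Continuous (smear a f) :=
    (continuous_smear hf hb).comp (f := fun x : Plane => (a, x)) (by fun_prop)
  refine (memLp_two_iff_integrable_sq hc.aestronglyMeasurable).2 ?_
  refine ((integrable_gauss_mul_sq hf hL a).integral_prod_left).mono'
    (hc.pow 2).aestronglyMeasurable (Eventually.of_forall fun x => ?_)
  rw [norm_pow, Real.norm_eq_abs, sq_abs]
  exact smear_sq_le hf hb a x

theorem nrm_smear_le {f : Plane → ℝ} (hf : Continuous f) (hb : ∃ B, 0 ≤ B ∧ ∀ x, |f x| ≤ B)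
    (hL : MemLp f 2 volume) (a : ℝ) : nrm (smear a f) ≤ nrm f := by
  refine Real.sqrt_le_sqrt ?_
  have hI := integrable_gauss_mul_sq hf hL a
  calc ∫ x, smear a f x ^ 2 ≤ ∫ x, ∫ z, gauss z * f (x - a • z) ^ 2 :=
        integral_mono (memLp_smear hf hb hL a).integrable_sq hI.integral_prod_left
          fun x => smear_sq_le hf hb a x
    _ = ∫ z, ∫ x, gauss z * f (x - a • z) ^ 2 := integral_integral_swap hI
    _ = ∫ z, gauss z * ∫ x, f x ^ 2 := by
        congr 1; funext z
        rw [integral_const_mul, integral_sub_right_eq_self (fun x => f x ^ 2) (a • z)]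
    _ = _ := by rw [integral_mul_const, integral_gauss, one_mul]

theorem TestFun.continuous_dir {f : Plane → ℝ} (hf : TestFun f) (i : Fin 2) :
    Continuous (fun x => fderiv ℝ f x (basisVec i)) := by
  have := hf.continuous_fderiv
  fun_prop

theorem TestFun.h1_smear {f : Plane → ℝ} (hf : TestFun f) (a : ℝ) : H1 (smear a f) where
  contDiff := hf.contDiff_smear a
  memLp := memLp_smear hf.contDiff.continuous hf.bdd hf.memLp a
  memLp_fderiv i := by
    simp only [hf.fderiv_smear a]
    exact memLp_smear (hf.continuous_dir i) (hf.bdd_fderiv i) (hf.memLp_fderiv i) a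

theorem TestFun.mul_integral_fderiv {f g g' : Plane → ℝ} (hf : TestFun f) (hg : GaussBdd g)
    (hg' : GaussBdd g') (i : Fin 2) (hgd : ContDiff ℝ 1 g)
    (hgg' : ∀ z, fderiv ℝ g z (basisVec i) = g' z) (a : ℝ) (x : Plane) :
    a * ∫ z, g z * fderiv ℝ f (x - a • z) (basisVec i) = ∫ z, g' z * f (x - a • z) := by
  have hd : ∀ z, HasFDerivAt (fun z : Plane => f (x - a • z))
      ((fderiv ℝ f (x - a • z)).comp (-(a • ContinuousLinearMap.id ℝ Plane))) z := fun z =>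
    (hf.hasFDerivAt (x - a • z)).comp z (((hasFDerivAt_id z).const_smul a).const_sub x)
  have e : ∀ z, fderiv ℝ (fun z : Plane => f (x - a • z)) z (basisVec i) =
      -a * fderiv ℝ f (x - a • z) (basisVec i) := fun z => by
    rw [(hd z).fderiv]; simp
  have h := integral_mul_fderiv_eq_neg_fderiv_mul_of_integrable (μ := (volume : Measure Plane))
    (f := g) (g := fun z : Plane => f (x - a • z)) (v := basisVec i)
    (by simp only [hgg']; exact hg'.integrable_mul hf.contDiff.continuous hf.bdd x a)
    (by
      simp only [e]
      refine ((hg.integrable_mul (hf.continuous_dir i) (hf.bdd_fderiv i) x a).const_mul (-a)).congr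
        (Eventually.of_forall fun z => ?_)
      beta_reduce; ring)
    (hg.integrable_mul hf.contDiff.continuous hf.bdd x a)
    (fun z _ => hgd.differentiable (by norm_num) z) (fun z _ => (hd z).differentiableAt)
  simp only [e, hgg'] at h
  rw [← neg_inj, ← h, ← neg_mul, ← integral_const_mul]
  congr 1; funext z; ring

theorem TestFun.mul_smear_fderiv {f : Plane → ℝ} (hf : TestFun f) (a : ℝ) (x : Plane) (i : Fin 2) :
    a * smear a (fun x => fderiv ℝ f x (basisVec i)) x = ∫ z, -(z i / 2) * gauss z * f (x - a • z) :=
  hf.mul_integral_fderiv gaussBdd_gauss (gaussBdd_mul i) i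
    (contDiff_gauss.of_le (WithTop.coe_le_coe.2 le_top)) (fun z => fderiv_gauss z i) a x

theorem TestFun.sq_mul_smear_fderiv {f : Plane → ℝ} (hf : TestFun f) (a : ℝ) (x : Plane) (i : Fin 2)
    (hf' : TestFun (fun x => fderiv ℝ f x (basisVec i))) :
    a ^ 2 * smear a (fun x => fderiv ℝ (fun x => fderiv ℝ f x (basisVec i)) x (basisVec i)) x =
      ∫ z, (z i ^ 2 / 4 - 1 / 2) * gauss z * f (x - a • z) := by
  rw [sq, mul_assoc, hf'.mul_smear_fderiv a x i]
  exact hf.mul_integral_fderiv (gaussBdd_mul i) (gaussBdd_mul_sq i) i (contDiff_mul_gauss i)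
    (fun z => fderiv_mul_gauss z i) a x

theorem abs_integral_gaussBdd_mul_le {g f : Plane → ℝ} (hg : GaussBdd g) (hf : Continuous f)
    (hL : MemLp f 2 volume) {a : ℝ} (ha : 0 < a) (x : Plane) :
    |∫ z, g z * f (x - a • z)| ≤ nrm g * (a⁻¹ * nrm f) := by
  have hsq : Integrable (fun x => f x ^ 2) := hL.integrable_sq
  have i1 : Integrable (fun z => f (x - z) ^ 2) := hsq.comp_sub_left x
  have hm : MemLp (fun z => f (x - a • z)) 2 volume := by
    refine (memLp_two_iff_integrable_sq (Continuous.aestronglyMeasurable (by fun_prop))).2 ?_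
    exact (integrable_comp_smul_iff volume (fun z => f (x - z) ^ 2) ha.ne').2 i1
  refine (abs_integral_mul_le_nrm hg.memLp hm).trans (mul_le_mul_of_nonneg_left ?_ (nrm_nonneg _))
  have e : ∫ z, f (x - a • z) ^ 2 = (a⁻¹) ^ 2 * ∫ z, f z ^ 2 := by
    rw [Measure.integral_comp_smul volume (fun z => f (x - z) ^ 2) a,
      integral_sub_left_eq_self (fun z => f z ^ 2) volume x]
    simp only [finrank_euclideanSpace, Fintype.card_fin, smul_eq_mul]
    rw [abs_of_nonneg (by positivity), inv_pow]
  unfold nrm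
  rw [e, Real.sqrt_mul (sq_nonneg _), Real.sqrt_sq (by positivity)]

end Smear

section HeatFlow

/-- Functions all of whose partial derivatives up to order two are test functions. -/
structure TestFun₂ (f : Plane → ℝ) : Prop where
  zero : TestFun f
  one : ∀ i, TestFun (fun x => fderiv ℝ f x (basisVec i))
  two : ∀ i, TestFun (fun x => fderiv ℝ (fun x => fderiv ℝ f x (basisVec i)) x (basisVec i))

theorem Regular.testFun₂ {f : ℝ → Plane → ℝ} (hf : Regular f) {t : ℝ} (ht : 0 ≤ t) :
    TestFun₂ (f t) where
  zero := hf.testFun ht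
  one i := (hf.dx i).testFun ht
  two i := ((hf.dx i).dx i).testFun ht

/-- The Laplacian of the Gaussian average. -/
def lapSmear (a : ℝ) (f : Plane → ℝ) (x : Plane) : ℝ :=
  ∑ i, smear a (fun x => fderiv ℝ (fun x => fderiv ℝ f x (basisVec i)) x (basisVec i)) x

theorem abs_apply_mul_le (L : Plane →L[ℝ] ℝ) {B : ℝ} (hB : ‖L‖ ≤ B) (z : Plane) :
    |L z| ≤ B * (1 + ‖z‖ ^ 2) := by
  have h := L.le_opNorm z
  rw [Real.norm_eq_abs] at h
  have h0 := norm_nonneg L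
  refine h.trans (mul_le_mul hB ?_ (norm_nonneg _) (h0.trans hB))
  nlinarith [sq_nonneg (‖z‖ - 1)]

theorem TestFun₂.hasDerivAt_smear {f : Plane → ℝ} (hf : TestFun₂ f) (a : ℝ) (x : Plane) :
    HasDerivAt (fun a => smear a f x) (2 * a * lapSmear a f x) a := by
  have hg := contDiff_gauss.continuous
  have hfc := hf.zero.contDiff.continuous
  have hf'c := hf.zero.continuous_fderiv
  obtain ⟨B, hB0, hB⟩ := hf.zero.norm_fderiv_le
  have hbd : Integrable (fun z : Plane => B * ((1 + ‖z‖ ^ 2) * gauss z)) := by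
    have : GaussBdd (fun z : Plane => (1 + ‖z‖ ^ 2) * gauss z) := ⟨by fun_prop, 1, zero_le_one, fun z => by
      rw [one_mul, abs_of_nonneg (mul_nonneg (by positivity) (gauss_nonneg z))]⟩
    exact this.integrable.const_mul B
  have h := hasDerivAt_integral_of_dominated_loc_of_deriv_le (μ := (volume : Measure Plane))
    (bound := fun z : Plane => B * ((1 + ‖z‖ ^ 2) * gauss z))
    (F := fun a z => gauss z * f (x - a • z))
    (F' := fun a z => gauss z * (fderiv ℝ f (x - a • z) (-z))) (x₀ := a)
    (s := univ) univ_mem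
    (Eventually.of_forall fun y => Continuous.aestronglyMeasurable (by fun_prop))
    (gaussBdd_gauss.integrable_mul hfc hf.zero.bdd x a)
    (Continuous.aestronglyMeasurable (by fun_prop))
    (Eventually.of_forall fun z y _ => by
      rw [norm_mul, Real.norm_eq_abs, Real.norm_eq_abs, abs_of_nonneg (gauss_nonneg z), map_neg,
        abs_neg]
      have := mul_le_mul_of_nonneg_left (abs_apply_mul_le _ (hB (x - y • z)) z) (gauss_nonneg z)
      linarith) hbd
    (Eventually.of_forall fun z b _ => by
      have h1 : HasDerivAt (fun b : ℝ => x - b • z) (-z) b := by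
        simpa using ((hasDerivAt_id b).smul_const z).const_sub x
      exact ((hf.zero.hasFDerivAt (x - b • z)).comp_hasDerivAt b h1).const_mul (gauss z))
  refine h.2.congr_deriv ?_
  have e : ∀ z : Plane, gauss z * (fderiv ℝ f (x - a • z) (-z)) =
      ∑ i, 2 * (-(z i / 2) * gauss z * fderiv ℝ f (x - a • z) (basisVec i)) := by
    intro z
    have h1 := congrArg (fderiv ℝ f (x - a • z)) (eq_sum_basisVec z)
    simp only [map_add, map_smul, smul_eq_mul] at h1
    simp only [map_neg, Fin.sum_univ_two]
    linear_combination (-gauss z) * h1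
  simp only [e]
  rw [integral_finsetSum _ fun i _ => ((gaussBdd_mul i).integrable_mul (hf.zero.continuous_dir i)
    (hf.zero.bdd_fderiv i) x a).const_mul 2, lapSmear, Finset.mul_sum]
  refine Finset.sum_congr rfl fun i _ => ?_
  rw [integral_const_mul, ← (hf.one i).mul_smear_fderiv a x i]
  ring

theorem TestFun₂.memLp_lapSmear {f : Plane → ℝ} (hf : TestFun₂ f) (a : ℝ) :
    MemLp (lapSmear a f) 2 volume :=
  memLp_finsetSum _ fun i _ =>
    memLp_smear (hf.two i).contDiff.continuous (hf.two i).bdd (hf.two i).memLp a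

theorem TestFun₂.continuous_lapSmear {f : Plane → ℝ} (hf : TestFun₂ f) :
    Continuous (fun q : ℝ × Plane => lapSmear q.1 f q.2) :=
  continuous_finsetSum _ fun i _ => continuous_smear (hf.two i).contDiff.continuous (hf.two i).bdd

theorem TestFun₂.exists_nrm_lapSmear_le {f : Plane → ℝ} (hf : TestFun₂ f) :
    ∃ B, 0 ≤ B ∧ ∀ a, ∫ x, lapSmear a f x ^ 2 ≤ B := by
  refine ⟨∑ i, 2 * nrm (fun x => fderiv ℝ (fun x => fderiv ℝ f x (basisVec i)) x (basisVec i)) ^ 2,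
    by positivity, fun a => ?_⟩
  have hm := fun i => memLp_smear (hf.two i).contDiff.continuous (hf.two i).bdd (hf.two i).memLp a
  have hI := fun i => (HasInt.of_integrable (hm i).integrable_sq).const_mul 2
  have hS := HasInt.sum Finset.univ fun i _ => hI i
  calc _ ≤ _ := integral_mono (hf.memLp_lapSmear a).integrable_sq hS.integrable fun x => by
        simp only [lapSmear, Fin.sum_univ_two]
        nlinarith [sq_nonneg (smear a (fun x => fderiv ℝ (fun x => fderiv ℝ f x (basisVec 0)) x (basisVec 0)) x
          - smear a (fun x => fderiv ℝ (fun x => fderiv ℝ f x (basisVec 1)) x (basisVec 1)) x)]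
    _ = _ := hS.eq
    _ ≤ _ := Finset.sum_le_sum fun i _ => by
        rw [← nrm_sq]
        have := nrm_smear_le (hf.two i).contDiff.continuous (hf.two i).bdd (hf.two i).memLp a
        gcongr
        exact nrm_nonneg _

/-- The heat flow decreases `∫ f · f` at most by `a²` times the Dirichlet energy of `f`. -/
theorem TestFun₂.sub_integral_mul_smear_le {f : Plane → ℝ} (hf : TestFun₂ f) {b : ℝ} (hb : 0 ≤ b) :
    (∫ x, f x * f x) - ∫ x, f x * smear b f x ≤
      b ^ 2 * ∑ i, ∫ x, fderiv ℝ f x (basisVec i) * fderiv ℝ f x (basisVec i) := by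
  obtain ⟨B, hB0, hB⟩ := hf.exists_nrm_lapSmear_le
  set D := ∑ i, ∫ x, fderiv ℝ f x (basisVec i) * fderiv ℝ f x (basisVec i) with hD
  have hintg : ∀ a, Integrable (fun x => f x * (2 * a * lapSmear a f x)) := fun a =>
    hf.zero.memLp.integrable_mul ((hf.memLp_lapSmear a).const_mul (2 * a))
  have hbound : ∀ a, 0 ≤ a → -(2 * a * D) ≤ ∫ x, f x * (2 * a * lapSmear a f x) := by
    intro a ha
    have e1 : HasInt (fun x => f x * lapSmear a f x)
        (∑ i, -∫ x, fderiv ℝ f x (basisVec i) * smear a (fun x => fderiv ℝ f x (basisVec i)) x) := by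
      refine (HasInt.sum Finset.univ (F := fun i x => f x * smear a (fun x => fderiv ℝ
        (fun x => fderiv ℝ f x (basisVec i)) x (basisVec i)) x) fun i _ => ?_).congr fun x => by
          rw [lapSmear, Finset.mul_sum]
      rw [← hf.zero.toH1.integral_mul_fderiv ((hf.one i).h1_smear a) i]
      simp only [(hf.one i).fderiv_smear a]
      exact HasInt.of_integrable (hf.zero.memLp.integrable_mul
        (memLp_smear (hf.two i).contDiff.continuous (hf.two i).bdd (hf.two i).memLp a))
    have e2 : ∫ x, f x * (2 * a * lapSmear a f x) = 2 * a *
        ∑ i, -∫ x, fderiv ℝ f x (basisVec i) * smear a (fun x => fderiv ℝ f x (basisVec i)) x := by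
      rw [← e1.eq, ← integral_const_mul]
      congr 1; funext x; ring
    rw [e2, hD]
    have e3 : ∀ i, ∫ x, fderiv ℝ f x (basisVec i) * smear a (fun x => fderiv ℝ f x (basisVec i)) x ≤
        ∫ x, fderiv ℝ f x (basisVec i) * fderiv ℝ f x (basisVec i) := by
      intro i
      have hm := memLp_smear (hf.one i).contDiff.continuous (hf.one i).bdd (hf.one i).memLp a
      refine (le_abs_self _).trans ((abs_integral_mul_le_nrm (hf.one i).memLp hm).trans ?_)
      have h1 := nrm_smear_le (hf.one i).contDiff.continuous (hf.one i).bdd (hf.one i).memLp a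
      refine (mul_le_mul_of_nonneg_left h1 (nrm_nonneg _)).trans (le_of_eq ?_)
      rw [← sq, nrm_sq]
      simp only [sq]
    have e4 := Finset.sum_le_sum fun i (_ : i ∈ Finset.univ) => e3 i
    rw [Finset.sum_neg_distrib]
    nlinarith
  have hcont : ContinuousOn (fun q : ℝ × Plane => f q.2 * (2 * q.1 * lapSmear q.1 f q.2))
      (Icc 0 b ×ˢ univ) := by
    have h1 := hf.continuous_lapSmear
    have h2 := hf.zero.contDiff.continuous
    exact Continuous.continuousOn (by fun_prop)
  have habs : ∀ a ∈ Icc 0 b, ∫ x, |f x * (2 * a * lapSmear a f x)| ≤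
      (∫ x, f x * f x) + (2 * b) ^ 2 * B := by
    intro a ha
    refine (MemLp.integral_abs_mul_le hf.zero.memLp ((hf.memLp_lapSmear a).const_mul (2 * a))).trans
      (add_le_add_right ?_ _)
    have e : ∀ x, 2 * a * lapSmear a f x * (2 * a * lapSmear a f x) =
      (2 * a) ^ 2 * lapSmear a f x ^ 2 := fun x => by ring
    simp only [e]
    rw [integral_const_mul]
    have h0 : 0 ≤ ∫ x, lapSmear a f x ^ 2 := integral_nonneg fun x => sq_nonneg _
    have h1 : (2 * a) ^ 2 ≤ (2 * b) ^ 2 := by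
      have := ha.1; have := ha.2; gcongr
    exact mul_le_mul h1 (hB a) h0 (by positivity)
  have key := integral_sub_eq_intervalIntegral (f := fun a x => f x * smear a f x) hb
    (fun x a _ => ((hf.hasDerivAt_smear a x).const_mul (f x)).hasDerivWithinAt) hcont
    (fun a _ => hintg a) habs (hf.zero.memLp.integrable_mul (hf.zero.h1_smear 0).memLp)
    (hf.zero.memLp.integrable_mul (hf.zero.h1_smear b).memLp)
  simp only [smear_zero] at key
  have hmono : ∫ a in (0 : ℝ)..b, -(2 * a * D) ≤ ∫ a in (0 : ℝ)..b, ∫ x, f x * (2 * a * lapSmear a f x) :=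
    intervalIntegral.integral_mono_on hb (by apply Continuous.intervalIntegrable; fun_prop)
      (intervalIntegrable_integral hb hcont (fun a _ => hintg a) habs) fun a ha => hbound a ha.1
  have hval : ∫ a in (0 : ℝ)..b, -(2 * a * D) = -(b ^ 2 * D) := by
    rw [intervalIntegral.integral_neg, intervalIntegral.integral_mul_const,
      intervalIntegral.integral_const_mul, integral_id]
    ring
  linarith

end HeatFlow

section Pairing

/-- The constant in the pointwise bounds for derivatives of Gaussian averages. -/
def smearConst : ℝ :=
  ∑ i : Fin 2, (nrm (fun z : Plane => -(z i / 2) * gauss z) +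
    nrm (fun z : Plane => (z i ^ 2 / 4 - 1 / 2) * gauss z))

theorem smearConst_nonneg : 0 ≤ smearConst :=
  Finset.sum_nonneg fun _ _ => add_nonneg (nrm_nonneg _) (nrm_nonneg _)

theorem TestFun.abs_smear_fderiv_le {f : Plane → ℝ} (hf : TestFun f) {a b : ℝ} (hb : 0 < b)
    (hab : b ≤ a) (x : Plane) (i : Fin 2) :
    |smear a (fun x => fderiv ℝ f x (basisVec i)) x| ≤ smearConst * (b⁻¹ ^ 2 * nrm f) := by
  have ha : 0 < a := hb.trans_le hab
  have h := abs_integral_gaussBdd_mul_le (gaussBdd_mul i) hf.contDiff.continuous hf.memLp ha x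
  rw [← hf.mul_smear_fderiv a x i, abs_mul, abs_of_pos ha] at h
  have hc : nrm (fun z : Plane => -(z i / 2) * gauss z) ≤ smearConst :=
    le_trans (le_add_of_nonneg_right (nrm_nonneg _))
      (Finset.single_le_sum (f := fun i : Fin 2 => nrm (fun z : Plane => -(z i / 2) * gauss z) +
        nrm (fun z : Plane => (z i ^ 2 / 4 - 1 / 2) * gauss z))
        (fun _ _ => add_nonneg (nrm_nonneg _) (nrm_nonneg _)) (Finset.mem_univ i))
  have hn := nrm_nonneg f
  calc |smear a (fun x => fderiv ℝ f x (basisVec i)) x|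
      = a⁻¹ * (a * |smear a (fun x => fderiv ℝ f x (basisVec i)) x|) := by field_simp
    _ ≤ a⁻¹ * (nrm (fun z : Plane => -(z i / 2) * gauss z) * (a⁻¹ * nrm f)) := by gcongr
    _ ≤ b⁻¹ * (smearConst * (b⁻¹ * nrm f)) := by
        have := smearConst_nonneg
        have := nrm_nonneg (fun z : Plane => -(z i / 2) * gauss z)
        gcongr
    _ = _ := by ring

theorem TestFun₂.abs_lapSmear_le {f : Plane → ℝ} (hf : TestFun₂ f) {a b : ℝ} (hb : 0 < b)
    (hab : b ≤ a) (x : Plane) : |lapSmear a f x| ≤ smearConst * (b⁻¹ ^ 3 * nrm f) := by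
  have ha : 0 < a := hb.trans_le hab
  have hn := nrm_nonneg f
  have h : ∀ i : Fin 2, |smear a (fun x => fderiv ℝ (fun x => fderiv ℝ f x (basisVec i)) x (basisVec i)) x|
      ≤ nrm (fun z : Plane => (z i ^ 2 / 4 - 1 / 2) * gauss z) * (b⁻¹ ^ 3 * nrm f) := by
    intro i
    have h := abs_integral_gaussBdd_mul_le (gaussBdd_mul_sq i) hf.zero.contDiff.continuous
      hf.zero.memLp ha x
    rw [← hf.zero.sq_mul_smear_fderiv a x i (hf.one i), abs_mul, abs_of_pos (pow_pos ha 2)] at h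
    set S := |smear a (fun x => fderiv ℝ (fun x => fderiv ℝ f x (basisVec i)) x (basisVec i)) x|
    have hN := nrm_nonneg (fun z : Plane => (z i ^ 2 / 4 - 1 / 2) * gauss z)
    set N := nrm (fun z : Plane => (z i ^ 2 / 4 - 1 / 2) * gauss z)
    calc S = a⁻¹ ^ 2 * (a ^ 2 * S) := by field_simp
      _ ≤ a⁻¹ ^ 2 * (N * (a⁻¹ * nrm f)) := by gcongr
      _ ≤ b⁻¹ ^ 2 * (N * (b⁻¹ * nrm f)) := by gcongr
      _ = _ := by ring
  refine (Finset.abs_sum_le_sum_abs _ _).trans ((Finset.sum_le_sum fun i _ => h i).trans ?_)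
  rw [← Finset.sum_mul]
  refine mul_le_mul_of_nonneg_right ?_ (by positivity)
  exact Finset.sum_le_sum fun i _ => le_add_of_nonneg_left (nrm_nonneg _)

/-- The scale at time `s ≤ t` of the backward heat flow that reaches the scale `b` at time `t`. -/
def scale (b t s : ℝ) : ℝ := Real.sqrt (b ^ 2 + (t - s))

theorem le_scale {b t s : ℝ} (hs : s ≤ t) : b ≤ scale b t s :=
  Real.le_sqrt_of_sq_le (by linarith)

theorem TestFun₂.hasDerivAt_smear_scale {f : Plane → ℝ} (hf : TestFun₂ f) {b t s : ℝ} (hb : 0 < b)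
    (hs : s ≤ t) (x : Plane) :
    HasDerivAt (fun s => smear (scale b t s) f x) (-lapSmear (scale b t s) f x) s := by
  have hpos : 0 < scale b t s := hb.trans_le (le_scale hs)
  have h0 : b ^ 2 + (t - s) ≠ 0 := (by have := pow_pos hb 2; linarith : (0 : ℝ) < _).ne'
  have h1 : HasDerivAt (fun s => scale b t s) (-1 / (2 * scale b t s)) s := by
    have := (((hasDerivAt_id s).const_sub t).const_add (b ^ 2)).sqrt h0
    simpa [scale] using this
  have h2 := (hf.hasDerivAt_smear (scale b t s) x).comp s h1
  refine h2.congr_deriv ?_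
  field_simp

theorem Regular.mul_smear_deriv_bound {m : ℝ → Plane → ℝ} {f : Plane → ℝ} (hm : Regular m)
    (hf : TestFun₂ f) (t : ℝ) (a : ℝ → ℝ) :
    ∃ B, ∀ s ∈ Icc 0 t, Integrable (fun x => INS2D.tderiv m s x * smear (a s) f x
        - m s x * lapSmear (a s) f x) ∧
      ∫ x, |INS2D.tderiv m s x * smear (a s) f x - m s x * lapSmear (a s) f x| ≤ B := by
  have hsub : Icc 0 t ⊆ Ici 0 := fun t ht => ht.1
  obtain ⟨L, hL0, hL⟩ := hf.exists_nrm_lapSmear_le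
  obtain ⟨B, hB⟩ := isCompact_Icc.bddAbove_image (((hm.tderiv.continuousOn_integral_mul hm.tderiv).add
    (hm.continuousOn_integral_mul hm)).mono hsub)
  refine ⟨B + (nrm f ^ 2 + L), fun s hs => ?_⟩
  have m1 := hm.tderiv.memLp hs.1
  have m2 := hm.memLp hs.1
  have m3 := (hf.zero.h1_smear (a s)).memLp
  have m4 := hf.memLp_lapSmear (a s)
  have i1 : Integrable (fun x => INS2D.tderiv m s x * smear (a s) f x) := m1.integrable_mul m3
  have i2 : Integrable (fun x => m s x * lapSmear (a s) f x) := m2.integrable_mul m4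
  refine ⟨i1.sub i2, ?_⟩
  have h1 := MemLp.integral_abs_mul_le m1 m3
  have h2 := MemLp.integral_abs_mul_le m2 m4
  have h3 : ∫ x, smear (a s) f x * smear (a s) f x ≤ nrm f ^ 2 := by
    have := nrm_smear_le hf.zero.contDiff.continuous hf.zero.bdd hf.zero.memLp (a s)
    rw [← nrm_sq']
    exact pow_le_pow_left₀ (nrm_nonneg _) this 2
  have h4 : ∫ x, lapSmear (a s) f x * lapSmear (a s) f x ≤ L := by
    simpa only [sq] using hL (a s)
  have h5 : _ ≤ B := hB ⟨s, hs, rfl⟩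
  have h6 : ∫ x, |INS2D.tderiv m s x * smear (a s) f x - m s x * lapSmear (a s) f x| ≤
      (∫ x, |INS2D.tderiv m s x * smear (a s) f x|) + ∫ x, |m s x * lapSmear (a s) f x| := by
    rw [← integral_add i1.abs i2.abs]
    exact integral_mono (i1.sub i2).abs (i1.abs.add i2.abs) fun x => abs_sub _ _
  simp only [Pi.add_apply] at h5
  linarith

theorem Regular.continuousOn_mul_smear_deriv {m : ℝ → Plane → ℝ} {f : Plane → ℝ} (hm : Regular m)
    (hf : TestFun₂ f) (b t : ℝ) :
    ContinuousOn (fun q : ℝ × Plane => INS2D.tderiv m q.1 q.2 * smear (scale b t q.1) f q.2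
      - m q.1 q.2 * lapSmear (scale b t q.1) f q.2) (Icc 0 t ×ˢ univ) := by
  have hsub : Icc 0 t ×ˢ (univ : Set Plane) ⊆ Ici 0 ×ˢ univ := prod_mono (fun t ht => ht.1) subset_rfl
  have hsc : Continuous (fun q : ℝ × Plane => (scale b t q.1, q.2)) := by unfold scale; fun_prop
  have h1 := (continuous_smear hf.zero.contDiff.continuous hf.zero.bdd).comp hsc
  have h2 := hf.continuous_lapSmear.comp hsc
  exact ((hm.tderiv.bddL2.cont.mono hsub).mul h1.continuousOn).sub
    ((hm.bddL2.cont.mono hsub).mul h2.continuousOn)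

theorem Regular.integral_mul_smear_sub {m : ℝ → Plane → ℝ} {f : Plane → ℝ} (hm : Regular m)
    (hf : TestFun₂ f) {b t : ℝ} (hb : 0 < b) (ht : 0 ≤ t) :
    (∫ x, m t x * smear b f x) - ∫ x, m 0 x * smear (scale b t 0) f x = ∫ s in (0 : ℝ)..t,
      ∫ x, (INS2D.tderiv m s x * smear (scale b t s) f x - m s x * lapSmear (scale b t s) f x) := by
  obtain ⟨B, hB⟩ := hm.mul_smear_deriv_bound hf t (scale b t)
  have := integral_sub_eq_intervalIntegral (f := fun s x => m s x * smear (scale b t s) f x) ht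
    (fun x s hs => by
      have h1 := (hm.smooth.hasDerivWithinAt hs.1 x).mono (fun t ht => ht.1 : Icc 0 t ⊆ Ici 0)
      exact (h1.mul (hf.hasDerivAt_smear_scale hb hs.2 x).hasDerivWithinAt).congr_deriv (by ring))
    (hm.continuousOn_mul_smear_deriv hf b t) (fun s hs => (hB s hs).1) (fun s hs => (hB s hs).2)
    ((hm.memLp le_rfl).integrable_mul (hf.zero.h1_smear _).memLp)
    ((hm.memLp ht).integrable_mul (hf.zero.h1_smear _).memLp)
  have e : scale b t t = b := by simp [scale, Real.sqrt_sq hb.le]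
  rwa [e] at this

theorem Regular.intervalIntegrable_mul_smear_deriv {m : ℝ → Plane → ℝ} {f : Plane → ℝ}
    (hm : Regular m) (hf : TestFun₂ f) (b : ℝ) {t : ℝ} (ht : 0 ≤ t) :
    IntervalIntegrable (fun s => ∫ x, (INS2D.tderiv m s x * smear (scale b t s) f x
      - m s x * lapSmear (scale b t s) f x)) volume 0 t := by
  obtain ⟨B, hB⟩ := hm.mul_smear_deriv_bound hf t (scale b t)
  exact intervalIntegrable_integral ht (hm.continuousOn_mul_smear_deriv hf b t)
    (fun s hs => (hB s hs).1) (fun s hs => (hB s hs).2)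

end Pairing

namespace Flow

variable {r : ℝ → Plane → ℝ} {v p : Fin 2 → ℝ → Plane → ℝ} {t : ℝ}

theorem tderiv_momentum (H : Flow r v p) (k : Fin 2) (ht : 0 ≤ t) (x : Plane) :
    tderiv (fun t x => v k t x + r t x * v k t x) t x =
      slap (v k) t x - p k t x - adv v (fun t x => v k t x + r t x * v k t x) t x := by
  have hv := H.reg_v k
  rw [hv.tderiv_add (H.reg_r.mul hv) ht, H.reg_r.tderiv_mul hv ht, H.mass' ht]
  have hd : ∀ i, dx i (fun t x => v k t x + r t x * v k t x) t x =
      dx i (v k) t x + (dx i r t x * v k t x + r t x * dx i (v k) t x) := fun i => by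
    rw [hv.dx_add (H.reg_r.mul hv) ht, H.reg_r.dx_mul hv ht]
  have h := H.mom' k ht x
  simp only [adv] at h ⊢
  rw [hd, hd]
  linear_combination h

theorem hasInt_pairing (H : Flow r v p) (ht : 0 ≤ t) {f : Fin 2 → Plane → ℝ}
    (hf : ∀ k, TestFun₂ (f k))
    (hdiv : ∀ x, fderiv ℝ (f 0) x (basisVec 0) + fderiv ℝ (f 1) x (basisVec 1) = 0) (a : ℝ) :
    HasInt (fun x => (∑ k, (tderiv (fun t x => v k t x + r t x * v k t x) t x * smear a (f k) x
        - (v k t x + r t x * v k t x) * lapSmear a (f k) x))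
      - ∑ k, ((∑ i, v i t x * (v k t x + r t x * v k t x) *
          smear a (fun x => fderiv ℝ (f k) x (basisVec i)) x)
        - r t x * v k t x * lapSmear a (f k) x)) 0 := by
  have hm : ∀ k, Regular (fun t x => v k t x + r t x * v k t x) := fun k =>
    (H.reg_v k).add (H.reg_r.mul (H.reg_v k))
  have A : ∀ k, HasInt (fun x => slap (v k) t x * smear a (f k) x
      - v k t x * lapSmear a (f k) x) 0 := by
    intro k
    have h : ∀ i, HasInt (fun x => dx i (dx i (v k)) t x * smear a (f k) x - v k t x *
        smear a (fun x => fderiv ℝ (fun x => fderiv ℝ (f k) x (basisVec i)) x (basisVec i)) x) 0 := by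
      intro i
      have hφ := (hf k).zero.h1_smear a
      have hφ' := ((hf k).one i).h1_smear a
      have hv := (H.reg_v k).h1 ht
      have hv' := ((H.reg_v k).dx i).h1 ht
      have e1 := hφ.integral_mul_fderiv hv' i
      have e2 := hv.integral_mul_fderiv hφ' i
      simp only [(hf k).zero.fderiv_smear a] at e1
      simp only [((hf k).one i).fderiv_smear a] at e2
      have i1 : Integrable (fun x => dx i (dx i (v k)) t x * smear a (f k) x) :=
        (hv'.memLp_fderiv i).integrable_mul hφ.memLp
      have i2 := hv.memLp.integrable_mul (hφ'.memLp_fderiv i)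
      simp only [((hf k).one i).fderiv_smear a] at i2
      have h3 := (HasInt.of_integrable i1).sub (HasInt.of_integrable i2)
      have e3 : ∫ x, dx i (dx i (v k)) t x * smear a (f k) x = ∫ x, v k t x *
        smear a (fun x => fderiv ℝ (fun x => fderiv ℝ (f k) x (basisVec i)) x (basisVec i)) x := by
        rw [e2]
        refine Eq.trans ?_ (e1.trans ?_)
        · exact integral_congr_ae (Eventually.of_forall fun x => mul_comm _ _)
        · congr 1
          exact integral_congr_ae (Eventually.of_forall fun x => mul_comm _ _)
      exact ⟨h3.integrable, h3.eq.trans (sub_eq_zero.2 e3)⟩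
    have := (h 0).add (h 1)
    rw [add_zero] at this
    exact this.congr fun x => by simp only [slap, lapSmear, Fin.sum_univ_two]; ring
  have B : HasInt (fun x => p 0 t x * smear a (f 0) x + p 1 t x * smear a (f 1) x) 0 := by
    have h0 := (hf 0).zero.h1_smear a
    have h1 := (hf 1).zero.h1_smear a
    have hd : ∀ x, fderiv ℝ (smear a (f 0)) x (basisVec 0) + fderiv ℝ (smear a (f 1)) x (basisVec 1) = 0 := by
      intro x
      rw [(hf 0).zero.fderiv_smear a, (hf 1).zero.fderiv_smear a, smear, smear, ← integral_add
        (gaussBdd_gauss.integrable_mul ((hf 0).zero.continuous_dir 0) ((hf 0).zero.bdd_fderiv 0) x a)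
        (gaussBdd_gauss.integrable_mul ((hf 1).zero.continuous_dir 1) ((hf 1).zero.bdd_fderiv 1) x a)]
      simp only [← mul_add, hdiv, mul_zero, integral_zero]
    have hI := H1.integral_curlFree_divFree ((H.reg_p 0).h1 ht) ((H.reg_p 1).h1 ht) h0 h1
      (fun x => H.curl t ht x) hd
    have h3 := (HasInt.of_integrable (((H.reg_p 0).memLp ht).integrable_mul h0.memLp)).add
      (HasInt.of_integrable (((H.reg_p 1).memLp ht).integrable_mul h1.memLp))
    exact ⟨h3.integrable, h3.eq.trans hI⟩
  have C : ∀ k, HasInt (fun x => adv v (fun t x => v k t x + r t x * v k t x) t x * smear a (f k) x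
      + ∑ i, v i t x * (v k t x + r t x * v k t x) *
          smear a (fun x => fderiv ℝ (f k) x (basisVec i)) x) 0 := by
    intro k
    have hφ := (hf k).zero.h1_smear a
    have h : ∀ i, HasInt (fun x => v i t x * (v k t x + r t x * v k t x) *
        smear a (fun x => fderiv ℝ (f k) x (basisVec i)) x +
        dx i (fun t x => v i t x * (v k t x + r t x * v k t x)) t x * smear a (f k) x) 0 := by
      intro i
      have hw := ((H.reg_v i).mul (hm k)).h1 ht
      have e1 := hw.integral_mul_fderiv hφ i
      have i2 := hw.memLp.integrable_mul (hφ.memLp_fderiv i)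
      simp only [(hf k).zero.fderiv_smear a] at e1 i2
      have h3 := (HasInt.of_integrable i2).add
        (HasInt.of_integrable ((hw.memLp_fderiv i).integrable_mul hφ.memLp))
      refine ⟨h3.integrable, h3.eq.trans ?_⟩
      rw [add_eq_zero_iff_eq_neg]
      exact e1
    have := (h 0).add (h 1)
    rw [add_zero] at this
    refine this.congr fun x => ?_
    rw [(H.reg_v 0).dx_mul (hm k) ht, (H.reg_v 1).dx_mul (hm k) ht]
    simp only [adv, Fin.sum_univ_two]
    linear_combination (-(v k t x + r t x * v k t x) * smear a (f k) x) * H.div t ht x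
  have key := (((A 0).add (A 1)).sub B).sub ((C 0).add (C 1))
  norm_num at key
  refine key.congr fun x => ?_
  simp only [H.tderiv_momentum _ ht]
  simp only [Fin.sum_univ_two]
  ring

end Flow

theorem sq_intervalIntegral_sqrt_le {q : ℝ → ℝ} {t : ℝ} (ht : 0 ≤ t) (hq : ContinuousOn q (Icc 0 t))
    (hq0 : ∀ s ∈ Icc 0 t, 0 ≤ q s) :
    (∫ s in (0 : ℝ)..t, Real.sqrt (q s)) ^ 2 ≤ t * ∫ s in (0 : ℝ)..t, q s := by
  have i1 := hq.intervalIntegrable_of_Icc (μ := volume) ht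
  have i2 := hq.sqrt.intervalIntegrable_of_Icc (μ := volume) ht
  set S := ∫ s in (0 : ℝ)..t, Real.sqrt (q s)
  have h0 : 0 ≤ ∫ s in (0 : ℝ)..t, (t * Real.sqrt (q s) - S) ^ 2 :=
    intervalIntegral.integral_nonneg ht fun s _ => sq_nonneg _
  have e : ∫ s in (0 : ℝ)..t, (t * Real.sqrt (q s) - S) ^ 2 =
      ∫ s in (0 : ℝ)..t, ((t ^ 2 * q s - 2 * t * S * Real.sqrt (q s)) + S ^ 2) := by
    refine intervalIntegral.integral_congr fun s hs => ?_
    rw [uIcc_of_le ht] at hs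
    have := Real.sq_sqrt (hq0 s hs)
    linear_combination t ^ 2 * this
  rw [e, intervalIntegral.integral_add ((i1.const_mul _).sub (i2.const_mul _)) (by simp),
    intervalIntegral.integral_sub (i1.const_mul _) (i2.const_mul _),
    intervalIntegral.integral_const_mul, intervalIntegral.integral_const_mul,
    intervalIntegral.integral_const, smul_eq_mul] at h0
  rcases ht.eq_or_lt with rfl | ht'
  · simp [S]
  · have h1 : 0 ≤ t * (t * (∫ s in (0 : ℝ)..t, q s) - S ^ 2) := by
      change 0 ≤ t ^ 2 * _ - 2 * t * S * S + (t - 0) * S ^ 2 at h0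
      linarith
    have := nonneg_of_mul_nonneg_right h1 ht'
    linarith

theorem continuousOn_sqNorm {v : Fin 2 → ℝ → Plane → ℝ} (hv : ∀ k, Regular (v k)) :
    ContinuousOn (sqNorm v) (Ici 0) := by
  unfold sqNorm
  refine continuousOn_finsetSum _ fun k _ => ?_
  simpa only [sq] using (hv k).continuousOn_integral_mul (hv k)

namespace Flow

variable {r : ℝ → Plane → ℝ} {v p : Fin 2 → ℝ → Plane → ℝ} {t : ℝ}

theorem memLp_density_mul {ρ f : Plane → ℝ} (hr : ∀ x, |ρ x| ≤ 1 / 4) (hρ : MemLp ρ 2 volume)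
    (hf : MemLp f 2 volume) : MemLp (fun x => f x + ρ x * f x) 2 volume ∧
      ∀ x, |f x + ρ x * f x| ≤ 5 / 4 * |f x| := by
  have h : ∀ x, |f x + ρ x * f x| ≤ 5 / 4 * |f x| := fun x => by
    have hx := abs_le.1 (hr x)
    rw [show f x + ρ x * f x = (1 + ρ x) * f x by ring, abs_mul, abs_of_nonneg (by linarith)]
    exact mul_le_mul_of_nonneg_right (by linarith) (abs_nonneg _)
  refine ⟨(hf.const_mul (5 / 4)).mono (hf.1.add (hρ.1.mul hf.1)) (Eventually.of_forall fun x => ?_), h⟩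
  rw [Real.norm_eq_abs, Real.norm_eq_abs, abs_mul, abs_of_pos (by norm_num : (0 : ℝ) < 5 / 4)]
  exact h x

theorem abs_pairing_deriv_le (H : Flow r v p) (ht : 0 ≤ t) (hr : ∀ x, |r t x| ≤ 1 / 4)
    {f : Fin 2 → Plane → ℝ} (hf : ∀ k, TestFun₂ (f k))
    (hdiv : ∀ x, fderiv ℝ (f 0) x (basisVec 0) + fderiv ℝ (f 1) x (basisVec 1) = 0) {a b n : ℝ}
    (hb : 0 < b) (hab : b ≤ a) (hn : ∀ k, nrm (f k) ≤ n) :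
    |∑ k, ∫ x, (tderiv (fun t x => v k t x + r t x * v k t x) t x * smear a (f k) x
        - (v k t x + r t x * v k t x) * lapSmear a (f k) x)| ≤
      smearConst * n * (5 * b⁻¹ ^ 2 * sqNorm v t
        + 2 * b⁻¹ ^ 3 * nrm (r t) * Real.sqrt (sqNorm v t)) := by
  have hP := H.hasInt_pairing ht hf hdiv a
  have hm : ∀ k, Regular (fun t x => v k t x + r t x * v k t x) := fun k =>
    (H.reg_v k).add (H.reg_r.mul (H.reg_v k))
  have hL : ∀ k, HasInt (fun x => tderiv (fun t x => v k t x + r t x * v k t x) t x * smear a (f k) x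
        - (v k t x + r t x * v k t x) * lapSmear a (f k) x) _ := fun k =>
    HasInt.of_integrable ((((hm k).tderiv.memLp ht).integrable_mul ((hf k).zero.h1_smear a).memLp).sub
      (((hm k).memLp ht).integrable_mul ((hf k).memLp_lapSmear a)))
  have hsum := HasInt.sum Finset.univ fun k _ => hL k
  have hR := (hsum.sub hP).congr (G := fun x => ∑ k, ((∑ i, v i t x * (v k t x + r t x * v k t x) *
          smear a (fun x => fderiv ℝ (f k) x (basisVec i)) x)
        - r t x * v k t x * lapSmear a (f k) x)) fun x => by ring
  rw [sub_zero] at hR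
  rw [← hR.eq, ← Real.norm_eq_abs]
  have hc := smearConst_nonneg
  have hn0 : 0 ≤ n := (nrm_nonneg _).trans (hn 0)
  set S₁ := smearConst * (b⁻¹ ^ 2 * n) with hS₁
  set S₂ := smearConst * (b⁻¹ ^ 3 * n) with hS₂
  have hS₁0 : 0 ≤ S₁ := by positivity
  have hS₂0 : 0 ≤ S₂ := by positivity
  have b1 : ∀ k i x, |smear a (fun x => fderiv ℝ (f k) x (basisVec i)) x| ≤ S₁ := fun k i x =>
    ((hf k).zero.abs_smear_fderiv_le hb hab x i).trans (by have := hn k; rw [hS₁]; gcongr)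
  have b2 : ∀ k x, |lapSmear a (f k) x| ≤ S₂ := fun k x =>
    ((hf k).abs_lapSmear_le hb hab x).trans (by have := hn k; rw [hS₂]; gcongr)
  have hv := fun k => (H.reg_v k).memLp ht
  have hrL := H.reg_r.memLp ht
  have hD := fun k => (memLp_density_mul hr hrL (hv k)).2
  have hI := HasInt.sum Finset.univ fun k (_ : k ∈ Finset.univ) => (HasInt.sum Finset.univ
    fun i (_ : i ∈ Finset.univ) => (HasInt.of_integrable ((hv i).integrable_mul (hv k)).abs).const_mul
      (5 / 4 * S₁)).add ((HasInt.of_integrable (hrL.integrable_mul (hv k)).abs).const_mul S₂)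
  refine (norm_integral_le_of_norm_le hI.integrable (Eventually.of_forall fun x => ?_)).trans ?_
  · rw [Real.norm_eq_abs]
    refine (Finset.abs_sum_le_sum_abs _ _).trans (Finset.sum_le_sum fun k _ => ?_)
    refine (abs_sub _ _).trans (add_le_add ((Finset.abs_sum_le_sum_abs _ _).trans
      (Finset.sum_le_sum fun i _ => ?_)) ?_)
    · simp only [Pi.mul_apply, abs_mul]
      calc |v i t x| * |v k t x + r t x * v k t x| * |smear a (fun x => fderiv ℝ (f k) x (basisVec i)) x|
          ≤ |v i t x| * (5 / 4 * |v k t x|) * S₁ := by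
            have := hD k x; have := b1 k i x; gcongr
        _ = _ := by ring
    · simp only [Pi.mul_apply, abs_mul (_ * _), abs_mul (r t x)]
      have := b2 k x
      calc |r t x| * |v k t x| * |lapSmear a (f k) x| ≤ |r t x| * |v k t x| * S₂ := by gcongr
        _ = _ := by ring
  · rw [hI.eq]
    have hq := Real.sq_sqrt (sqNorm_nonneg v t)
    have hq0 := Real.sqrt_nonneg (sqNorm v t)
    have na := nrm_le_sqNorm v t
    set q := Real.sqrt (sqNorm v t)
    have k1 : ∀ i k, ∫ x, |(v i t * v k t) x| ≤ q ^ 2 := fun i k =>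
      (integral_abs_mul_le_nrm (hv i) (hv k)).trans (by
        rw [sq]; exact mul_le_mul (na i) (na k) (nrm_nonneg _) hq0)
    have k2 : ∀ k, ∫ x, |(r t * v k t) x| ≤ nrm (r t) * q := fun k =>
      (integral_abs_mul_le_nrm hrL (hv k)).trans (mul_le_mul_of_nonneg_left (na k) (nrm_nonneg _))
    have s1 : ∀ i k, 5 / 4 * S₁ * ∫ x, |(v i t * v k t) x| ≤ 5 / 4 * S₁ * q ^ 2 := fun i k =>
      mul_le_mul_of_nonneg_left (k1 i k) (by positivity)
    have s2 : ∀ k, S₂ * ∫ x, |(r t * v k t) x| ≤ S₂ * (nrm (r t) * q) := fun k =>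
      mul_le_mul_of_nonneg_left (k2 k) hS₂0
    simp only [Fin.sum_univ_two]
    have e : smearConst * n * (5 * b⁻¹ ^ 2 * sqNorm v t + 2 * b⁻¹ ^ 3 * nrm (r t) * q) =
        4 * (5 / 4 * S₁ * q ^ 2) + 2 * (S₂ * (nrm (r t) * q)) := by
      rw [hS₁, hS₂, hq]; ring
    rw [e]
    linarith [s1 0 0, s1 0 1, s1 1 0, s1 1 1, s2 0, s2 1]

theorem abs_integral_mul_smear_le {m f : Plane → ℝ} (hm : Continuous m) (hmL : MemLp m 2 volume)
    (hx : Integrable (fun x => ‖x‖ * |m x|)) (h0 : ∫ x, m x = 0) (hf : TestFun f) {a b : ℝ}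
    (hb : 0 < b) (hab : b ≤ a) :
    |∫ x, m x * smear a f x| ≤ 2 * (smearConst * (b⁻¹ ^ 2 * nrm f)) * ∫ x, ‖x‖ * |m x| := by
  have hmI : Integrable m := by
    have h1 : IntegrableOn m (Metric.closedBall 0 1) :=
      hm.continuousOn.integrableOn_compact (isCompact_closedBall 0 1)
    have h2 : IntegrableOn m (Metric.closedBall 0 1)ᶜ := by
      refine Integrable.mono' hx.integrableOn hm.aestronglyMeasurable ?_
      refine (ae_restrict_iff' measurableSet_closedBall.compl).2 (Eventually.of_forall fun x hxx => ?_)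
      have : 1 ≤ ‖x‖ := by
        simp only [mem_compl_iff, Metric.mem_closedBall, dist_zero_right, not_le] at hxx
        exact hxx.le
      rw [Real.norm_eq_abs]
      nlinarith [abs_nonneg (m x)]
    rw [← integrableOn_univ, ← union_compl_self (Metric.closedBall (0 : Plane) 1)]
    exact h1.union h2
  set S := smearConst * (b⁻¹ ^ 2 * nrm f)
  have hlip : ∀ x, |smear a f x - smear a f 0| ≤ 2 * S * ‖x‖ := by
    intro x
    have h := Convex.norm_image_sub_le_of_norm_fderiv_le (𝕜 := ℝ) (f := smear a f) (C := 2 * S)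
      (s := univ) (x := 0) (y := x) (fun y _ => (hf.hasFDerivAt_smear a y).differentiableAt)
      (fun y _ => by
        refine (norm_clm_le _).trans ?_
        rw [hf.fderiv_smear a, hf.fderiv_smear a]
        linarith [hf.abs_smear_fderiv_le hb hab y 0, hf.abs_smear_fderiv_le hb hab y 1])
      convex_univ (mem_univ _) (mem_univ _)
    simpa using h
  have i1 : Integrable (fun x => m x * smear a f x) := hmL.integrable_mul (hf.h1_smear a).memLp
  have e : ∫ x, m x * smear a f x = ∫ x, m x * (smear a f x - smear a f 0) := by
    simp only [mul_sub]
    rw [integral_sub i1 (hmI.mul_const _), integral_mul_const, h0, zero_mul, sub_zero]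
  rw [e, ← integral_const_mul, ← Real.norm_eq_abs]
  refine norm_integral_le_of_norm_le (hx.const_mul _) (Eventually.of_forall fun x => ?_)
  rw [norm_mul, Real.norm_eq_abs, Real.norm_eq_abs]
  nlinarith [mul_le_mul_of_nonneg_left (hlip x) (abs_nonneg (m x))]

/-- The low-frequency estimate: the velocity at time `t` is controlled at every scale `b` by its
gradient, the first moment of the initial data, and the history of the flow. -/
theorem sqNorm_le (H : Flow r v p) (hr0 : ∀ x, |r 0 x| ≤ 1 / 4)
    (hx : ∀ k, Integrable (fun x => ‖x‖ * |v k 0 x|))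
    (hmean : ∀ k, ∫ x, (v k 0 x + r 0 x * v k 0 x) = 0) (ht : 0 ≤ t) {b : ℝ} (hb : 0 < b) :
    sqNorm v t ≤ (2 + 150 * smearConst ^ 2) * (b ^ 2 * dirichlet v t
      + b⁻¹ ^ 4 * (∑ k, ∫ x, ‖x‖ * |v k 0 x|) ^ 2 + b⁻¹ ^ 4 * (∫ s in (0 : ℝ)..t, sqNorm v s) ^ 2
      + b⁻¹ ^ 6 * (∫ x, r 0 x * r 0 x) * (t * ∫ s in (0 : ℝ)..t, sqNorm v s)) := by
  have hr : ∀ s, 0 ≤ s → ∀ x, |r s x| ≤ 1 / 4 := fun s hs x =>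
    H.abs_le_of_initial (by norm_num) hr0 hs x
  have hm : ∀ k, Regular (fun t x => v k t x + r t x * v k t x) := fun k =>
    (H.reg_v k).add (H.reg_r.mul (H.reg_v k))
  have hf : ∀ k, TestFun₂ (v k t) := fun k => (H.reg_v k).testFun₂ ht
  set n := Real.sqrt (sqNorm v t) with hn
  have hn2 : n ^ 2 = sqNorm v t := Real.sq_sqrt (sqNorm_nonneg v t)
  have hn0 : 0 ≤ n := Real.sqrt_nonneg _
  have hnk := nrm_le_sqNorm v t
  set R := nrm (r 0) with hR
  have hRs : ∀ s, 0 ≤ s → nrm (r s) = R := fun s hs => by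
    have := H.integral_sq_of_transport H.reg_r (fun t ht x => H.mass' ht x) hs
    rw [hR, nrm, nrm]; simp only [sq, this]
  set U := ∑ k, ∫ x, ‖x‖ * |v k 0 x| with hU
  set A := ∫ s in (0 : ℝ)..t, sqNorm v s with hA
  set Q := ∫ s in (0 : ℝ)..t, Real.sqrt (sqNorm v s) with hQ
  have hc := smearConst_nonneg
  set c := smearConst with hcdef
  have hsub : Icc 0 t ⊆ Ici 0 := fun t ht => ht.1
  have hqc : ContinuousOn (sqNorm v) (Icc 0 t) := (continuousOn_sqNorm H.reg_v).mono hsub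
  have hCS : Q ^ 2 ≤ t * A := sq_intervalIntegral_sqrt_le ht hqc fun s _ => sqNorm_nonneg v s
  have h1 : sqNorm v t - ∑ k, ∫ x, v k t x * smear b (v k t) x ≤ b ^ 2 * dirichlet v t := by
    have h := fun k => (hf k).sub_integral_mul_smear_le hb.le
    have := Finset.sum_le_sum fun k (_ : k ∈ Finset.univ) => h k
    rw [Finset.sum_sub_distrib, ← Finset.mul_sum] at this
    simpa only [sqNorm, dirichlet, dx, sq (v _ t _)] using this
  have h2 : ∑ k, ∫ x, v k t x * smear b (v k t) x ≤
      (∑ k, ∫ x, (v k t x + r t x * v k t x) * smear b (v k t) x) + n ^ 2 / 4 := by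
    have h : ∀ k, ∫ x, v k t x * smear b (v k t) x ≤
        (∫ x, (v k t x + r t x * v k t x) * smear b (v k t) x) + (∫ x, v k t x ^ 2) / 4 := by
      intro k
      have mv := (H.reg_v k).memLp ht
      have ms := ((hf k).zero.h1_smear b).memLp
      have i1 : Integrable (fun x => v k t x * smear b (v k t) x) := mv.integrable_mul ms
      have i2 : Integrable (fun x => (v k t x + r t x * v k t x) * smear b (v k t) x) :=
        ((hm k).memLp ht).integrable_mul ms
      have i3 : Integrable (fun x => |v k t x * smear b (v k t) x|) := i1.abs
      have h3 : ∫ x, v k t x * smear b (v k t) x ≤ ∫ x, ((v k t x + r t x * v k t x) *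
          smear b (v k t) x + 1 / 4 * |v k t x * smear b (v k t) x|) := by
        refine integral_mono i1 (i2.add (i3.const_mul _)) fun x => ?_
        have h4 : |r t x * (v k t x * smear b (v k t) x)| ≤ 1 / 4 * |v k t x * smear b (v k t) x| := by
          rw [abs_mul]; exact mul_le_mul_of_nonneg_right (hr t ht x) (abs_nonneg _)
        have := (abs_le.1 h4).1
        beta_reduce
        linarith
      rw [integral_add i2 (i3.const_mul _), integral_const_mul] at h3
      have h5 := integral_abs_mul_le_nrm mv ms
      have h6 := mul_le_mul_of_nonneg_left (nrm_smear_le (hf k).zero.contDiff.continuous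
        (hf k).zero.bdd mv b) (nrm_nonneg (v k t))
      rw [← sq, nrm_sq] at h6
      linarith
    have := Finset.sum_le_sum fun k (_ : k ∈ Finset.univ) => h k
    rw [Finset.sum_add_distrib, ← Finset.sum_div] at this
    rw [hn2]
    exact this
  have h3 : (∑ k, ∫ x, (v k t x + r t x * v k t x) * smear b (v k t) x) ≤
      (∑ k, ∫ x, (v k 0 x + r 0 x * v k 0 x) * smear (scale b t 0) (v k t) x) +
        c * n * (5 * b⁻¹ ^ 2 * A + 2 * b⁻¹ ^ 3 * R * Q) := by
    have e := fun k => (hm k).integral_mul_smear_sub (hf k) hb ht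
    have ii := fun k => (hm k).intervalIntegrable_mul_smear_deriv (hf k) b ht
    have hs := Finset.sum_congr rfl fun k (_ : k ∈ Finset.univ) => e k
    rw [Finset.sum_sub_distrib, ← intervalIntegral.integral_finsetSum fun k _ => ii k] at hs
    rw [← sub_le_iff_le_add', hs]
    have iq := hqc.intervalIntegrable_of_Icc (μ := volume) ht
    have iq2 := hqc.sqrt.intervalIntegrable_of_Icc (μ := volume) ht
    have hval : ∫ s in (0 : ℝ)..t, c * n * (5 * b⁻¹ ^ 2 * sqNorm v s + 2 * b⁻¹ ^ 3 * R *
        Real.sqrt (sqNorm v s)) = c * n * (5 * b⁻¹ ^ 2 * A + 2 * b⁻¹ ^ 3 * R * Q) := by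
      rw [intervalIntegral.integral_const_mul, intervalIntegral.integral_add (iq.const_mul _)
        (iq2.const_mul _), intervalIntegral.integral_const_mul, intervalIntegral.integral_const_mul]
    rw [← hval]
    refine intervalIntegral.integral_mono_on ht (by
      simpa only [Finset.sum_fn] using IntervalIntegrable.sum Finset.univ fun k _ => ii k)
      (((iq.const_mul _).add (iq2.const_mul _)).const_mul _) fun s hs => ?_
    have := H.abs_pairing_deriv_le hs.1 (hr s hs.1) hf (H.div t ht) hb (le_scale hs.2) hnk
    rw [hRs s hs.1] at this
    exact (le_abs_self _).trans this
  have h4 : (∑ k, ∫ x, (v k 0 x + r 0 x * v k 0 x) * smear (scale b t 0) (v k t) x) ≤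
      5 / 2 * (c * (b⁻¹ ^ 2 * n)) * U := by
    rw [hU, Finset.mul_sum]
    refine Finset.sum_le_sum fun k _ => ?_
    have hD := (memLp_density_mul hr0 (H.reg_r.memLp le_rfl) ((H.reg_v k).memLp le_rfl)).2
    have hcm : Continuous (fun x => v k 0 x + r 0 x * v k 0 x) := ((hm k).h1 le_rfl).contDiff.continuous
    have hxm : Integrable (fun x => ‖x‖ * |v k 0 x + r 0 x * v k 0 x|) := by
      refine ((hx k).const_mul (5 / 4)).mono' (Continuous.aestronglyMeasurable (by fun_prop))
        (Eventually.of_forall fun x => ?_)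
      rw [norm_mul, norm_norm, Real.norm_eq_abs, abs_abs]
      nlinarith [mul_le_mul_of_nonneg_left (hD x) (norm_nonneg x)]
    have h := abs_integral_mul_smear_le hcm ((hm k).memLp le_rfl) hxm (hmean k) (hf k).zero hb
      (le_scale (b := b) (t := t) ht)
    refine (le_abs_self _).trans (h.trans ?_)
    have h5 : ∫ x, ‖x‖ * |v k 0 x + r 0 x * v k 0 x| ≤ 5 / 4 * ∫ x, ‖x‖ * |v k 0 x| := by
      rw [← integral_const_mul]
      refine integral_mono hxm ((hx k).const_mul _) fun x => ?_
      have := mul_le_mul_of_nonneg_left (hD x) (norm_nonneg x)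
      beta_reduce
      linarith
    have h6 := hnk k
    have h7 : 0 ≤ ∫ x, ‖x‖ * |v k 0 x| := integral_nonneg fun x => by positivity
    have h8 := nrm_nonneg (v k t)
    calc _ ≤ 2 * (c * (b⁻¹ ^ 2 * n)) * (5 / 4 * ∫ x, ‖x‖ * |v k 0 x|) := by
          refine mul_le_mul (by gcongr) h5 (integral_nonneg fun x => by positivity) (by positivity)
      _ = _ := by ring
  have hR2 : R ^ 2 = ∫ x, r 0 x * r 0 x := nrm_sq' _
  have hA0 : 0 ≤ A := intervalIntegral.integral_nonneg ht fun s _ => sqNorm_nonneg v s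
  set J₁ := c * b⁻¹ ^ 2 * U with hJ₁
  set J₂ := c * b⁻¹ ^ 2 * A with hJ₂
  set J₃ := c * b⁻¹ ^ 3 * R * Q with hJ₃
  have h5 : 3 / 4 * n ^ 2 ≤ b ^ 2 * dirichlet v t + n * (5 / 2 * J₁ + 5 * J₂ + 2 * J₃) := by
    rw [← hn2] at h1
    have : n * (5 / 2 * J₁ + 5 * J₂ + 2 * J₃) = 5 / 2 * (c * (b⁻¹ ^ 2 * n)) * U +
      c * n * (5 * b⁻¹ ^ 2 * A + 2 * b⁻¹ ^ 3 * R * Q) := by rw [hJ₁, hJ₂, hJ₃]; ring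
    linarith
  have h6 : n ^ 2 ≤ 2 * (b ^ 2 * dirichlet v t) + 150 * (J₁ ^ 2 + J₂ ^ 2 + J₃ ^ 2) := by
    nlinarith [sq_nonneg (n / 2 - (5 / 2 * J₁ + 5 * J₂ + 2 * J₃)), sq_nonneg (J₁ - J₂),
      sq_nonneg (J₁ - J₃), sq_nonneg (J₂ - J₃), sq_nonneg J₁, sq_nonneg J₂, sq_nonneg J₃]
  have h7 : J₃ ^ 2 ≤ c ^ 2 * (b⁻¹ ^ 6 * R ^ 2 * (t * A)) := by
    have : J₃ ^ 2 = c ^ 2 * (b⁻¹ ^ 6 * R ^ 2 * Q ^ 2) := by rw [hJ₃]; ring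
    rw [this]; gcongr
  have hZ := dirichlet_nonneg v t
  have n1 : 0 ≤ c ^ 2 * (b ^ 2 * dirichlet v t) := by positivity
  have n2 : 0 ≤ b⁻¹ ^ 4 * U ^ 2 := by positivity
  have n3 : 0 ≤ b⁻¹ ^ 4 * A ^ 2 := by positivity
  have n4 : 0 ≤ b⁻¹ ^ 6 * R ^ 2 * (t * A) := by positivity
  have e1 : J₁ ^ 2 = c ^ 2 * (b⁻¹ ^ 4 * U ^ 2) := by rw [hJ₁]; ring
  have e2 : J₂ ^ 2 = c ^ 2 * (b⁻¹ ^ 4 * A ^ 2) := by rw [hJ₂]; ring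
  rw [← hn2, ← hR2]
  rw [e1, e2] at h6
  linarith

end Flow

section Decay

theorem antitoneOn_Icc_of_hasDerivAt {f f' : ℝ → ℝ} {a b : ℝ} (hc : ContinuousOn f (Icc a b))
    (hd : ∀ t ∈ Ioo a b, HasDerivAt f (f' t) t) (hf : ∀ t ∈ Ioo a b, f' t ≤ 0) :
    AntitoneOn f (Icc a b) := by
  refine antitoneOn_of_deriv_nonpos (convex_Icc a b) hc ?_ ?_ <;> rw [interior_Icc]
  · exact fun t ht => (hd t ht).differentiableAt.differentiableWithinAt
  · exact fun t ht => (hd t ht).deriv ▸ hf t ht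

/-- A nonincreasing energy `y` with dissipation `Z`, subject to the low-frequency inequality. -/
structure LowFreq (K E T : ℝ) (y Z : ℝ → ℝ) : Prop where
  cont : ContinuousOn y (Ici 0)
  deriv : ∀ t, 0 < t → HasDerivAt y (-2 * Z t) t
  start : y 0 = E
  nonneg : ∀ t, 0 ≤ t → 0 ≤ y t
  nonneg' : ∀ t, 0 ≤ t → 0 ≤ Z t
  le : ∀ t, 0 ≤ t → ∀ τ, 0 < τ → y t ≤ K * (τ * Z t + τ⁻¹ ^ 2 * (T ^ 2 * E ^ 2 +
    (∫ s in (0 : ℝ)..t, y s) ^ 2) + τ⁻¹ ^ 3 * (T * t * ∫ s in (0 : ℝ)..t, y s))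

namespace LowFreq

variable {K E T : ℝ} {y Z : ℝ → ℝ}

theorem antitone (h : LowFreq K E T y Z) {s t : ℝ} (hs : 0 ≤ s) (hst : s ≤ t) : y t ≤ y s :=
  antitoneOn_Icc_of_hasDerivAt (h.cont.mono fun _ hx => hs.trans hx.1)
    (fun x hx => h.deriv x (hs.trans_lt hx.1))
    (fun x hx => by have := h.nonneg' x (hs.trans hx.1.le); linarith)
    (left_mem_Icc.2 hst) (right_mem_Icc.2 hst) hst

theorem le_init (h : LowFreq K E T y Z) {t : ℝ} (ht : 0 ≤ t) : y t ≤ E :=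
  h.start ▸ h.antitone le_rfl ht

theorem intervalIntegrable (h : LowFreq K E T y Z) {a b : ℝ} (ha : 0 ≤ a) (hab : a ≤ b) :
    IntervalIntegrable y volume a b :=
  (h.cont.mono fun _ hx => ha.trans hx.1).intervalIntegrable_of_Icc hab

theorem integral_nonneg (h : LowFreq K E T y Z) {a b : ℝ} (ha : 0 ≤ a) (hab : a ≤ b) :
    0 ≤ ∫ s in a..b, y s :=
  intervalIntegral.integral_nonneg hab fun s hs => h.nonneg s (ha.trans hs.1)

theorem integral_le (h : LowFreq K E T y Z) {t : ℝ} (ht : 0 ≤ t) :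
    ∫ s in (0 : ℝ)..t, y s ≤ t * E := by
  have := intervalIntegral.integral_mono_on ht (h.intervalIntegrable le_rfl ht)
    (intervalIntegrable_const (c := E)) fun s hs => h.le_init hs.1
  simpa using this

theorem integral_mono (h : LowFreq K E T y Z) {s t : ℝ} (hs : 0 ≤ s) (hst : s ≤ t) :
    ∫ x in (0 : ℝ)..s, y x ≤ ∫ x in (0 : ℝ)..t, y x := by
  rw [← intervalIntegral.integral_add_adjacent_intervals (h.intervalIntegrable le_rfl hs)
    (h.intervalIntegrable hs hst)]
  linarith [h.integral_nonneg hs hst]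

theorem exists_mul_le (h : LowFreq K E T y Z) {a : ℝ} (ha : 0 < a) :
    ∃ s ∈ Ioo a (2 * a), s * Z s ≤ y a - y (2 * a) := by
  obtain ⟨s, hs, he⟩ := exists_hasDerivAt_eq_slope y (fun s => -2 * Z s) (by linarith : a < 2 * a)
    (h.cont.mono fun _ hx => ha.le.trans hx.1) fun x hx => h.deriv x (ha.trans hx.1)
  refine ⟨s, hs, ?_⟩
  have h1 : -2 * Z s * a = y (2 * a) - y a := by
    rw [he]; field_simp; ring
  have h2 : s * Z s ≤ 2 * a * Z s :=
    mul_le_mul_of_nonneg_right hs.2.le (h.nonneg' s (ha.le.trans hs.1.le))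
  linarith

/-- The energy becomes small after a number of dyadic steps that depends only on its size. -/
theorem exists_small (K M ε : ℝ) (hK : 1 ≤ K) (hM : 0 ≤ M) (hε : 0 < ε) :
    ∃ N : ℕ, ∀ (E T : ℝ) (y Z : ℝ → ℝ), 0 < T → E ≤ M → LowFreq K E T y Z → y (2 ^ N * T) ≤ ε := by
  set Λ := 1 + 2 * K * (2 * M ^ 2 + M) / ε with hΛ
  have hΛ1 : 1 ≤ Λ := by rw [hΛ]; exact le_add_of_nonneg_right (by positivity)
  obtain ⟨N, hN⟩ := exists_nat_gt (2 * K * (Λ * M) / ε)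
  have hN0 : (0 : ℝ) < N := lt_of_le_of_lt (by positivity) hN
  refine ⟨N, fun E T y Z hT hE h => ?_⟩
  have hE0 : 0 ≤ E := h.start ▸ h.nonneg 0 le_rfl
  have hNpos : 0 < N := by exact_mod_cast hN0
  obtain ⟨j, hj, hd⟩ : ∃ j ∈ Finset.range N, y (2 ^ j * T) - y (2 ^ (j + 1) * T) ≤ E / N := by
    refine Finset.exists_le_of_sum_le ⟨0, Finset.mem_range.2 hNpos⟩ ?_
    rw [Finset.sum_range_sub' (fun j => y (2 ^ j * T)), Finset.sum_const, Finset.card_range,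
      nsmul_eq_mul, mul_div_cancel₀ _ hN0.ne']
    have h1 := h.nonneg (2 ^ N * T) (by positivity)
    have h2 := h.le_init (t := 2 ^ 0 * T) (by positivity)
    linarith
  have ha : 0 < 2 ^ j * T := by positivity
  obtain ⟨s, hs, hsZ⟩ := h.exists_mul_le ha
  have e2 : 2 * (2 ^ j * T) = 2 ^ (j + 1) * T := by ring
  rw [e2] at hs hsZ
  have hs0 : 0 < s := ha.trans hs.1
  have hTs : T ≤ s := by
    have : (1 : ℝ) ≤ 2 ^ j := one_le_pow₀ (by norm_num)
    nlinarith [hs.1]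
  have hsN : s ≤ 2 ^ N * T := by
    refine hs.2.le.trans (mul_le_mul_of_nonneg_right ?_ hT.le)
    exact pow_le_pow_right₀ (by norm_num) (Finset.mem_range.1 hj)
  refine (h.antitone hs0.le hsN).trans ((h.le s hs0.le (Λ * s) (by positivity)).trans ?_)
  have hA := h.integral_le hs0.le
  have hA0 := h.integral_nonneg le_rfl hs0.le
  set A := ∫ x in (0 : ℝ)..s, y x
  have hΛ0 : 0 < Λ := by linarith
  have t1 : Λ * s * Z s ≤ Λ * M / N := by
    have h1 : s * Z s ≤ M / N := hsZ.trans (hd.trans (by gcongr))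
    calc Λ * s * Z s = Λ * (s * Z s) := by ring
      _ ≤ Λ * (M / N) := by gcongr
      _ = _ := by ring
  have hi : Λ⁻¹ ≤ 1 := inv_le_one_of_one_le₀ hΛ1
  have hi0 : 0 < Λ⁻¹ := inv_pos.2 hΛ0
  have t2 : (Λ * s)⁻¹ ^ 2 * (T ^ 2 * E ^ 2 + A ^ 2) ≤ 2 * M ^ 2 * Λ⁻¹ := by
    have h1 : T ^ 2 * E ^ 2 + A ^ 2 ≤ s ^ 2 * (2 * M ^ 2) := by
      have h2 : T ^ 2 * E ^ 2 ≤ s ^ 2 * M ^ 2 := by gcongr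
      have h3 : A ^ 2 ≤ (s * M) ^ 2 := by
        have : A ≤ s * M := hA.trans (by gcongr)
        gcongr
      linarith [mul_pow s M 2]
    calc _ ≤ (Λ * s)⁻¹ ^ 2 * (s ^ 2 * (2 * M ^ 2)) := by gcongr
      _ = 2 * M ^ 2 * (Λ⁻¹ * Λ⁻¹) := by field_simp
      _ ≤ 2 * M ^ 2 * (Λ⁻¹ * 1) := by gcongr
      _ = _ := by ring
  have t3 : (Λ * s)⁻¹ ^ 3 * (T * s * A) ≤ M * Λ⁻¹ := by
    have h1 : T * s * A ≤ s ^ 3 * M := by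
      calc T * s * A ≤ s * s * (s * E) := by gcongr
        _ ≤ s * s * (s * M) := by gcongr
        _ = _ := by ring
    calc _ ≤ (Λ * s)⁻¹ ^ 3 * (s ^ 3 * M) := by gcongr
      _ = M * (Λ⁻¹ * (Λ⁻¹ * Λ⁻¹)) := by field_simp
      _ ≤ M * (Λ⁻¹ * (1 * 1)) := by gcongr
      _ = _ := by ring
  have u1 : K * (Λ * M / N) ≤ ε / 2 := by
    rw [div_lt_iff₀ hε] at hN
    rw [← mul_div_assoc, div_le_iff₀ hN0]
    linarith
  have u2 : K * ((2 * M ^ 2 + M) * Λ⁻¹) ≤ ε / 2 := by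
    have : 2 * K * (2 * M ^ 2 + M) ≤ ε * Λ := by
      rw [hΛ, mul_add ε 1, mul_div_cancel₀ _ hε.ne']; linarith
    rw [← mul_assoc, ← div_eq_mul_inv, div_le_iff₀ hΛ0]
    linarith
  have hsum := mul_le_mul_of_nonneg_left (add_le_add (add_le_add t1 t2) t3) (by linarith : 0 ≤ K)
  have e3 : K * (Λ * M / N + 2 * M ^ 2 * Λ⁻¹ + M * Λ⁻¹) =
      K * (Λ * M / N) + K * ((2 * M ^ 2 + M) * Λ⁻¹) := by ring
  linarith

theorem sq_mul_le (hK : 1 ≤ K) (hT : 0 < T) (h : LowFreq K E T y Z) {t₀ s H : ℝ} (ht₀ : 0 < t₀)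
    (hs : s ∈ Icc t₀ H) :
    s ^ 2 * y s ≤ 16 * K ^ 4 * (T ^ 2 * E ^ 2 + (∫ x in (0 : ℝ)..H, y x) ^ 2
      + T * ∫ x in (0 : ℝ)..H, y x) + t₀ ^ 2 * y t₀ := by
  have hs0 : 0 < s := ht₀.trans_le hs.1
  have hA0 := h.integral_nonneg le_rfl (hs0.le.trans hs.2)
  set A := ∫ x in (0 : ℝ)..H, y x
  set P := T ^ 2 * E ^ 2 + A ^ 2 + T * A with hP
  have hP0 : 0 ≤ P := by positivity
  have hanti : AntitoneOn (fun t => t ^ 4 * y t - 16 * K ^ 4 * P * t ^ 2) (Icc t₀ s) := by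
    refine antitoneOn_Icc_of_hasDerivAt
      (f' := fun t => (4 * t ^ 3 * y t + t ^ 4 * (-2 * Z t)) - 16 * K ^ 4 * P * (2 * t)) ?_ ?_ ?_
    · have := h.cont.mono (fun _ hx => ht₀.le.trans hx.1 : Icc t₀ s ⊆ Ici 0)
      fun_prop
    · intro t ht
      have h1 := ((hasDerivAt_pow 4 t).mul (h.deriv t (ht₀.trans ht.1))).sub
        ((hasDerivAt_pow 2 t).const_mul (16 * K ^ 4 * P))
      exact h1.congr_deriv (by norm_num)
    · intro t ht
      have ht0 : 0 < t := ht₀.trans ht.1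
      have hK0 : 0 < K := by linarith
      have h1 := h.le t ht0.le (t / (2 * K)) (by positivity)
      have hB := h.integral_mono ht0.le (ht.2.le.trans hs.2)
      have hB0 := h.integral_nonneg le_rfl ht0.le
      set B := ∫ x in (0 : ℝ)..t, y x
      have h2 : T ^ 2 * E ^ 2 + B ^ 2 ≤ T ^ 2 * E ^ 2 + A ^ 2 := by gcongr
      have h3 : T * t * B ≤ T * t * A := by gcongr
      have h4 : 4 * t ^ 3 * y t ≤ 4 * t ^ 3 * (K * (t / (2 * K) * Z t + (t / (2 * K))⁻¹ ^ 2 *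
          (T ^ 2 * E ^ 2 + A ^ 2) + (t / (2 * K))⁻¹ ^ 3 * (T * t * A))) := by
        refine mul_le_mul_of_nonneg_left (h1.trans ?_) (by positivity)
        gcongr
      have h5 : 4 * t ^ 3 * (K * (t / (2 * K) * Z t + (t / (2 * K))⁻¹ ^ 2 *
          (T ^ 2 * E ^ 2 + A ^ 2) + (t / (2 * K))⁻¹ ^ 3 * (T * t * A))) =
          2 * t ^ 4 * Z t + t * (16 * K ^ 3 * (T ^ 2 * E ^ 2 + A ^ 2) + 32 * K ^ 4 * (T * A)) := by
        field_simp
        ring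
      have h6 : 16 * K ^ 3 * (T ^ 2 * E ^ 2 + A ^ 2) ≤ 32 * K ^ 4 * (T ^ 2 * E ^ 2 + A ^ 2) := by
        refine mul_le_mul_of_nonneg_right ?_ (by positivity)
        have : K ^ 3 ≤ K ^ 4 := pow_le_pow_right₀ hK (by norm_num)
        have : 0 ≤ K ^ 4 := by positivity
        linarith
      have h7 := mul_le_mul_of_nonneg_left h6 ht0.le
      rw [hP]
      linarith
  have h1 := hanti (left_mem_Icc.2 hs.1) (right_mem_Icc.2 hs.1) hs.1
  simp only at h1
  have hy := h.nonneg t₀ ht₀.le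
  have hC : 0 ≤ 16 * K ^ 4 * P := by positivity
  have h2 : s ^ 2 * (s ^ 2 * y s) ≤ s ^ 2 * (16 * K ^ 4 * P + t₀ ^ 2 * y t₀) := by
    have h3 : t₀ ^ 2 * (t₀ ^ 2 * y t₀) ≤ s ^ 2 * (t₀ ^ 2 * y t₀) := by
      have := hs.1; gcongr
    have h4 : 0 ≤ 16 * K ^ 4 * P * t₀ ^ 2 := by positivity
    linarith
  exact le_of_mul_le_mul_left h2 (by positivity)

theorem integral_le_of_bounds (h : LowFreq K E T y Z) {t₀ H e m : ℝ} (ht₀ : 0 < t₀) (hH : t₀ ≤ H)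
    (he : 0 < e) (hm : 0 < m) (h1 : ∀ s ∈ Icc t₀ H, y s ≤ e ^ 2)
    (h2 : ∀ s ∈ Icc t₀ H, s ^ 2 * y s ≤ m ^ 2) :
    ∫ x in (0 : ℝ)..H, y x ≤ t₀ * E + 4 * (e * m) := by
  rw [← intervalIntegral.integral_add_adjacent_intervals (h.intervalIntegrable le_rfl ht₀.le)
    (h.intervalIntegrable ht₀.le hH)]
  refine add_le_add (h.integral_le ht₀.le) ?_
  set l := m / e with hl
  have hl0 : 0 < l := by positivity
  have hmle : m = l * e := by rw [hl]; field_simp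
  have hcont : ContinuousOn (fun s : ℝ => 4 * m ^ 2 / (s + l) ^ 2) (Icc t₀ H) := by
    refine ContinuousOn.div (by fun_prop) (by fun_prop) fun s hs => ?_
    have := ht₀.trans_le hs.1
    positivity
  have hi := hcont.intervalIntegrable_of_Icc (μ := volume) hH
  have hle : ∫ x in t₀..H, y x ≤ ∫ s in t₀..H, 4 * m ^ 2 / (s + l) ^ 2 := by
    refine intervalIntegral.integral_mono_on hH (h.intervalIntegrable ht₀.le hH) hi fun s hs => ?_
    have hs0 : 0 < s := ht₀.trans_le hs.1
    have hy := h.nonneg s hs0.le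
    rw [le_div_iff₀ (by positivity)]
    rcases le_total s l with hsl | hsl
    · have : (s + l) ^ 2 ≤ (2 * l) ^ 2 := by gcongr; linarith
      calc y s * (s + l) ^ 2 ≤ e ^ 2 * (2 * l) ^ 2 := mul_le_mul (h1 s hs) this (by positivity) (by positivity)
        _ = _ := by rw [hmle]; ring
    · have : (s + l) ^ 2 ≤ (2 * s) ^ 2 := by gcongr; linarith
      calc y s * (s + l) ^ 2 ≤ y s * (2 * s) ^ 2 := by gcongr
        _ = 4 * (s ^ 2 * y s) := by ring
        _ ≤ _ := by linarith [h2 s hs]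
  have hval : ∫ s in t₀..H, 4 * m ^ 2 / (s + l) ^ 2 = -(4 * m ^ 2) / (H + l) - -(4 * m ^ 2) / (t₀ + l) := by
    refine intervalIntegral.integral_eq_sub_of_hasDerivAt (f := fun s => -(4 * m ^ 2) / (s + l))
      (fun s hs => ?_) hi
    rw [uIcc_of_le hH] at hs
    have hs0 : 0 < s + l := by have := ht₀.trans_le hs.1; positivity
    have := (hasDerivAt_const s (-(4 * m ^ 2))).div ((hasDerivAt_id s).add_const l) hs0.ne'
    refine this.congr_deriv ?_
    simp only [id]
    ring
  rw [hval] at hle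
  have h3 : 0 ≤ 4 * m ^ 2 / (H + l) := by have : 0 < H := ht₀.trans_le hH; positivity
  have h4 : 4 * m ^ 2 / (t₀ + l) ≤ 4 * m ^ 2 / l := by gcongr; linarith
  have h5 : 4 * m ^ 2 / l = 4 * (e * m) := by rw [hl]; field_simp
  simp only [neg_div] at hle
  linarith

theorem exists_decay (K M : ℝ) (hK : 1 ≤ K) (hM : 0 ≤ M) :
    ∃ L, 0 ≤ L ∧ ∀ (E T : ℝ) (y Z : ℝ → ℝ), 0 < T → E ≤ M → LowFreq K E T y Z →
      ∀ t, 0 < t → t ^ 2 * y t ≤ L * (E * T ^ 2) := by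
  set C := 16 * K ^ 4 with hC
  have hC0 : 0 < C := by positivity
  obtain ⟨N, hN⟩ := exists_small K M (1 / (128 * C)) hK hM (by positivity)
  set q : ℝ := 2 ^ N with hq
  have hq1 : 1 ≤ q := one_le_pow₀ (by norm_num)
  refine ⟨2 * (C * (M + 2 * q ^ 2 * M + q) + 16 * C ^ 2 + q ^ 2), by positivity, ?_⟩
  intro E T y Z hT hE h t ht
  have hE0 : 0 ≤ E := h.start ▸ h.nonneg 0 le_rfl
  set L := 2 * (C * (M + 2 * q ^ 2 * M + q) + 16 * C ^ 2 + q ^ 2) with hL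
  have hLq : q ^ 2 ≤ L := by
    have : 0 ≤ C * (M + 2 * q ^ 2 * M + q) + 16 * C ^ 2 := by positivity
    nlinarith [sq_nonneg q]
  set t₀ := q * T with ht₀
  have ht₀0 : 0 < t₀ := by positivity
  have hsmall : y t₀ ≤ 1 / (128 * C) := hN E T y Z hT hE h
  have htriv : t₀ ^ 2 * E ≤ L * (E * T ^ 2) := by
    calc t₀ ^ 2 * E = q ^ 2 * (E * T ^ 2) := by rw [ht₀]; ring
      _ ≤ _ := by gcongr
  rcases le_total t t₀ with htt | htt
  · refine le_trans ?_ htriv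
    have := h.le_init ht.le
    have := h.nonneg t ht.le
    gcongr
  obtain ⟨s, hs, hmax⟩ := isCompact_Icc.exists_isMaxOn (f := fun s => s ^ 2 * y s)
    (s := Icc t₀ t) ⟨t₀, left_mem_Icc.2 htt⟩ (by
      have := h.cont.mono (fun _ hx => ht₀0.le.trans hx.1 : Icc t₀ t ⊆ Ici 0)
      fun_prop)
  have hs0 : 0 < s := ht₀0.trans_le hs.1
  refine (hmax (right_mem_Icc.2 htt)).trans ?_
  change s ^ 2 * y s ≤ _
  rcases (mul_nonneg (sq_nonneg s) (h.nonneg s hs0.le)).eq_or_lt with hz | hpos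
  · rw [← hz]; positivity
  have hEpos : 0 < E := by
    have h1 := h.le_init hs0.le
    have : 0 < y s := pos_of_mul_pos_right hpos (sq_nonneg s)
    linarith
  set ε := min (1 / (128 * C)) E with hε
  have hε0 : 0 < ε := lt_min (by positivity) hEpos
  set e := Real.sqrt ε with he
  set m := Real.sqrt (s ^ 2 * y s) with hm
  have he2 : e ^ 2 = ε := Real.sq_sqrt hε0.le
  have hm2 : m ^ 2 = s ^ 2 * y s := Real.sq_sqrt hpos.le
  have he0 : 0 < e := Real.sqrt_pos.2 hε0
  have hm0 : 0 < m := Real.sqrt_pos.2 hpos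
  have hA := h.integral_le_of_bounds ht₀0 htt he0 hm0
    (fun x hx => by
      rw [he2]
      exact le_min ((h.antitone ht₀0.le hx.1).trans hsmall) (h.le_init (ht₀0.le.trans hx.1)))
    (fun x hx => by rw [hm2]; exact hmax hx)
  have hA0 := h.integral_nonneg le_rfl ht.le
  have key := h.sq_mul_le hK hT ht₀0 hs
  set A := ∫ x in (0 : ℝ)..t, y x
  rw [← hm2] at key ⊢
  rw [← hC] at key
  have k1 : A ^ 2 ≤ 2 * t₀ ^ 2 * E ^ 2 + 32 * (e ^ 2 * m ^ 2) := by
    have : A ^ 2 ≤ (t₀ * E + 4 * (e * m)) ^ 2 := by gcongr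
    nlinarith [sq_nonneg (t₀ * E - 4 * (e * m))]
  have k2 : T * A ≤ T * (t₀ * E) + 4 * (T * (e * m)) := by
    have := mul_le_mul_of_nonneg_left hA hT.le
    linarith
  have k3 : C * (32 * (e ^ 2 * m ^ 2)) ≤ m ^ 2 / 4 := by
    have h1 : e ^ 2 ≤ 1 / (128 * C) := he2 ▸ min_le_left _ _
    calc C * (32 * (e ^ 2 * m ^ 2)) ≤ C * (32 * (1 / (128 * C) * m ^ 2)) := by gcongr
      _ = _ := by field_simp; norm_num
  have k4 : C * (4 * (T * (e * m))) ≤ m ^ 2 / 4 + 16 * C ^ 2 * (E * T ^ 2) := by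
    have h1 : e ^ 2 ≤ E := he2 ▸ min_le_right _ _
    have h2 : 16 * C ^ 2 * (e ^ 2 * T ^ 2) ≤ 16 * C ^ 2 * (E * T ^ 2) := by gcongr
    nlinarith [sq_nonneg (m / 2 - 4 * C * T * e)]
  have k5 : t₀ ^ 2 * y t₀ ≤ q ^ 2 * (E * T ^ 2) := by
    have := h.le_init ht₀0.le
    calc t₀ ^ 2 * y t₀ ≤ t₀ ^ 2 * E := by gcongr
      _ = _ := by rw [ht₀]; ring
  have k6 : T ^ 2 * E ^ 2 ≤ M * (E * T ^ 2) := by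
    calc T ^ 2 * E ^ 2 = E * (E * T ^ 2) := by ring
      _ ≤ _ := by gcongr
  have k7 : 2 * t₀ ^ 2 * E ^ 2 ≤ 2 * q ^ 2 * M * (E * T ^ 2) := by
    calc 2 * t₀ ^ 2 * E ^ 2 = 2 * q ^ 2 * (T ^ 2 * E ^ 2) := by rw [ht₀]; ring
      _ ≤ 2 * q ^ 2 * (M * (E * T ^ 2)) := by gcongr
      _ = _ := by ring
  have k8 : T * (t₀ * E) = q * (E * T ^ 2) := by rw [ht₀]; ring
  have k9 : C * (T ^ 2 * E ^ 2 + A ^ 2 + T * A) ≤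
      C * ((M + 2 * q ^ 2 * M + q) * (E * T ^ 2)) + C * (32 * (e ^ 2 * m ^ 2))
        + C * (4 * (T * (e * m))) := by
    rw [← mul_add, ← mul_add]
    refine mul_le_mul_of_nonneg_left ?_ hC0.le
    linarith
  rw [hL]
  linarith

end LowFreq

end Decay

section Smoothing

theorem le_exp_mul_of_deriv_le {f f' y Z : ℝ → ℝ} {K M s t : ℝ} (hK : 0 ≤ K)
    (hf : ContinuousOn f (Ici 0)) (hf' : ∀ t, 0 < t → HasDerivAt f (f' t) t)
    (hy : ContinuousOn y (Ici 0)) (hy' : ∀ t, 0 < t → HasDerivAt y (-2 * Z t) t)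
    (hle : ∀ t, 0 < t → f' t ≤ K * (Z t * f t)) (hf0 : ∀ t, 0 ≤ t → 0 ≤ f t)
    (hs : 0 ≤ s) (hst : s ≤ t) (hM : y s - y t ≤ M) : f t ≤ Real.exp (K / 2 * M) * f s := by
  have hsub : Icc s t ⊆ Ici 0 := fun _ hx => hs.trans hx.1
  have hanti : AntitoneOn (fun t => f t * Real.exp (K / 2 * y t)) (Icc s t) := by
    refine antitoneOn_Icc_of_hasDerivAt (f' := fun t => f' t * Real.exp (K / 2 * y t) +
      f t * (Real.exp (K / 2 * y t) * (K / 2 * (-2 * Z t)))) ?_ ?_ ?_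
    · exact (hf.mono hsub).mul ((continuousOn_const.mul (hy.mono hsub)).rexp)
    · intro x hx
      have hx0 : 0 < x := hs.trans_lt hx.1
      exact (hf' x hx0).mul ((hy' x hx0).const_mul (K / 2)).exp
    · intro x hx
      have h1 := hle x (hs.trans_lt hx.1)
      have h2 := Real.exp_pos (K / 2 * y x)
      have e : f' x * Real.exp (K / 2 * y x) + f x * (Real.exp (K / 2 * y x) * (K / 2 * (-2 * Z x)))
        = Real.exp (K / 2 * y x) * (f' x - K * (Z x * f x)) := by ring
      rw [e]
      exact mul_nonpos_of_nonneg_of_nonpos h2.le (by linarith)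
  have h1 := hanti (left_mem_Icc.2 hst) (right_mem_Icc.2 hst) hst
  simp only at h1
  have h2 := hf0 s hs
  calc f t = f t * Real.exp (K / 2 * y t) * Real.exp (-(K / 2 * y t)) := by
        rw [mul_assoc, ← Real.exp_add, add_neg_cancel, Real.exp_zero, mul_one]
    _ ≤ f s * Real.exp (K / 2 * y s) * Real.exp (-(K / 2 * y t)) := by gcongr
    _ = f s * Real.exp (K / 2 * (y s - y t)) := by
        rw [mul_assoc, ← Real.exp_add]; congr 2; ring
    _ ≤ f s * Real.exp (K / 2 * M) := by gcongr
    _ = _ := mul_comm _ _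

/-- The differential inequalities that link the energy `y`, its dissipation `Z` and the energy `W`
of the time derivative. -/
structure Hierarchy (K M : ℝ) (y Z W Z' W' : ℝ → ℝ) : Prop where
  y_cont : ContinuousOn y (Ici 0)
  z_cont : ContinuousOn Z (Ici 0)
  w_cont : ContinuousOn W (Ici 0)
  y_deriv : ∀ t, 0 < t → HasDerivAt y (-2 * Z t) t
  z_deriv : ∀ t, 0 < t → HasDerivAt Z (Z' t) t
  w_deriv : ∀ t, 0 < t → HasDerivAt W (W' t) t
  y_nonneg : ∀ t, 0 ≤ t → 0 ≤ y t
  y_le : ∀ t, 0 ≤ t → y t ≤ M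
  z_nonneg : ∀ t, 0 ≤ t → 0 ≤ Z t
  w_nonneg : ∀ t, 0 ≤ t → 0 ≤ W t
  z_le : ∀ t, 0 < t → Z' t ≤ -(1 / 2) * W t + K * Z t ^ 2
  w_le : ∀ t, 0 < t → W' t ≤ K * (Z t * (W t + Z t ^ 2))

namespace Hierarchy

variable {K M : ℝ} {y Z W Z' W' : ℝ → ℝ}

theorem sub_le (h : Hierarchy K M y Z W Z' W') {s t : ℝ} (hs : 0 ≤ s) (ht : 0 ≤ t) :
    y s - y t ≤ M := by
  linarith [h.y_le s hs, h.y_nonneg t ht]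

theorem z_le_mul (h : Hierarchy K M y Z W Z' W') (hK : 0 ≤ K) {s t : ℝ} (hs : 0 ≤ s) (hst : s ≤ t) :
    Z t ≤ Real.exp (K / 2 * M) * Z s :=
  le_exp_mul_of_deriv_le hK h.z_cont h.z_deriv h.y_cont h.y_deriv
    (fun t ht => by
      have h1 := h.z_le t ht
      have h2 := h.w_nonneg t ht.le
      nlinarith) h.z_nonneg hs hst (h.sub_le hs (hs.trans hst))

theorem x_le_mul (h : Hierarchy K M y Z W Z' W') (hK : 0 ≤ K) {s t : ℝ} (hs : 0 ≤ s) (hst : s ≤ t) :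
    W t + Z t ^ 2 ≤ Real.exp (3 * K / 2 * M) * (W s + Z s ^ 2) := by
  refine le_exp_mul_of_deriv_le (f := fun t => W t + Z t ^ 2) (f' := fun t => W' t + 2 * Z t * Z' t)
    (by positivity) (h.w_cont.add (h.z_cont.pow 2)) (fun t ht => ?_) h.y_cont h.y_deriv
    (fun t ht => ?_) (fun t ht => add_nonneg (h.w_nonneg t ht) (sq_nonneg _)) hs hst
    (h.sub_le hs (hs.trans hst))
  · exact ((h.w_deriv t ht).add ((h.z_deriv t ht).pow 2)).congr_deriv (by norm_num)
  · have h1 := h.w_le t ht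
    have h3 := h.w_nonneg t ht.le
    have h4 := h.z_nonneg t ht.le
    have h2 := mul_le_mul_of_nonneg_left (h.z_le t ht) h4
    have h5 := mul_nonneg h4 h3
    have h6 := mul_nonneg hK h5
    nlinarith

theorem exists_smoothing (K M : ℝ) (hK : 0 ≤ K) (hM : 0 ≤ M) : ∃ G, 0 ≤ G ∧
    ∀ y Z W Z' W' : ℝ → ℝ, Hierarchy K M y Z W Z' W' → ∀ t, 0 ≤ t →
      W t + Z t ^ 2 ≤ G * (W 0 + Z 0 ^ 2) ∧ t ^ 2 * (W t + Z t ^ 2) ≤ G * y (t / 4) := by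
  set g := Real.exp (K / 2 * M) with hg
  set g₃ := Real.exp (3 * K / 2 * M) with hg₃
  have hg0 : 0 < g := Real.exp_pos _
  have hg₃0 : 0 < g₃ := Real.exp_pos _
  refine ⟨g₃ + 16 * g₃ * (g / 2 + (2 * K + 1) * g ^ 4 * M / 4), by positivity, ?_⟩
  intro y Z W Z' W' h t ht
  have hX0 : 0 ≤ W 0 + Z 0 ^ 2 := add_nonneg (h.w_nonneg 0 le_rfl) (sq_nonneg _)
  constructor
  · refine (h.x_le_mul hK le_rfl ht).trans (mul_le_mul_of_nonneg_right ?_ hX0)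
    exact le_add_of_nonneg_right (by positivity)
  rcases ht.eq_or_lt with rfl | ht0
  · have := h.y_nonneg (0 / 4) (by norm_num)
    rw [zero_pow two_ne_zero, zero_mul]
    positivity
  obtain ⟨a, rfl⟩ : ∃ a, t = 4 * a := ⟨t / 4, by ring⟩
  have ha : 0 < a := by linarith
  rw [mul_div_cancel_left₀ a (by norm_num : (4 : ℝ) ≠ 0)]
  have hya := h.y_nonneg a ha.le
  obtain ⟨s₁, hs₁, e₁⟩ := exists_hasDerivAt_eq_slope y (fun s => -2 * Z s) (by linarith : a < 2 * a)
    (h.y_cont.mono fun _ hx => ha.le.trans hx.1) fun x hx => h.y_deriv x (ha.trans hx.1)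
  obtain ⟨s₂, hs₂, e₂⟩ := exists_hasDerivAt_eq_slope Z Z' (by linarith : 2 * a < 4 * a)
    (h.z_cont.mono fun _ hx => (by linarith [hx.1] : (0 : ℝ) ≤ _))
    fun x hx => h.z_deriv x (by linarith [hx.1])
  have h₂0 : 0 < s₂ := by linarith [hs₂.1]
  have z1 : 2 * a * Z s₁ ≤ y a := by
    have h1 : -2 * Z s₁ * a = y (2 * a) - y a := by rw [e₁]; field_simp; ring
    linarith [h.y_nonneg (2 * a) (by linarith)]
  have z2 : 2 * a * Z (2 * a) ≤ g * y a := by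
    have h1 := h.z_le_mul hK (ha.le.trans hs₁.1.le) hs₁.2.le
    have h2 := mul_le_mul_of_nonneg_left h1 (by linarith : 0 ≤ 2 * a)
    have h3 := mul_le_mul_of_nonneg_left z1 hg0.le
    linarith
  have z3 : 2 * a * Z s₂ ≤ g ^ 2 * y a := by
    have h1 := h.z_le_mul hK (by linarith : 0 ≤ 2 * a) hs₂.1.le
    have h2 := mul_le_mul_of_nonneg_left h1 (by linarith : 0 ≤ 2 * a)
    have h3 := mul_le_mul_of_nonneg_left z2 hg0.le
    linarith
  have w1 : a * W s₂ ≤ Z (2 * a) + 2 * a * (K * Z s₂ ^ 2) := by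
    have h1 : Z' s₂ * (2 * a) = Z (4 * a) - Z (2 * a) := by rw [e₂]; field_simp; ring
    have h2 := mul_le_mul_of_nonneg_right (h.z_le s₂ h₂0) (by linarith : 0 ≤ 2 * a)
    linarith [h.z_nonneg (4 * a) (by linarith)]
  have hz3 : 0 ≤ 2 * a * Z s₂ := mul_nonneg (by linarith) (h.z_nonneg s₂ h₂0.le)
  have z4 : (2 * a * Z s₂) ^ 2 ≤ g ^ 4 * M * y a := by
    calc (2 * a * Z s₂) ^ 2 ≤ (g ^ 2 * y a) ^ 2 := by gcongr
      _ = g ^ 4 * y a * y a := by ring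
      _ ≤ g ^ 4 * M * y a := by have := h.y_le a ha.le; gcongr
  have x1 : a ^ 2 * (W s₂ + Z s₂ ^ 2) ≤ (g / 2 + (2 * K + 1) * g ^ 4 * M / 4) * y a := by
    have h1 := mul_le_mul_of_nonneg_left w1 ha.le
    have h2 := mul_le_mul_of_nonneg_left z4 (by positivity : 0 ≤ (2 * K + 1) / 4)
    linarith
  have x2 := h.x_le_mul hK h₂0.le hs₂.2.le
  calc (4 * a) ^ 2 * (W (4 * a) + Z (4 * a) ^ 2)
      ≤ (4 * a) ^ 2 * (g₃ * (W s₂ + Z s₂ ^ 2)) := by gcongr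
    _ = 16 * g₃ * (a ^ 2 * (W s₂ + Z s₂ ^ 2)) := by ring
    _ ≤ 16 * g₃ * ((g / 2 + (2 * K + 1) * g ^ 4 * M / 4) * y a) := by gcongr
    _ ≤ _ := by
      rw [← mul_assoc]
      exact mul_le_mul_of_nonneg_right (le_add_of_nonneg_left hg₃0.le) hya

end Hierarchy

end Smoothing

namespace Flow

variable {r : ℝ → Plane → ℝ} {v p : Fin 2 → ℝ → Plane → ℝ} {t : ℝ}

theorem dirichletConst_nonneg : 0 ≤ dirichletConst := by unfold dirichletConst; positivity

theorem dirichlet_sq_le (hv : ∀ k, Regular (v k)) (ht : 0 ≤ t) :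
    dirichlet v t ^ 2 ≤ 16 * (sqNorm v t * hessian v t) := by
  have h : ∀ k i, ∫ x, dx i (v k) t x * dx i (v k) t x ≤
      Real.sqrt (sqNorm v t) * Real.sqrt (hessian v t) := by
    intro k i
    have h1 := (hv k).integral_mul_dx ((hv k).dx i) ht i
    have h2 := abs_integral_mul_le_nrm ((hv k).memLp ht) (((hv k).dx i).dx i |>.memLp ht)
    have h3 := mul_le_mul (nrm_le_sqNorm v t k) (nrm_dx_dx_le v t k i i) (nrm_nonneg _)
      (Real.sqrt_nonneg _)
    linarith [(abs_le.1 h2).1]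
  have hZ : dirichlet v t ≤ 4 * (Real.sqrt (sqNorm v t) * Real.sqrt (hessian v t)) := by
    simp only [dirichlet, Fin.sum_univ_two]
    linarith [h 0 0, h 0 1, h 1 0, h 1 1]
  calc dirichlet v t ^ 2 ≤ (4 * (Real.sqrt (sqNorm v t) * Real.sqrt (hessian v t))) ^ 2 :=
        pow_le_pow_left₀ (dirichlet_nonneg v t) hZ 2
    _ = 16 * (Real.sqrt (sqNorm v t) ^ 2 * Real.sqrt (hessian v t) ^ 2) := by ring
    _ = _ := by rw [Real.sq_sqrt (sqNorm_nonneg v t), Real.sq_sqrt (hessian_nonneg v t)]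

theorem energy_nonneg {v : Fin 2 → ℝ → Plane → ℝ} (hr : Regular r) (hv : ∀ k, Regular (v k))
    (ht : 0 ≤ t) (hr4 : ∀ x, |r t x| ≤ 1 / 4) : 0 ≤ energy r v t := by
  have := (energy_bounds hr hv ht hr4).1
  linarith [sqNorm_nonneg v t]

theorem energy_le (H : Flow r v p) (ht : 0 ≤ t) :
    energy r v t ≤ energy r v 0 :=
  antitoneOn_Icc_of_hasDerivAt
    ((continuousOn_energy H.reg_r H.reg_v).mono fun _ hx => hx.1)
    (fun x hx => H.hasDerivAt_energy hx.1)
    (fun x _ => by have := dirichlet_nonneg v x; linarith)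
    (left_mem_Icc.2 ht) (right_mem_Icc.2 ht) ht

/-- The constant in the bound of `‖∂ₜv‖² + ‖∇²v‖² + ‖p‖²` for flows of energy at most `M`. -/
def ellipticConst (M : ℝ) : ℝ := 12 + 2 * (512 * gnsConst ^ 2) ^ 2 * M

/-- The constant in the differential inequalities for flows of energy at most `M`. -/
def hierarchyConst (M : ℝ) : ℝ :=
  2 * dirichletConst * M + youngConst * (1 + 2 * M) * (ellipticConst M + 2 * M)

theorem ellipticConst_nonneg {M : ℝ} (hM : 0 ≤ M) : 0 ≤ ellipticConst M := by
  unfold ellipticConst; positivity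

theorem hierarchyConst_nonneg {M : ℝ} (hM : 0 ≤ M) : 0 ≤ hierarchyConst M := by
  have := dirichletConst_nonneg
  have := youngConst_nonneg
  have := ellipticConst_nonneg hM
  unfold hierarchyConst; positivity

theorem sqNorm_le_of_energy (H : Flow r v p) (hr0 : ∀ x, |r 0 x| ≤ 1 / 4) {M : ℝ}
    (hM : energy r v 0 ≤ M) (ht : 0 ≤ t) : sqNorm v t ≤ 2 * M := by
  have h1 := (energy_bounds H.reg_r H.reg_v ht
    fun x => H.abs_le_of_initial (by norm_num) hr0 ht x).1
  have h2 := H.energy_le ht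
  linarith [sqNorm_nonneg v t]

theorem elliptic_le (H : Flow r v p) (hr0 : ∀ x, |r 0 x| ≤ 1 / 4) {M : ℝ}
    (hM : energy r v 0 ≤ M) (ht : 0 ≤ t) :
    sqNorm (fun k => tderiv (v k)) t + hessian v t + sqNorm p t ≤
      ellipticConst M * (energy r (fun k => tderiv (v k)) t + dirichlet v t ^ 2) := by
  have hr : ∀ x, |r t x| ≤ 1 / 4 := fun x => H.abs_le_of_initial (by norm_num) hr0 ht x
  have h1 := H.hessian_le ht hr
  have h2 := H.sqNorm_le_of_energy hr0 hM ht
  have h3 := (energy_bounds H.reg_r (fun k => (H.reg_v k).tderiv) ht hr).1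
  have h4 : (512 * gnsConst ^ 2) ^ 2 * (sqNorm v t * dirichlet v t ^ 2) ≤
      (512 * gnsConst ^ 2) ^ 2 * (2 * M * dirichlet v t ^ 2) := by gcongr
  have hW := energy_nonneg H.reg_r (fun k => (H.reg_v k).tderiv) ht hr
  have hM0 : 0 ≤ M := by linarith [sqNorm_nonneg v t]
  have h5 : 0 ≤ (512 * gnsConst ^ 2) ^ 2 * M * energy r (fun k => tderiv (v k)) t := by positivity
  unfold ellipticConst
  linarith [sq_nonneg (dirichlet v t)]

theorem hierarchy (H : Flow r v p) (hr0 : ∀ x, |r 0 x| ≤ 1 / 4) {M : ℝ} (hM : energy r v 0 ≤ M) :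
    ∃ Z' W', Hierarchy (hierarchyConst M) M (energy r v) (dirichlet v)
      (energy r (fun k => tderiv (v k))) Z' W' := by
  have hr : ∀ t, 0 ≤ t → ∀ x, |r t x| ≤ 1 / 4 := fun t ht x =>
    H.abs_le_of_initial (by norm_num) hr0 ht x
  have hv' := fun k => (H.reg_v k).tderiv
  have hM0 : 0 ≤ M := (energy_nonneg H.reg_r H.reg_v le_rfl hr0).trans hM
  have hd := dirichletConst_nonneg
  have hyc := youngConst_nonneg
  have hec := ellipticConst_nonneg hM0
  refine ⟨_, _, continuousOn_energy H.reg_r H.reg_v, continuousOn_dirichlet H.reg_v,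
    continuousOn_energy H.reg_r hv', fun t ht => H.hasDerivAt_energy ht,
    fun t ht => H.hasDerivAt_dirichlet ht, fun t ht => H.hasDerivAt_energy_tderiv ht,
    fun t ht => energy_nonneg H.reg_r H.reg_v ht (hr t ht), fun t ht => (H.energy_le ht).trans hM,
    fun t _ => dirichlet_nonneg v t, fun t ht => energy_nonneg H.reg_r hv' ht (hr t ht),
    fun t ht => ?_, fun t ht => ?_⟩
  · refine (H.dirichlet_deriv_le ht.le (hr t ht.le)).trans (add_le_add_right ?_ _)
    have hq := H.sqNorm_le_of_energy hr0 hM ht.le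
    have h1 : dirichletConst * (sqNorm v t * dirichlet v t ^ 2) ≤
        dirichletConst * (2 * M * dirichlet v t ^ 2) := by gcongr
    have h2 : 0 ≤ youngConst * (1 + 2 * M) * (ellipticConst M + 2 * M) * dirichlet v t ^ 2 := by
      positivity
    unfold hierarchyConst
    linarith
  · refine (H.energy_tderiv_deriv_le ht.le (hr t ht.le)).trans ?_
    have hq := H.sqNorm_le_of_energy hr0 hM ht.le
    have hq0 := sqNorm_nonneg v t
    have hZ := dirichlet_nonneg v t
    have hW := energy_nonneg H.reg_r hv' ht.le (hr t ht.le)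
    have h1 := H.elliptic_le hr0 hM ht.le
    have h0 := sqNorm_nonneg p t
    have hc := hessian_nonneg v t
    have hw := sqNorm_nonneg (fun k => tderiv (v k)) t
    set Z := dirichlet v t
    set W := energy r (fun k => tderiv (v k)) t
    have h2 : sqNorm (fun k => tderiv (v k)) t + hessian v t + sqNorm v t * Z ^ 2 ≤
        (ellipticConst M + 2 * M) * (W + Z ^ 2) := by
      have h3 : sqNorm v t * Z ^ 2 ≤ 2 * M * Z ^ 2 := by gcongr
      have h4 : 0 ≤ 2 * M * W := by positivity
      linarith
    have h5 : (1 + sqNorm v t) * Z ≤ (1 + 2 * M) * Z := by gcongr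
    calc _ ≤ youngConst * ((1 + 2 * M) * Z * ((ellipticConst M + 2 * M) * (W + Z ^ 2))) := by
          gcongr
      _ = youngConst * (1 + 2 * M) * (ellipticConst M + 2 * M) * (Z * (W + Z ^ 2)) := by ring
      _ ≤ _ := by
          refine mul_le_mul_of_nonneg_right ?_ (by positivity)
          unfold hierarchyConst
          exact le_add_of_nonneg_left (by positivity)

theorem lowFreq (H : Flow r v p) (hr0 : ∀ x, |r 0 x| ≤ 1 / 4)
    (hx : ∀ k, Integrable (fun x => ‖x‖ * |v k 0 x|))
    (hmean : ∀ k, ∫ x, (v k 0 x + r 0 x * v k 0 x) = 0) {T : ℝ}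
    (hU : ∑ k, ∫ x, ‖x‖ * |v k 0 x| ≤ 2 * (T * energy r v 0)) (hR : ∫ x, r 0 x * r 0 x ≤ T) :
    LowFreq (5 * (2 + 150 * smearConst ^ 2)) (energy r v 0) T (energy r v) (dirichlet v) := by
  have hr : ∀ t, 0 ≤ t → ∀ x, |r t x| ≤ 1 / 4 := fun t ht x =>
    H.abs_le_of_initial (by norm_num) hr0 ht x
  refine ⟨continuousOn_energy H.reg_r H.reg_v, fun t ht => H.hasDerivAt_energy ht, rfl,
    fun t ht => energy_nonneg H.reg_r H.reg_v ht (hr t ht), fun t _ => dirichlet_nonneg v t, ?_⟩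
  intro t ht τ hτ
  have h := H.sqNorm_le hr0 hx hmean ht (b := Real.sqrt τ) (Real.sqrt_pos.2 hτ)
  have e2 : Real.sqrt τ ^ 2 = τ := Real.sq_sqrt hτ.le
  have e4 : (Real.sqrt τ)⁻¹ ^ 4 = τ⁻¹ ^ 2 := by
    rw [show (Real.sqrt τ)⁻¹ ^ 4 = ((Real.sqrt τ ^ 2)⁻¹) ^ 2 by rw [← inv_pow]; ring, e2]
  have e6 : (Real.sqrt τ)⁻¹ ^ 6 = τ⁻¹ ^ 3 := by
    rw [show (Real.sqrt τ)⁻¹ ^ 6 = ((Real.sqrt τ ^ 2)⁻¹) ^ 3 by rw [← inv_pow]; ring, e2]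
  rw [e2, e4, e6] at h
  have hb := (energy_bounds H.reg_r H.reg_v ht (hr t ht)).2
  have hsub : Icc 0 t ⊆ Ici 0 := fun _ hx => hx.1
  have hA : ∫ s in (0 : ℝ)..t, sqNorm v s ≤ 4 / 3 * ∫ s in (0 : ℝ)..t, energy r v s := by
    rw [← intervalIntegral.integral_const_mul]
    refine intervalIntegral.integral_mono_on ht
      (((continuousOn_sqNorm H.reg_v).mono hsub).intervalIntegrable_of_Icc ht)
      ((((continuousOn_energy H.reg_r H.reg_v).mono hsub).intervalIntegrable_of_Icc ht).const_mul _)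
      fun s hs => ?_
    have := (energy_bounds H.reg_r H.reg_v hs.1 (hr s hs.1)).1
    linarith
  have hA0 : 0 ≤ ∫ s in (0 : ℝ)..t, sqNorm v s :=
    intervalIntegral.integral_nonneg ht fun s _ => sqNorm_nonneg v s
  set A := ∫ s in (0 : ℝ)..t, sqNorm v s
  set B := ∫ s in (0 : ℝ)..t, energy r v s
  have hU0 : 0 ≤ ∑ k, ∫ x, ‖x‖ * |v k 0 x| :=
    Finset.sum_nonneg fun k _ => integral_nonneg fun x => by positivity
  have hR0 : 0 ≤ ∫ x, r 0 x * r 0 x := integral_nonneg fun x => mul_self_nonneg _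
  have hT : 0 ≤ T := hR0.trans hR
  set U := ∑ k, ∫ x, ‖x‖ * |v k 0 x|
  set E := energy r v 0
  have hZ := dirichlet_nonneg v t
  have k1 : U ^ 2 ≤ 4 * (T ^ 2 * E ^ 2) := by
    calc U ^ 2 ≤ (2 * (T * E)) ^ 2 := by gcongr
      _ = _ := by ring
  have hB0 : 0 ≤ B := by linarith
  have k2 : A ^ 2 ≤ 4 * B ^ 2 := by
    calc A ^ 2 ≤ (4 / 3 * B) ^ 2 := by gcongr
      _ ≤ _ := by nlinarith [sq_nonneg B]
  have k3 : (∫ x, r 0 x * r 0 x) * (t * A) ≤ 4 * (T * t * B) := by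
    have h5 : A ≤ 4 * B := by linarith
    calc (∫ x, r 0 x * r 0 x) * (t * A) ≤ T * (t * (4 * B)) := by gcongr
      _ = _ := by ring
  have hS : τ * dirichlet v t + τ⁻¹ ^ 2 * U ^ 2 + τ⁻¹ ^ 2 * A ^ 2
      + τ⁻¹ ^ 3 * (∫ x, r 0 x * r 0 x) * (t * A) ≤
      4 * (τ * dirichlet v t + τ⁻¹ ^ 2 * (T ^ 2 * E ^ 2 + B ^ 2) + τ⁻¹ ^ 3 * (T * t * B)) := by
    have m1 : τ⁻¹ ^ 2 * U ^ 2 ≤ τ⁻¹ ^ 2 * (4 * (T ^ 2 * E ^ 2)) := by gcongr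
    have m2 : τ⁻¹ ^ 2 * A ^ 2 ≤ τ⁻¹ ^ 2 * (4 * B ^ 2) := by gcongr
    have m3 : τ⁻¹ ^ 3 * ((∫ x, r 0 x * r 0 x) * (t * A)) ≤ τ⁻¹ ^ 3 * (4 * (T * t * B)) := by gcongr
    have m4 : 0 ≤ τ * dirichlet v t := by positivity
    linarith
  have hK : 0 ≤ 2 + 150 * smearConst ^ 2 := by positivity
  have := mul_le_mul_of_nonneg_left hS hK
  linarith

/-- Decay of the time derivative, of the second derivatives and of the pressure gradient. -/
theorem exists_decay (M : ℝ) : ∃ L, 0 ≤ L ∧ ∀ (r : ℝ → Plane → ℝ) (v p : Fin 2 → ℝ → Plane → ℝ),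
    Flow r v p → (∀ x, |r 0 x| ≤ 1 / 4) → (∀ k, Integrable (fun x => ‖x‖ * |v k 0 x|)) →
    (∀ k, ∫ x, (v k 0 x + r 0 x * v k 0 x) = 0) → energy r v 0 ≤ M → ∀ T, 0 < T →
    ∑ k, ∫ x, ‖x‖ * |v k 0 x| ≤ 2 * (T * energy r v 0) → ∫ x, r 0 x * r 0 x ≤ T →
    energy r v 0 ≤ T * dirichlet v 0 → ∀ t, 0 ≤ t →
    bracket T t ^ 4 * (sqNorm (fun k => tderiv (v k)) t + hessian v t + sqNorm p t) ≤
      L * (energy r (fun k => tderiv (v k)) 0 + dirichlet v 0 ^ 2) := by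
  rcases lt_or_ge M 0 with hM | hM
  · refine ⟨0, le_rfl, fun r v p H hr0 _ _ hE => ?_⟩
    linarith [energy_nonneg H.reg_r H.reg_v le_rfl hr0]
  obtain ⟨D, hD0, hD⟩ := LowFreq.exists_decay (5 * (2 + 150 * smearConst ^ 2)) M
    (by nlinarith [sq_nonneg smearConst]) hM
  obtain ⟨G, hG0, hG⟩ := Hierarchy.exists_smoothing (hierarchyConst M) M (hierarchyConst_nonneg hM) hM
  have hc0 := ellipticConst_nonneg hM
  set c := ellipticConst M with hc
  refine ⟨c * (8 * (81 * G + 352 * G * D * c)), by positivity, ?_⟩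
  intro r v p H hr0 hx hmean hE T hT hU hR hTZ t ht
  obtain ⟨Z', W', hH⟩ := H.hierarchy hr0 hE
  have hlow := H.lowFreq hr0 hx hmean hU hR
  obtain ⟨x1, x2⟩ := hG _ _ _ _ _ hH t ht
  have hell := H.elliptic_le hr0 hE ht
  have hell0 := H.elliptic_le hr0 hE le_rfl
  have hE0 := energy_nonneg H.reg_r H.reg_v le_rfl hr0
  have hXt : 0 ≤ energy r (fun k => tderiv (v k)) t + dirichlet v t ^ 2 :=
    add_nonneg (hH.w_nonneg t ht) (sq_nonneg _)
  have hX0 : 0 ≤ energy r (fun k => tderiv (v k)) 0 + dirichlet v 0 ^ 2 :=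
    add_nonneg (hH.w_nonneg 0 le_rfl) (sq_nonneg _)
  set X := energy r (fun k => tderiv (v k)) t + dirichlet v t ^ 2
  set X₀ := energy r (fun k => tderiv (v k)) 0 + dirichlet v 0 ^ 2
  set E := energy r v 0
  have hEX : E ≤ 22 * (T ^ 2 * (c * X₀)) := by
    rcases hE0.eq_or_lt with h0 | hpos
    · rw [← h0]; positivity
    have h1 := dirichlet_sq_le H.reg_v le_rfl
    have h2 := (energy_bounds H.reg_r H.reg_v le_rfl hr0).1
    have h3 : hessian v 0 ≤ c * X₀ := by
      linarith [sqNorm_nonneg (fun k => tderiv (v k)) 0, sqNorm_nonneg p 0]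
    have h4 : E * E ≤ E * (22 * (T ^ 2 * (c * X₀))) := by
      have hZ := dirichlet_nonneg v 0
      have hq := sqNorm_nonneg v 0
      have hh := hessian_nonneg v 0
      have hq2 : sqNorm v 0 ≤ 4 / 3 * E := by linarith
      calc E * E ≤ (T * dirichlet v 0) * (T * dirichlet v 0) :=
            mul_le_mul hTZ hTZ hE0 (by positivity)
        _ = T ^ 2 * dirichlet v 0 ^ 2 := by ring
        _ ≤ T ^ 2 * (16 * (4 / 3 * E * (c * X₀))) := by
            refine mul_le_mul_of_nonneg_left (h1.trans ?_) (by positivity)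
            gcongr
        _ = E * (64 / 3 * (T ^ 2 * (c * X₀))) := by ring
        _ ≤ _ := by
            refine mul_le_mul_of_nonneg_left ?_ hE0
            refine mul_le_mul_of_nonneg_right (by norm_num) (by positivity)
    exact le_of_mul_le_mul_left h4 hpos
  have hlate : (t / T) ^ 4 * X ≤ 352 * G * D * c * X₀ := by
    rcases ht.eq_or_lt with rfl | ht0
    · rw [zero_div, zero_pow (by norm_num), zero_mul]; positivity
    have h1 := hD _ _ _ _ hT hE hlow (t / 4) (by positivity)
    have h2 : t ^ 4 * X ≤ 352 * G * D * c * X₀ * T ^ 4 := by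
      calc t ^ 4 * X = t ^ 2 * (t ^ 2 * X) := by ring
        _ ≤ t ^ 2 * (G * energy r v (t / 4)) := by gcongr
        _ = 16 * G * ((t / 4) ^ 2 * energy r v (t / 4)) := by ring
        _ ≤ 16 * G * (D * (E * T ^ 2)) := by gcongr
        _ ≤ 16 * G * (D * (22 * (T ^ 2 * (c * X₀)) * T ^ 2)) := by gcongr
        _ = _ := by ring
    rw [div_pow, div_mul_eq_mul_div, div_le_iff₀ (by positivity)]
    exact h2
  have hbr : bracket T t ^ 4 ≤ 8 * (81 + (t / T) ^ 4) := by
    have h3 : Real.exp 1 ≤ 3 := Real.exp_one_lt_three.le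
    have h4 : 0 ≤ t / T := by positivity
    unfold bracket
    calc (Real.exp 1 + t / T) ^ 4 ≤ (3 + t / T) ^ 4 := by gcongr
      _ ≤ _ := by
        nlinarith [sq_nonneg (3 - t / T), sq_nonneg (3 ^ 2 - (t / T) ^ 2), sq_nonneg (3 + t / T),
          mul_nonneg (sq_nonneg (3 - t / T)) (sq_nonneg (3 + t / T)),
          sq_nonneg ((3 + t / T) ^ 2 - 2 * (9 + (t / T) ^ 2)), sq_nonneg ((3 - t / T) ^ 2)]
  calc bracket T t ^ 4 * (sqNorm (fun k => tderiv (v k)) t + hessian v t + sqNorm p t)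
      ≤ 8 * (81 + (t / T) ^ 4) * (c * X) := by
        refine mul_le_mul hbr hell ?_ (by positivity)
        exact add_nonneg (add_nonneg (sqNorm_nonneg _ _) (hessian_nonneg _ _)) (sqNorm_nonneg _ _)
    _ = c * (8 * (81 * X + (t / T) ^ 4 * X)) := by ring
    _ ≤ c * (8 * (81 * (G * X₀) + 352 * G * D * c * X₀)) := by gcongr
    _ = _ := by ring

end Flow

section Components

theorem l2_sq_eq {G : Type*} [NormedAddCommGroup G] {f : Plane → G} (hf : Continuous f) :
    l2 f ^ 2 = ∫ x, ‖f x‖ ^ 2 := by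
  have h0 : (2 : ℝ≥0∞) ≠ 0 := by norm_num
  have h1 : (2 : ℝ≥0∞) ≠ ⊤ := by norm_num
  rw [l2, eLpNorm_eq_lintegral_rpow_enorm_toReal h0 h1, ← ENNReal.toReal_rpow,
    integral_eq_lintegral_of_nonneg_ae (Eventually.of_forall fun x => sq_nonneg _)
      (hf.norm.pow 2).aestronglyMeasurable]
  rw [ENNReal.toReal_ofNat, ← Real.sqrt_eq_rpow, Real.sq_sqrt ENNReal.toReal_nonneg]
  congr 1
  refine lintegral_congr fun x => ?_
  rw [← ofReal_norm, ENNReal.rpow_ofNat, ENNReal.ofReal_pow (norm_nonneg _)]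

theorem norm_sq_eq (x : Plane) : ‖x‖ ^ 2 = ∑ k, x k ^ 2 := by
  rw [EuclideanSpace.norm_sq_eq]; simp

theorem l2_sq_eq_sum {f : Plane → Plane} (hf : Continuous f)
    (hL : ∀ k, MemLp (fun x => f x k) 2 volume) : l2 f ^ 2 = ∑ k, ∫ x, f x k ^ 2 := by
  rw [l2_sq_eq hf, ← integral_finsetSum _ fun k _ => (hL k).integrable_sq]
  simp only [norm_sq_eq]

variable {F : Type*} [NormedAddCommGroup F] [NormedSpace ℝ F]

theorem norm_grad_sq (f : Plane → F) (x : Plane) :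
    ‖grad f x‖ ^ 2 = ∑ i, ‖fderiv ℝ f x (basisVec i)‖ ^ 2 := by
  rw [PiLp.norm_sq_eq_of_L2]; rfl

theorem contDiff_fderiv_apply {f : Plane → F} (hf : ContDiff ℝ ∞ f) (e : Plane) :
    ContDiff ℝ ∞ (fun x => fderiv ℝ f x e) :=
  (hf.fderiv_right (m := ∞) (by simp)).clm_apply contDiff_const

theorem contDiff_grad {f : Plane → F} (hf : ContDiff ℝ ∞ f) : ContDiff ℝ ∞ (grad f) :=
  PiLp.contDiff_toLp.comp (contDiff_pi.2 fun i => contDiff_fderiv_apply hf (basisVec i))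

theorem fderiv_grad {f : Plane → F} (hf : ContDiff ℝ ∞ f) (x e : Plane) :
    fderiv ℝ (grad f) x e =
      WithLp.toLp 2 (fun i => fderiv ℝ (fun x => fderiv ℝ f x (basisVec i)) x e) := by
  have h1 : HasFDerivAt (fun x => fun i => fderiv ℝ f x (basisVec i))
      (ContinuousLinearMap.pi fun i => fderiv ℝ (fun x => fderiv ℝ f x (basisVec i)) x) x :=
    hasFDerivAt_pi.2 fun i =>
      ((contDiff_fderiv_apply hf (basisVec i)).differentiable (by simp) x).hasFDerivAt
  have h2 : HasFDerivAt (grad f) _ x := (PiLp.hasFDerivAt_toLp (𝕜 := ℝ) 2 _).comp x h1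
  rw [h2.fderiv]
  rfl

theorem norm_grad_grad_sq {f : Plane → F} (hf : ContDiff ℝ ∞ f) (x : Plane) :
    ‖grad (grad f) x‖ ^ 2 =
      ∑ i, ∑ j, ‖fderiv ℝ (fun x => fderiv ℝ f x (basisVec j)) x (basisVec i)‖ ^ 2 := by
  rw [norm_grad_sq]
  refine Finset.sum_congr rfl fun i _ => ?_
  rw [fderiv_grad hf, PiLp.norm_sq_eq_of_L2]

theorem lap_eq {f : Plane → F} (hf : ContDiff ℝ ∞ f) (x : Plane) :
    lap f x = ∑ i, fderiv ℝ (fun x => fderiv ℝ f x (basisVec i)) x (basisVec i) := by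
  refine Finset.sum_congr rfl fun i _ => ?_
  rw [iteratedFDeriv_two_apply, fderiv_clm_apply
    ((hf.fderiv_right (m := ∞) (by simp)).differentiable (by simp) x) (differentiableAt_const _)]
  simp

end Components

section Conversion

variable {ρ : ℝ → Plane → ℝ} {u : ℝ → Plane → Plane} {P : ℝ → Plane → ℝ} {t : ℝ}

/-- The `k`-th component of a time-dependent planar field. -/
def comp (u : ℝ → Plane → Plane) (k : Fin 2) (t : ℝ) (x : Plane) : ℝ := u t x k

theorem tderiv_comp (hu : Smooth u) (k : Fin 2) (ht : 0 ≤ t) :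
    tderiv (comp u k) t = fun x => tderiv u t x k :=
  hu.tderiv_clm_comp (EuclideanSpace.proj k) ht

theorem dx_comp (hu : Smooth u) (k i : Fin 2) (ht : 0 ≤ t) :
    dx i (comp u k) t = fun x => dx i u t x k :=
  hu.dx_clm_comp (EuclideanSpace.proj k) i ht

theorem dx_dx_apply {F : Type*} [NormedAddCommGroup F] [NormedSpace ℝ F] (f : ℝ → Plane → F)
    (i j : Fin 2) (t : ℝ) (x : Plane) :
    dx j (dx i f) t x = fderiv ℝ (fun x => fderiv ℝ (f t) x (basisVec i)) x (basisVec j) := rfl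

theorem dx_dx_comp (hu : Smooth u) (k i j : Fin 2) (ht : 0 ≤ t) :
    dx j (dx i (comp u k)) t = fun x => dx j (dx i u) t x k :=
  (dx_congr j (fun _ hs => dx_comp hu k i hs) ht).trans (dx_comp (hu.smooth_dx i) k j ht)

theorem SobolevSmooth.regular_comp (hu : SobolevSmooth u) (k : Fin 2) : Regular (comp u k) :=
  (hu.clm_comp (EuclideanSpace.proj k : Plane →L[ℝ] ℝ)).regular

theorem fderiv_apply_eq {F : Type*} [NormedAddCommGroup F] [NormedSpace ℝ F] (L : Plane →L[ℝ] F)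
    (z : Plane) : L z = z 0 • L (basisVec 0) + z 1 • L (basisVec 1) := by
  conv_lhs => rw [eq_sum_basisVec z]
  simp only [map_add, map_smul]

theorem gradient_apply (f : Plane → ℝ) (x : Plane) (k : Fin 2) :
    gradient f x k = fderiv ℝ f x (basisVec k) := by
  rw [← inner_gradient_left, basisVec, EuclideanSpace.inner_single_right]
  simp

theorem IsSmoothSolution.flow (hS : IsSmoothSolution ρ u P) :
    Flow (fun t x => ρ t x - 1) (comp u) (comp fun t x => gradient (P t) x) where
  reg_r := hS.regular_rho.regular
  reg_v := hS.regular_u.regular_comp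
  reg_p := hS.regular_gradP.regular_comp
  mass t ht x := by
    have h := hS.mass t ht x
    rw [fderiv_apply_eq] at h
    have e1 : tderiv (fun t x => ρ t x - 1) t x = tderiv ρ t x := by
      simp only [tderiv, derivWithin_sub_const]
    have e2 : ∀ i, dx i (fun t x => ρ t x - 1) t x = fderiv ℝ (ρ t) x (basisVec i) := fun i => by
      simp only [dx, fderiv_sub_const]
    rw [e1, e2, e2]
    exact h
  mom k t ht x := by
    have hu := hS.regular_u.isSmooth
    have h := congrArg (fun z : Plane => z k) (hS.momentum t ht x)
    rw [fderiv_apply_eq, lap_eq (hu.contDiff_slice ht)] at h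
    simp only [Fin.sum_univ_two, PiLp.add_apply, PiLp.sub_apply, PiLp.smul_apply, smul_eq_mul,
      PiLp.zero_apply] at h
    rw [tderiv_comp hu k ht, dx_comp hu k 0 ht, dx_comp hu k 1 ht, dx_dx_comp hu k 0 0 ht,
      dx_dx_comp hu k 1 1 ht]
    simp only [comp, dx_dx_apply]
    simp only [dx]
    linear_combination h
  div t ht x := by
    have hu := hS.regular_u.isSmooth
    rw [dx_comp hu 0 0 ht, dx_comp hu 1 1 ht]
    have h := hS.incompressible t ht x
    rw [divg, Fin.sum_univ_two] at h
    exact h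
  curl t ht x := by
    have hg := hS.regular_gradP.isSmooth
    have hd : Differentiable ℝ (fun x => gradient (P t) x) := (hg.contDiff_slice ht).differentiable (by simp)
    have hf : ∀ y, HasFDerivAt (P t) (fderiv ℝ (P t) y) y := fun y =>
      (hS.differentiable_P t ht y).hasFDerivAt
    have hd' : Differentiable ℝ (fderiv ℝ (P t)) := by
      have : fderiv ℝ (P t) = fun x => InnerProductSpace.toDual ℝ Plane (gradient (P t) x) := by
        funext y; rw [toDual_gradient]
      rw [this]
      exact (InnerProductSpace.toDual ℝ Plane).differentiable.comp hd
    have hs := second_derivative_symmetric hf (hd' x).hasFDerivAt (basisVec 1) (basisVec 0)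
    have e : ∀ i k, dx i (comp (fun t x => gradient (P t) x) k) t x =
        fderiv ℝ (fderiv ℝ (P t)) x (basisVec i) (basisVec k) := by
      intro i k
      have : comp (fun t x => gradient (P t) x) k t = fun x => fderiv ℝ (P t) x (basisVec k) := by
        funext y; exact gradient_apply (P t) y k
      simp only [dx]
      rw [this, fderiv_clm_apply (hd' x) (differentiableAt_const _)]
      simp
    rw [e, e, hs]

theorem SobolevSmooth.l2_sq (hu : SobolevSmooth u) (ht : 0 ≤ t) :
    l2 (u t) ^ 2 = sqNorm (comp u) t :=
  l2_sq_eq_sum (hu.isSmooth.contDiff_slice ht).continuous fun k => (hu.regular_comp k).memLp ht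

theorem SobolevSmooth.l2_tderiv_sq (hu : SobolevSmooth u) (ht : 0 ≤ t) :
    l2 (INS2D.tderiv u t) ^ 2 = sqNorm (fun k => INS2D.tderiv (comp u k)) t := by
  rw [hu.tderiv.l2_sq ht, sqNorm, sqNorm]
  simp only [tderiv_comp hu.isSmooth _ ht]
  rfl

theorem SobolevSmooth.l2_grad_sq (hu : SobolevSmooth u) (ht : 0 ≤ t) :
    l2 (grad (u t)) ^ 2 = dirichlet (comp u) t := by
  have hs := hu.isSmooth
  rw [l2_sq_eq (contDiff_grad (hs.contDiff_slice ht)).continuous]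
  refine HasInt.eq ?_
  refine (HasInt.sum Finset.univ fun k _ => HasInt.sum Finset.univ fun i _ =>
    ((hu.regular_comp k).dx i).hasInt_mul ((hu.regular_comp k).dx i) ht).congr fun x => ?_
  rw [norm_grad_sq, Finset.sum_comm]
  refine Finset.sum_congr rfl fun i _ => ?_
  rw [norm_sq_eq]
  refine Finset.sum_congr rfl fun k _ => ?_
  rw [dx_comp hs k i ht, sq]
  rfl

theorem SobolevSmooth.l2_grad_grad_sq (hu : SobolevSmooth u) (ht : 0 ≤ t) :
    l2 (grad (grad (u t))) ^ 2 = hessian (comp u) t := by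
  have hs := hu.isSmooth
  rw [l2_sq_eq (contDiff_grad (contDiff_grad (hs.contDiff_slice ht))).continuous]
  refine HasInt.eq ?_
  refine (HasInt.sum Finset.univ fun k _ => HasInt.sum Finset.univ fun j _ =>
    HasInt.sum Finset.univ fun i _ => (((hu.regular_comp k).dx j).dx i).hasInt_mul
      (((hu.regular_comp k).dx j).dx i) ht).congr fun x => ?_
  rw [norm_grad_grad_sq (hs.contDiff_slice ht)]
  simp only [dx_dx_comp hs _ _ _ ht]
  simp only [norm_sq_eq, ← sq, dx_dx_apply, Fin.sum_univ_two]
  ring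

theorem IsSmoothSolution.energy_eq (hS : IsSmoothSolution ρ u P) {w : ℝ → Plane → Plane}
    (hw : SobolevSmooth w) (ht : 0 ≤ t) :
    ∫ x, ρ t x * ‖w t x‖ ^ 2 = energy (fun t x => ρ t x - 1) (comp w) t := by
  have hr := hS.regular_rho.regular
  refine HasInt.eq ?_
  refine (HasInt.sum Finset.univ fun k _ => ((hw.regular_comp k).add
    (hr.mul (hw.regular_comp k))).hasInt_mul (hw.regular_comp k) ht).congr fun x => ?_
  rw [norm_sq_eq, Finset.mul_sum]
  refine Finset.sum_congr rfl fun k _ => ?_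
  simp only [comp]; ring

theorem IsSmoothSolution.continuous_rho (hS : IsSmoothSolution ρ u P) (ht : 0 ≤ t) :
    Continuous (ρ t) := by
  have h := (hS.regular_rho.isSmooth.contDiff_slice ht).continuous
  exact (h.add (continuous_const (y := (1 : ℝ)))).congr fun x => sub_add_cancel _ _

theorem IsSmoothSolution.E0_eq (hS : IsSmoothSolution ρ u P) :
    E0 ρ u = energy (fun t x => ρ t x - 1) (comp u) 0 :=
  hS.energy_eq hS.regular_u le_rfl

theorem IsSmoothSolution.E1_eq (hS : IsSmoothSolution ρ u P) : E1 u = dirichlet (comp u) 0 :=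
  hS.regular_u.l2_grad_sq le_rfl

theorem IsSmoothSolution.E2_eq (hS : IsSmoothSolution ρ u P) :
    E2 ρ u = energy (fun t x => ρ t x - 1) (fun k => tderiv (comp u k)) 0
      + dirichlet (comp u) 0 ^ 2 := by
  have hu := hS.regular_u
  have h1 : l2 (fun x => Real.sqrt (ρ 0 x) • tderiv u 0 x) ^ 2 = ∫ x, ρ 0 x * ‖tderiv u 0 x‖ ^ 2 := by
    have hc : Continuous (fun x => Real.sqrt (ρ 0 x) • tderiv u 0 x) :=
      (hS.continuous_rho le_rfl).sqrt.smul (hu.tderiv.isSmooth.contDiff_slice le_rfl).continuous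
    rw [l2_sq_eq hc]
    refine integral_congr_ae (Eventually.of_forall fun x => ?_)
    simp only [norm_smul, mul_pow, Real.norm_eq_abs, sq_abs]
    rw [Real.sq_sqrt (hS.rho_pos 0 le_rfl x).le]
  have h2 : l2 (grad (u 0)) ^ 4 = dirichlet (comp u) 0 ^ 2 := by
    rw [← hu.l2_grad_sq le_rfl]; ring
  rw [E2, h1, h2, hS.energy_eq hu.tderiv le_rfl, energy, energy]
  simp only [tderiv_comp hu.isSmooth _ le_rfl]
  rfl

theorem sum_moment_le (hx : Integrable (fun x => ‖x‖ * ‖u 0 x‖)) (hu : Continuous (u 0)) :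
    (∀ k, Integrable (fun x => ‖x‖ * |comp u k 0 x|)) ∧
      ∑ k, ∫ x, ‖x‖ * |comp u k 0 x| ≤ 2 * U0 u := by
  have hle : ∀ k x, ‖x‖ * |comp u k 0 x| ≤ ‖x‖ * ‖u 0 x‖ := fun k x =>
    mul_le_mul_of_nonneg_left (abs_apply_le _ k) (norm_nonneg _)
  have hc : ∀ k, Continuous (fun x => comp u k 0 x) := fun k => by unfold comp; fun_prop
  have hi : ∀ k, Integrable (fun x => ‖x‖ * |comp u k 0 x|) := fun k => by
    have := hc k
    refine hx.mono' (Continuous.aestronglyMeasurable (by fun_prop)) (Eventually.of_forall fun x => ?_)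
    rw [norm_mul, norm_norm, Real.norm_eq_abs, abs_abs]
    exact hle k x
  refine ⟨hi, ?_⟩
  have h := fun k => integral_mono (hi k) hx (hle k)
  rw [Fin.sum_univ_two, U0]
  linarith [h 0, h 1]

end Conversion

section Main

variable {ρ : ℝ → Plane → ℝ} {u : ℝ → Plane → Plane} {P : ℝ → Plane → ℝ} {t : ℝ}

theorem AdmissibleData.abs_sub_one_le {ρ₀ : Plane → ℝ} {u₀ : Plane → Plane}
    (hA : AdmissibleData ρ₀ u₀) (x : Plane) : |ρ₀ x - 1| ≤ 1 / 4 := by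
  have := hA.density x
  rw [abs_le]; constructor <;> linarith

theorem IsSmoothSolution.integrable_momentum (hS : IsSmoothSolution ρ u P)
    (hA : AdmissibleData (ρ 0) (u 0)) : Integrable (fun x => ρ 0 x • u 0 x) := by
  have hcu := (hS.regular_u.isSmooth.contDiff_slice le_rfl).continuous
  have hc : Continuous (fun x => ρ 0 x • u 0 x) := (hS.continuous_rho le_rfl).smul hcu
  have h1 : IntegrableOn (fun x => ρ 0 x • u 0 x) (Metric.closedBall 0 1) :=
    hc.continuousOn.integrableOn_compact (isCompact_closedBall 0 1)
  have h2 : IntegrableOn (fun x => ρ 0 x • u 0 x) (Metric.closedBall 0 1)ᶜ := by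
    refine Integrable.mono' (hA.moment.const_mul (5 / 4)).integrableOn hc.aestronglyMeasurable ?_
    refine (ae_restrict_iff' measurableSet_closedBall.compl).2 (Eventually.of_forall fun x hx => ?_)
    have h1 : 1 ≤ ‖x‖ := by
      simp only [mem_compl_iff, Metric.mem_closedBall, dist_zero_right, not_le] at hx
      exact hx.le
    have h2 := hA.density x
    rw [norm_smul, Real.norm_eq_abs, abs_of_pos (hS.rho_pos 0 le_rfl x)]
    refine mul_le_mul h2.2 ?_ (norm_nonneg _) (by norm_num)
    exact le_mul_of_one_le_left (norm_nonneg _) h1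
  rw [← integrableOn_univ, ← union_compl_self (Metric.closedBall (0 : Plane) 1)]
  exact h1.union h2

theorem IsSmoothSolution.mean_zero (hS : IsSmoothSolution ρ u P) (hA : AdmissibleData (ρ 0) (u 0))
    (k : Fin 2) : ∫ x, (comp u k 0 x + (ρ 0 x - 1) * comp u k 0 x) = 0 := by
  have h := (EuclideanSpace.proj k : Plane →L[ℝ] ℝ).integral_comp_comm (hS.integrable_momentum hA)
  rw [hA.mean_zero, map_zero] at h
  refine Eq.trans (integral_congr_ae (Eventually.of_forall fun x => ?_)) h
  simp [comp]
  ring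

theorem energy_tderiv_eq_zero {r : ℝ → Plane → ℝ} {v : Fin 2 → ℝ → Plane → ℝ}
    (h : ∀ k t, 0 ≤ t → v k t = fun _ => 0) : energy r (fun k => tderiv (v k)) 0 = 0 := by
  have h0 : ∀ k, tderiv (v k) 0 = fun _ => 0 := fun k => by
    rw [← Flow.tderiv_zero_fun 0]
    exact tderiv_congr (fun s hs => h k s hs) le_rfl
  simp [energy, h0]

theorem dirichlet_eq_zero {v : Fin 2 → ℝ → Plane → ℝ} (h : ∀ k, v k 0 = fun _ => 0) :
    dirichlet v 0 = 0 := by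
  simp [dirichlet, dx, h]

theorem eq_zero_of_sqNorm {v : Fin 2 → ℝ → Plane → ℝ} (hv : ∀ k, Regular (v k)) (ht : 0 ≤ t)
    (h : sqNorm v t = 0) (k : Fin 2) : v k t = fun _ => 0 := by
  have h1 : ∫ x, v k t x ^ 2 = 0 :=
    (Finset.sum_eq_zero_iff_of_nonneg fun _ _ => integral_nonneg fun _ => sq_nonneg _).1 h k
      (Finset.mem_univ k)
  rw [integral_eq_zero_iff_of_nonneg (fun _ => sq_nonneg _) ((hv k).memLp ht).integrable_sq] at h1
  have hc : Continuous (fun x => v k t x ^ 2) := ((hv k).h1 ht).contDiff.continuous.pow 2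
  have h2 := (hc.ae_eq_iff_eq volume continuous_const).1 h1
  funext x
  exact pow_eq_zero_iff two_ne_zero |>.1 (congrFun h2 x)

namespace Flow

variable {r : ℝ → Plane → ℝ} {v p : Fin 2 → ℝ → Plane → ℝ}

theorem energy_eq_zero_of_dirichlet (H : Flow r v p) (hr0 : ∀ x, |r 0 x| ≤ 1 / 4)
    (hx : ∀ k, Integrable (fun x => ‖x‖ * |v k 0 x|))
    (hmean : ∀ k, ∫ x, (v k 0 x + r 0 x * v k 0 x) = 0) (hZ : dirichlet v 0 = 0) :
    energy r v 0 = 0 := by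
  set c := (2 + 150 * smearConst ^ 2) * (∑ k, ∫ x, ‖x‖ * |v k 0 x|) ^ 2
  have h : ∀ b : ℝ, 0 < b → sqNorm v 0 ≤ c * b⁻¹ ^ 4 := fun b hb => by
    have := H.sqNorm_le hr0 hx hmean le_rfl hb
    rw [hZ, intervalIntegral.integral_same] at this
    refine this.trans (le_of_eq ?_)
    simp only [c]; ring
  have hlim : Tendsto (fun b : ℝ => c * b⁻¹ ^ 4) atTop (𝓝 (c * 0 ^ 4)) :=
    (tendsto_inv_atTop_zero.pow 4).const_mul c
  have h0 : sqNorm v 0 ≤ 0 := by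
    have := ge_of_tendsto hlim ((eventually_gt_atTop 0).mono h)
    simpa using this
  have h1 := (energy_bounds H.reg_r H.reg_v le_rfl hr0).2
  have h2 := energy_nonneg H.reg_r H.reg_v le_rfl hr0
  linarith

theorem initial_eq_zero (H : Flow r v p) (hr0 : ∀ x, |r 0 x| ≤ 1 / 4) (hE : energy r v 0 = 0) :
    (∀ k, v k 0 = fun _ => 0) ∧ energy r (fun k => tderiv (v k)) 0 = 0 := by
  have hz : ∀ k t, 0 ≤ t → v k t = fun _ => 0 := fun k t ht => by
    refine eq_zero_of_sqNorm H.reg_v ht ?_ k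
    have := H.sqNorm_le_of_energy hr0 hE.le ht
    linarith [sqNorm_nonneg v t]
  exact ⟨fun k => hz k 0 le_rfl, energy_tderiv_eq_zero hz⟩

end Flow

theorem add_add_le_sqrt {a b c : ℝ} : a + b + c ≤ Real.sqrt (3 * (a ^ 2 + b ^ 2 + c ^ 2)) := by
  refine Real.le_sqrt_of_sq_le ?_
  linarith [sq_nonneg (a - b), sq_nonneg (a - c), sq_nonneg (b - c), sq_nonneg (a + b + c),
    show (a + b + c) ^ 2 + (a - b) ^ 2 + (a - c) ^ 2 + (b - c) ^ 2 = 3 * (a ^ 2 + b ^ 2 + c ^ 2) by ring]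

theorem IsSmoothSolution.exists_decay (M : ℝ) : ∃ L, 0 ≤ L ∧
    ∀ (ρ : ℝ → Plane → ℝ) (u : ℝ → Plane → Plane) (P : ℝ → Plane → ℝ), IsSmoothSolution ρ u P →
      AdmissibleData (ρ 0) (u 0) → E0 ρ u ≤ M → ∀ T, T2 ρ u ≤ T → ∀ t, 0 ≤ t →
      l2 (tderiv u t) + l2 (grad (grad (u t))) + l2 (gradient (P t)) ≤
        L * (Real.sqrt (E2 ρ u) * (bracket T t ^ 2)⁻¹) := by
  obtain ⟨L, hL0, hL⟩ := Flow.exists_decay M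
  refine ⟨Real.sqrt (3 * L), Real.sqrt_nonneg _, ?_⟩
  intro ρ u P hS hA hM T hT t ht
  have H := hS.flow
  have hr0 := hA.abs_sub_one_le
  obtain ⟨hx, hU⟩ := sum_moment_le hA.moment (hS.regular_u.isSmooth.contDiff_slice le_rfl).continuous
  have hmean := hS.mean_zero hA
  have hE0 := Flow.energy_nonneg H.reg_r H.reg_v le_rfl hr0
  have hE1 := dirichlet_nonneg (comp u) 0
  rw [hS.E0_eq] at hM
  have hsum := (add_add_le_sqrt (a := l2 (tderiv u t)) (b := l2 (grad (grad (u t))))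
    (c := l2 (gradient (P t))))
  rw [hS.regular_u.l2_tderiv_sq ht, hS.regular_u.l2_grad_grad_sq ht,
    hS.regular_gradP.l2_sq ht] at hsum
  set S := sqNorm (fun k => tderiv (comp u k)) t + hessian (comp u) t
    + sqNorm (comp fun t x => gradient (P t) x) t with hSdef
  refine hsum.trans ?_
  have hR0 : l2 (fun x => ρ 0 x - 1) ^ 2 = ∫ x, (ρ 0 x - 1) * (ρ 0 x - 1) := by
    rw [l2_sq_eq (H.reg_r.h1 le_rfl).contDiff.continuous]
    simp only [Real.norm_eq_abs, sq_abs]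
    simp only [sq]
  have hT0 : ∫ x, (ρ 0 x - 1) * (ρ 0 x - 1) ≤ T :=
    hR0 ▸ (le_max_right _ _).trans ((le_max_left _ _).trans ((le_max_left _ _).trans hT))
  rcases hE0.eq_or_lt with h0 | hpos
  · have hS0 : S ≤ 0 := by
      obtain ⟨hz, hW⟩ := H.initial_eq_zero hr0 h0.symm
      have h := hL _ _ _ H hr0 hx hmean hM (T + 1) (by
        have : (0 : ℝ) ≤ ∫ x, (ρ 0 x - 1) * (ρ 0 x - 1) := integral_nonneg fun _ => mul_self_nonneg _
        linarith) (by simp [hz, ← h0]) (by linarith) (by rw [← h0, dirichlet_eq_zero hz, mul_zero]) t ht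
      rw [hW, dirichlet_eq_zero hz] at h
      have hb : 0 < bracket (T + 1) t ^ 4 := by
        have : (0 : ℝ) ≤ ∫ x, (ρ 0 x - 1) * (ρ 0 x - 1) := integral_nonneg fun _ => mul_self_nonneg _
        have h3 : 0 < T + 1 := by linarith
        unfold bracket; positivity
      by_contra hc
      push Not at hc
      have := mul_pos hb hc
      norm_num at h
      linarith
    rw [Real.sqrt_eq_zero_of_nonpos (by linarith)]
    positivity
  have hZpos : 0 < dirichlet (comp u) 0 := by
    refine hE1.lt_of_ne fun h => hpos.ne' ?_
    exact H.energy_eq_zero_of_dirichlet hr0 hx hmean h.symm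
  have hT1 : E0 ρ u / E1 u ≤ T := (le_max_right _ _).trans ((le_max_left _ _).trans hT)
  have hT2 : U0 u / E0 ρ u ≤ T :=
    (le_max_left _ _).trans ((le_max_left _ _).trans ((le_max_left _ _).trans hT))
  rw [hS.E0_eq, hS.E1_eq] at hT1
  rw [hS.E0_eq] at hT2
  have hTpos : 0 < T := (div_pos hpos hZpos).trans_le hT1
  rw [div_le_iff₀ hZpos] at hT1
  rw [div_le_iff₀ hpos] at hT2
  have h := hL _ _ _ H hr0 hx hmean hM T hTpos (by linarith) hT0 hT1 t ht
  rw [← hS.E2_eq] at h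
  have hb : 0 < bracket T t := by unfold bracket; positivity
  have hE2 : 0 ≤ E2 ρ u := by unfold E2; positivity
  calc Real.sqrt (3 * S) = Real.sqrt (bracket T t ^ 4 * (3 * S)) * (bracket T t ^ 2)⁻¹ := by
        rw [show bracket T t ^ 4 = (bracket T t ^ 2) ^ 2 by ring,
          Real.sqrt_mul (sq_nonneg (bracket T t ^ 2)) (3 * S), Real.sqrt_sq (by positivity)]
        field_simp
    _ ≤ Real.sqrt (3 * L * E2 ρ u) * (bracket T t ^ 2)⁻¹ := by
        refine mul_le_mul_of_nonneg_right (Real.sqrt_le_sqrt ?_) (by positivity)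
        linarith
    _ = _ := by rw [Real.sqrt_mul (by positivity), mul_assoc]

end Main

end

end INS2D

theorem stmt_9 :
    ∃ C : ℝ → ℝ, Monotone C ∧
      ∀ (ρ : ℝ → INS2D.Plane → ℝ) (u : ℝ → INS2D.Plane → INS2D.Plane) (P : ℝ → INS2D.Plane → ℝ),
        INS2D.IsSmoothSolution ρ u P → INS2D.AdmissibleData (ρ 0) (u 0) →
        ∀ T : ℝ, INS2D.T2 ρ u ≤ T → ∀ t : ℝ, 0 ≤ t →
          INS2D.l2 (INS2D.tderiv u t) + INS2D.l2 (INS2D.grad (INS2D.grad (u t)))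
              + INS2D.l2 (gradient (P t))
            ≤ C (INS2D.E0 ρ u) * (Real.sqrt (INS2D.E2 ρ u) * (INS2D.bracket T t ^ 2)⁻¹) := by
  choose L hL0 hL using INS2D.IsSmoothSolution.exists_decay
  refine ⟨fun E => ∑ n ∈ Finset.range (⌈E⌉₊ + 1), L n, fun a b hab => ?_, ?_⟩
  · refine Finset.sum_le_sum_of_subset_of_nonneg (Finset.range_subset_range.2 ?_)
      fun n _ _ => hL0 n
    exact Nat.succ_le_succ (Nat.ceil_mono hab)
  · intro ρ u P hS hA T hT t ht
    refine (hL _ ρ u P hS hA (Nat.le_ceil (INS2D.E0 ρ u)) T hT t ht).trans ?_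
    refine mul_le_mul_of_nonneg_right ?_ (by positivity)
    exact Finset.single_le_sum (f := fun n : ℕ => L n) (fun n _ => hL0 n)
      (Finset.mem_range.2 (Nat.lt_succ_self _))
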